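/- arXiv:1412.0882 — 4 statements merged into one kernel-verified Lean document; each statement's English description precedes it below -/
import Mathlib

section
/- Write M₀ = π([0,β)). There exists a constant K > 1 such that for all integers n ≥ 0 and k ≥ 0, M₀·(1−p)^k·p^{g(n,k)} ≤ π([nβ/α^k, (n+1)β/α^k)) ≤ M₀·K·((1−p)/(1−p^{α−1}))^k·p^{g(n,k)}. -/
open MeasureTheory Set

/-- `g(n,k) = n·α + (1-α)·Σ_{i=0}^{k} ⌊n/α^i⌋`. -/
def g (α n k : ℕ) : ℤ :=
  (n : ℤ) * α + (1 - (α : ℤ)) * ∑ i ∈ Finset.range (k + 1), ((n / α ^ i : ℕ) : ℤ)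

lemma aux_g_add (α n k : ℕ) (hα : 2 ≤ α) :
    g α (n + α ^ k) k = g α n k + 1 := by
  unfold g
  have hpos : ∀ i, 0 < α ^ i := fun i => by positivity
  have h1 : ∀ i ∈ Finset.range (k + 1), (((n + α ^ k) / α ^ i : ℕ) : ℤ)
      = ((n / α ^ i : ℕ) : ℤ) + (α : ℤ) ^ (k + 1 - 1 - i) := by
    intro i hi
    have hi' : i ≤ k := by simpa [Nat.lt_succ_iff] using hi
    have : α ^ k = α ^ i * α ^ (k - i) := by rw [← pow_add]; congr 1; omega
    rw [this, Nat.add_mul_div_left _ _ (hpos i)]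
    push_cast
    simp
  rw [Finset.sum_congr rfl h1, Finset.sum_add_distrib,
    Finset.sum_range_reflect (fun j => (α : ℤ) ^ j) (k + 1)]
  have h2 := geom_sum_mul (α : ℤ) (k + 1)
  push_cast
  have h3 : (1 - (α : ℤ)) * ∑ i ∈ Finset.range (k + 1), (α : ℤ) ^ i = 1 - (α : ℤ) ^ (k + 1) := by
    linarith
  rw [mul_add, h3]
  ring

lemma aux_g_succ (α n k : ℕ) :
    g α n k = g α n (k + 1) + ((α : ℤ) - 1) * ((n / α ^ (k + 1) : ℕ) : ℤ) := by
  unfold g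
  rw [Finset.sum_range_succ _ (k + 1)]
  ring

lemma aux_g_zero (α n : ℕ) : g α n 0 = n := by
  unfold g
  simp
  ring

lemma aux_T_bound (α : ℕ) (hα : 2 ≤ α) (p : ℝ) (hp0 : 0 < p) (hp : p ≤ 1 / 2) (T : ℕ → ℝ)
    (hT1 : ∀ n, T n ≤ 1)
    (hlim : Filter.Tendsto T Filter.atTop (nhds 0))
    (hrec : ∀ n, T (n + 1) = p * T n + (1 - p) * T (α * (n + 1))) (n : ℕ) :
    T n ≤ 2 * (p ^ 5)⁻¹ * p ^ n := by
  set f : ℕ → ℝ := fun n => (p ^ 5)⁻¹ * p ^ n * (2 - (3 / 4) ^ n) with hf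
  have hq : ∀ n : ℕ, ((3 : ℝ) / 4) ^ n ≤ 1 := fun n => pow_le_one₀ (by norm_num) (by norm_num)
  have hq0 : ∀ n : ℕ, 0 < ((3 : ℝ) / 4) ^ n := fun n => by positivity
  have hfpos : ∀ n, 0 < f n := fun n => by
    have := hq n
    have : 0 < 2 - ((3 : ℝ) / 4) ^ n := by linarith
    positivity
  have hsmall : ∀ n, n ≤ 5 → T n ≤ f n := by
    intro n hn
    refine (hT1 n).trans ?_
    have h1 : p ^ 5 ≤ p ^ n := pow_le_pow_of_le_one hp0.le (by linarith) hn
    have h2 : 1 ≤ (p ^ 5)⁻¹ * p ^ n := by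
      rw [← div_eq_inv_mul, le_div_iff₀ (by positivity)]; linarith
    have h3 := hq n
    simp only [hf]
    nlinarith
  have hsuper : ∀ n, 4 ≤ n → p * f n + (1 - p) * f (α * (n + 1)) < f (n + 1) := by
    intro n hn
    have hC : 0 < (p ^ 5)⁻¹ := by positivity
    have e1 : p ^ (α * (n + 1)) ≤ p ^ (n + 1) * (1 / 2) ^ (n + 1) := by
      calc p ^ (α * (n + 1)) ≤ p ^ (2 * (n + 1)) :=
            pow_le_pow_of_le_one hp0.le (by linarith) (by gcongr)
        _ = p ^ (n + 1) * p ^ (n + 1) := by ring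
        _ ≤ _ := by gcongr
    have e2 : ((1 : ℝ) / 2) ^ (n + 1) * 6 < (3 / 4) ^ (n + 1) := by
      have h15 : (6 : ℝ) < (3 / 2) ^ (n + 1) := by
        calc (6 : ℝ) < (3 / 2) ^ 5 := by norm_num
          _ ≤ (3 / 2) ^ (n + 1) := by
            apply pow_le_pow_right₀ (by norm_num); omega
      have : ((3 : ℝ) / 4) ^ (n + 1) = (1 / 2) ^ (n + 1) * (3 / 2) ^ (n + 1) := by
        rw [← mul_pow]; norm_num
      rw [this]
      gcongr
    have e3 : (1 - p) * f (α * (n + 1)) ≤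
        (p ^ 5)⁻¹ * (p ^ (n + 1) * (1 / 2) ^ (n + 1)) * 2 := by
      calc (1 - p) * f (α * (n + 1)) ≤ 1 * f (α * (n + 1)) :=
            mul_le_mul_of_nonneg_right (by linarith) (hfpos _).le
        _ = (p ^ 5)⁻¹ * p ^ (α * (n + 1)) * (2 - (3 / 4) ^ (α * (n + 1))) := by simp [hf]
        _ ≤ _ := by
          have := hq0 (α * (n + 1))
          have := hq (α * (n + 1))
          apply mul_le_mul
          · gcongr
          · linarith
          · linarith
          · positivity
    have e4 : 0 < (p ^ 5)⁻¹ * p ^ (n + 1) := by positivity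
    have e5 : f (n + 1) - p * f n = (p ^ 5)⁻¹ * p ^ (n + 1) * ((3 / 4) ^ (n + 1) / 3) := by
      simp only [hf]
      ring
    have e6 : (p ^ 5)⁻¹ * p ^ (n + 1) * (2 * (1 / 2) ^ (n + 1)) <
        (p ^ 5)⁻¹ * p ^ (n + 1) * ((3 / 4) ^ (n + 1) / 3) := by
      apply mul_lt_mul_of_pos_left _ e4
      linarith
    nlinarith
  have main : ∀ n, T n ≤ f n := by
    by_contra hcon
    push Not at hcon
    obtain ⟨n1, hn1⟩ := hcon
    have hev : ∀ᶠ n in Filter.atTop, T n < T n1 - f n1 :=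
      hlim.eventually (gt_mem_nhds (by linarith))
    obtain ⟨N, hN⟩ := Filter.eventually_atTop.1 hev
    obtain ⟨m, hm, hmax⟩ := Finset.exists_max_image (Finset.range (N + n1 + 1))
      (fun n => T n - f n) ⟨0, by simp⟩
    have hm1 : T n1 - f n1 ≤ T m - f m := hmax n1 (Finset.mem_range.2 (by omega))
    have hall : ∀ n, T n - f n ≤ T m - f m := by
      intro n
      by_cases h : n < N + n1 + 1
      · exact hmax n (by simpa using h)
      · have := hN n (by omega)
        have := hfpos n
        linarith
    have hm5 : 5 < m := by
      by_contra h
      have := hsmall m (by omega)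
      linarith
    obtain ⟨j, rfl⟩ : ∃ j, m = j + 1 := ⟨m - 1, by omega⟩
    have a1 := hall j
    have a2 := hall (α * (j + 1))
    have a3 := hsuper j (by omega)
    have a4 := hrec j
    have b1 := mul_le_mul_of_nonneg_left a1 hp0.le
    have b2 := mul_le_mul_of_nonneg_left a2 (show 0 ≤ 1 - p by linarith)
    nlinarith
  refine (main n).trans ?_
  have := hq0 n
  have h : 0 < (p ^ 5)⁻¹ * p ^ n := by positivity
  simp only [hf]
  nlinarith

lemma aux_T_one (α : ℕ) (hα : 2 ≤ α) (p : ℝ) (hp0 : 0 < p) (hp : p ≤ 1 / 2) (T : ℕ → ℝ)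
    (hT1 : ∀ n, T n ≤ 1)
    (hlim : Filter.Tendsto T Filter.atTop (nhds 0))
    (hrec : ∀ n, T (n + 1) = p * T n + (1 - p) * T (α * (n + 1))) : T 1 < 1 := by
  by_contra hcon
  have h1 : T 1 = 1 := le_antisymm (hT1 1) (not_lt.1 hcon)
  have h2 : ∀ k, T (α ^ k) = 1 := by
    intro k
    induction k with
    | zero => simpa using h1
    | succ k ih =>
      have hpos : 0 < α ^ k := by positivity
      obtain ⟨j, hj⟩ : ∃ j, α ^ k = j + 1 := ⟨α ^ k - 1, by omega⟩
      have h3 := hrec j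
      rw [← hj, ih, ← pow_succ'] at h3
      have h4 := hT1 j
      have h5 := hT1 (α ^ (k + 1))
      apply le_antisymm h5
      by_contra h6
      push Not at h6
      nlinarith
  have h3 := hlim.comp (tendsto_pow_atTop_atTop_of_one_lt (show 1 < α by omega))
  have h4 : (T ∘ fun k => α ^ k) = fun _ => 1 := funext h2
  rw [h4] at h3
  exact zero_ne_one (tendsto_nhds_unique h3 tendsto_const_nhds)

lemma aux_lower (α : ℕ) (hα : 2 ≤ α) (p : ℝ) (hp0 : 0 < p) (hp : p ≤ 1 / 2) (m : ℕ → ℕ → ℝ)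
    (hm0 : ∀ n k, 0 ≤ m n k)
    (h0 : ∀ n, p * m n 0 ≤ m (n + 1) 0)
    (R1 : ∀ n k, n < α ^ (k + 1) → m n (k + 1) = (1 - p) * m n k)
    (R2 : ∀ n k, m (n + α ^ (k + 1)) (k + 1) = p * m n (k + 1) + (1 - p) * m (n + α ^ (k + 1)) k)
    (k : ℕ) : ∀ n, (1 - p) ^ k * p ^ (g α n k) * m 0 0 ≤ m n k := by
  induction k with
  | zero =>
    intro n
    simp only [aux_g_zero, pow_zero, one_mul, zpow_natCast]
    induction n with
    | zero => simp
    | succ n ih =>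
      refine le_trans ?_ (h0 n)
      rw [pow_succ', mul_assoc]
      gcongr
  | succ k ihk =>
    intro n
    induction n using Nat.strong_induction_on with
    | _ n ih =>
      by_cases h : n < α ^ (k + 1)
      · rw [R1 n k h]
        have := ihk n
        rw [aux_g_succ, Nat.div_eq_of_lt h] at this
        simp only [Nat.cast_zero, mul_zero, add_zero] at this
        rw [pow_succ', mul_assoc, mul_assoc, ← mul_assoc ((1 - p) ^ k)]
        exact mul_le_mul_of_nonneg_left this (by linarith)
      · push Not at h
        obtain ⟨j, rfl⟩ := Nat.exists_eq_add_of_le' h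
        have hpos : 0 < α ^ (k + 1) := by positivity
        have h1 := mul_le_mul_of_nonneg_left (ih j (by omega)) hp0.le
        rw [R2, aux_g_add α j (k + 1) hα, zpow_add₀ hp0.ne', zpow_one]
        have h2 := mul_nonneg (show 0 ≤ 1 - p by linarith) (hm0 (j + α ^ (k + 1)) k)
        linarith

lemma aux_upper (α : ℕ) (hα : 2 ≤ α) (p : ℝ) (hp0 : 0 < p) (hp : p ≤ 1 / 2) (m : ℕ → ℕ → ℝ)
    (K : ℝ) (hK : 0 ≤ K)
    (h0 : ∀ n, m n 0 ≤ K * p ^ n)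
    (R1 : ∀ n k, n < α ^ (k + 1) → m n (k + 1) = (1 - p) * m n k)
    (R2 : ∀ n k, m (n + α ^ (k + 1)) (k + 1) = p * m n (k + 1) + (1 - p) * m (n + α ^ (k + 1)) k)
    (k : ℕ) : ∀ n, m n k ≤ K * ((1 - p) / (1 - p ^ (α - 1))) ^ k * p ^ (g α n k) := by
  have hs0 : 0 < p ^ (α - 1) := by positivity
  have hs1 : p ^ (α - 1) < 1 := pow_lt_one₀ hp0.le (by linarith) (by omega)
  set s := p ^ (α - 1) with hs
  have hgs : ∀ n k, p ^ (g α n k) = p ^ (g α n (k + 1)) * s ^ (n / α ^ (k + 1)) := by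
    intro n k
    rw [aux_g_succ, zpow_add₀ hp0.ne', hs, ← pow_mul, ← zpow_natCast p]
    congr 2
    push_cast [Nat.cast_sub (show 1 ≤ α by omega)]
    ring
  induction k with
  | zero =>
    intro n
    simpa [aux_g_zero] using h0 n
  | succ k ihk =>
    set A := K * ((1 - p) / (1 - s)) ^ k with hA
    have hA0 : 0 ≤ A := by
      have : 0 < (1 - p) / (1 - s) := div_pos (by linarith) (by linarith)
      positivity
    have key : ∀ n, (1 - s) * m n (k + 1) ≤
        A * (1 - p) * p ^ (g α n (k + 1)) * (1 - s ^ (n / α ^ (k + 1) + 1)) := by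
      intro n
      have hpos : 0 < α ^ (k + 1) := by positivity
      induction n using Nat.strong_induction_on with
      | _ n ih =>
        have hb := mul_le_mul_of_nonneg_left (ihk n) (show 0 ≤ (1 - s) * (1 - p) from
          mul_nonneg (by linarith) (by linarith))
        rw [hgs] at hb
        by_cases h : n < α ^ (k + 1)
        · rw [R1 n k h]
          rw [Nat.div_eq_of_lt h] at hb ⊢
          simp only [pow_zero, zero_add, pow_one] at hb ⊢
          linarith
        · push Not at h
          obtain ⟨j, rfl⟩ := Nat.exists_eq_add_of_le' h
          have h1 := mul_le_mul_of_nonneg_left (ih j (by omega)) hp0.le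
          have hd : (j + α ^ (k + 1)) / α ^ (k + 1) = j / α ^ (k + 1) + 1 :=
            Nat.add_div_right _ hpos
          rw [R2]
          rw [hd] at hb ⊢
          rw [aux_g_add α j (k + 1) hα, zpow_add₀ hp0.ne', zpow_one] at hb ⊢
          rw [pow_succ s (j / α ^ (k + 1) + 1)]
          linarith
    intro n
    have hk := key n
    have h1 : 0 ≤ A * (1 - p) * p ^ (g α n (k + 1)) :=
      mul_nonneg (mul_nonneg hA0 (by linarith)) (by positivity)
    have h2 : 0 < s ^ (n / α ^ (k + 1) + 1) := by positivity
    have h3 : (1 - s) * m n (k + 1) ≤ A * (1 - p) * p ^ (g α n (k + 1)) := by nlinarith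
    have h4 : m n (k + 1) ≤ A * (1 - p) * p ^ (g α n (k + 1)) / (1 - s) := by
      rw [le_div_iff₀ (by linarith)]; linarith
    refine h4.trans (le_of_eq ?_)
    rw [hA]
    ring

/-- Lemma `inteq2`: writing `M₀ = π([0,β))`, there is `K > 1` such that for all
`n, k ≥ 0`,
`M₀·(1-p)^k·p^{g(n,k)} ≤ π([nβ/α^k, (n+1)β/α^k)) ≤ M₀·K·((1-p)/(1-p^{α-1}))^k·p^{g(n,k)}`. -/
theorem stmt5 (α β : ℕ) (hα : 2 ≤ α) (hβ : 1 ≤ β) (p : ℝ) (hp0 : 0 < p) (hp : p ≤ 1 / 2)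
    (π : Measure ℝ) [IsProbabilityMeasure π] (hsupp : π (Ici (0 : ℝ)) = 1)
    (hinv : ∀ A : Set ℝ, MeasurableSet A →
      π A = ENNReal.ofReal p * π ((fun y => y + (β : ℝ)) ⁻¹' A)
          + ENNReal.ofReal (1 - p) * π ((fun y => y / (α : ℝ)) ⁻¹' A)) :
    ∃ K : ℝ, 1 < K ∧ ∀ n k : ℕ,
      ENNReal.ofReal ((1 - p) ^ k * p ^ (g α n k)) * π (Ico (0 : ℝ) (β : ℝ)) ≤
          π (Ico ((n : ℝ) * β / (α : ℝ) ^ k) (((n : ℝ) + 1) * β / (α : ℝ) ^ k)) ∧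
        π (Ico ((n : ℝ) * β / (α : ℝ) ^ k) (((n : ℝ) + 1) * β / (α : ℝ) ^ k)) ≤
          ENNReal.ofReal (K * ((1 - p) / (1 - p ^ (α - 1))) ^ k * p ^ (g α n k)) *
            π (Ico (0 : ℝ) (β : ℝ)) := by
  have hα0 : (0 : ℝ) < α := by exact_mod_cast (show 0 < α by omega)
  have hβ0 : (0 : ℝ) < β := by exact_mod_cast (show 0 < β by omega)
  have hinvr : ∀ A : Set ℝ, MeasurableSet A →
      π.real A = p * π.real ((fun y => y + (β : ℝ)) ⁻¹' A)
          + (1 - p) * π.real ((fun y => y / (α : ℝ)) ⁻¹' A) := by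
    intro A hA
    simp only [Measure.real]
    rw [hinv A hA, ENNReal.toReal_add (ENNReal.mul_ne_top (by simp) (measure_ne_top _ _))
      (ENNReal.mul_ne_top (by simp) (measure_ne_top _ _)), ENNReal.toReal_mul, ENNReal.toReal_mul,
      ENNReal.toReal_ofReal hp0.le, ENNReal.toReal_ofReal (by linarith)]
  have hneg : π.real (Iio 0) = 0 := by
    have : π (Iio 0) = 0 := by
      rw [← compl_Ici, prob_compl_eq_zero_iff measurableSet_Ici]; exact hsupp
    simp [Measure.real, this]
  have hIco : ∀ a b : ℝ, π.real (Ico a b) =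
      p * π.real (Ico (a - β) (b - β)) + (1 - p) * π.real (Ico (α * a) (α * b)) := by
    intro a b
    rw [hinvr _ measurableSet_Ico]
    congr 3
    · congr 1; ext y; simp only [mem_preimage, mem_Ico]; constructor <;> rintro ⟨h1, h2⟩ <;>
        constructor <;> linarith
    · ext y; simp only [mem_preimage, mem_Ico]
      rw [le_div_iff₀ hα0, div_lt_iff₀ hα0, mul_comm a, mul_comm b]
  have hIci : ∀ a : ℝ, π.real (Ici a) =
      p * π.real (Ici (a - β)) + (1 - p) * π.real (Ici (α * a)) := by
    intro a
    rw [hinvr _ measurableSet_Ici]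
    have e1 : (fun y => y + (β : ℝ)) ⁻¹' Ici a = Ici (a - β) := by
      ext y; simp only [mem_preimage, mem_Ici]; constructor <;> intro h <;> linarith
    have e2 : (fun y => y / (α : ℝ)) ⁻¹' Ici a = Ici (α * a) := by
      ext y; simp only [mem_preimage, mem_Ici]
      rw [le_div_iff₀ hα0, mul_comm a]
    rw [e1, e2]
  set T : ℕ → ℝ := fun n => π.real (Ici ((n : ℝ) * β)) with hT
  set m : ℕ → ℕ → ℝ := fun n k =>
    π.real (Ico ((n : ℝ) * β / (α : ℝ) ^ k) (((n : ℝ) + 1) * β / (α : ℝ) ^ k)) with hm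
  have hT1 : ∀ n, T n ≤ 1 := fun n => measureReal_le_one
  have hrec : ∀ n, T (n + 1) = p * T n + (1 - p) * T (α * (n + 1)) := by
    intro n
    simp only [hT]
    rw [hIci]
    push_cast
    ring_nf
  have hlim : Filter.Tendsto T Filter.atTop (nhds 0) := by
    have h1 : Filter.Tendsto (fun n : ℕ => π (Ici ((n : ℝ) * β))) Filter.atTop
        (nhds (π (⋂ n : ℕ, Ici ((n : ℝ) * β)))) := by
      apply tendsto_measure_iInter_atTop
      · intro n; exact measurableSet_Ici.nullMeasurableSet
      · intro a b hab
        apply Ici_subset_Ici.2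
        gcongr
      · exact ⟨0, measure_ne_top _ _⟩
    have h2 : (⋂ n : ℕ, Ici ((n : ℝ) * β)) = ∅ := by
      ext x
      simp only [mem_iInter, mem_Ici, mem_empty_iff_false, iff_false, not_forall, not_le]
      obtain ⟨n, hn⟩ := exists_nat_gt (x / β)
      exact ⟨n, (div_lt_iff₀ hβ0).1 hn⟩
    rw [h2, measure_empty] at h1
    have := (ENNReal.tendsto_toReal ENNReal.zero_ne_top).comp h1
    simpa [hT, Measure.real, Function.comp_def] using this
  have hTb := aux_T_bound α hα p hp0 hp T hT1 hlim hrec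
  have hT1' := aux_T_one α hα p hp0 hp T hT1 hlim hrec
  have hmM : m 0 0 = π.real (Ico 0 (β : ℝ)) := by simp [hm]
  have hMpos : 0 < m 0 0 := by
    have h0 : T 0 = 1 := by simp [hT, Measure.real, hsupp]
    have h2 : T 0 = m 0 0 + T 1 := by
      rw [hmM]
      simp only [hT]
      rw [← measureReal_union _ measurableSet_Ici]
      · simp [Ico_union_Ici_eq_Ici hβ0.le]
      · rw [Set.disjoint_left]
        rintro x ⟨_, h⟩ h'
        simp at h'
        linarith
    linarith
  have R1 : ∀ n k, n < α ^ (k + 1) → m n (k + 1) = (1 - p) * m n k := by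
    intro n k h
    simp only [hm]
    rw [hIco]
    have hz : π.real (Ico ((n : ℝ) * β / (α : ℝ) ^ (k + 1) - β)
        (((n : ℝ) + 1) * β / (α : ℝ) ^ (k + 1) - β)) = 0 := by
      apply le_antisymm _ measureReal_nonneg
      rw [← hneg]
      refine measureReal_mono ?_ (measure_ne_top _ _)
      rintro x ⟨_, hx⟩
      have h' : (n : ℝ) + 1 ≤ (α : ℝ) ^ (k + 1) := by exact_mod_cast h
      have : ((n : ℝ) + 1) * β / (α : ℝ) ^ (k + 1) ≤ β := by
        rw [div_le_iff₀ (by positivity), mul_comm]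
        gcongr
      simp only [mem_Iio]
      linarith
    rw [hz, mul_zero, zero_add]
    congr 3 <;> (field_simp) <;> ring
  have R2 : ∀ n k, m (n + α ^ (k + 1)) (k + 1) =
      p * m n (k + 1) + (1 - p) * m (n + α ^ (k + 1)) k := by
    intro n k
    simp only [hm]
    rw [hIco]
    push_cast
    congr 4 <;> (field_simp) <;> ring
  have h0 : ∀ n, p * m n 0 ≤ m (n + 1) 0 := by
    intro n
    simp only [hm]
    rw [hIco (((n + 1 : ℕ) : ℝ) * β / (α : ℝ) ^ 0)]
    have e1 : ((n + 1 : ℕ) : ℝ) * β / (α : ℝ) ^ 0 - β = (n : ℝ) * β / (α : ℝ) ^ 0 := by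
      push_cast; simp; ring
    have e2 : (((n + 1 : ℕ) : ℝ) + 1) * β / (α : ℝ) ^ 0 - β = ((n : ℝ) + 1) * β / (α : ℝ) ^ 0 := by
      push_cast; simp; ring
    rw [e1, e2]
    have := mul_nonneg (show 0 ≤ 1 - p by linarith) (measureReal_nonneg (μ := π)
      (s := Ico (α * (((n + 1 : ℕ) : ℝ) * β / (α : ℝ) ^ 0))
        (α * ((((n + 1 : ℕ) : ℝ) + 1) * β / (α : ℝ) ^ 0))))
    linarith
  have hmT : ∀ n, m n 0 ≤ T n := by
    intro n
    simp only [hm, hT]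
    refine measureReal_mono ?_ (measure_ne_top _ _)
    rintro x ⟨hx, _⟩
    simpa using hx
  have hKpos : 0 < 2 * (p ^ 5)⁻¹ / m 0 0 := by positivity
  have hlow := aux_lower α hα p hp0 hp m (fun _ _ => measureReal_nonneg) h0 R1 R2
  have hup := aux_upper α hα p hp0 hp m ((2 * (p ^ 5)⁻¹ / m 0 0 + 1) * m 0 0) (by positivity)
    (by
      intro n
      refine (hmT n).trans ((hTb n).trans ?_)
      have : (2 * (p ^ 5)⁻¹ / m 0 0 + 1) * m 0 0 = 2 * (p ^ 5)⁻¹ + m 0 0 := by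
        field_simp
      rw [this]
      gcongr
      linarith) R1 R2
  refine ⟨2 * (p ^ 5)⁻¹ / m 0 0 + 1, by linarith, fun n k => ?_⟩
  rw [← ofReal_measureReal (μ := π) (s := Ico 0 (β : ℝ)), ← hmM,
    ← ofReal_measureReal (μ := π) (s := Ico ((n : ℝ) * β / (α : ℝ) ^ k) _)]
  change _ ≤ ENNReal.ofReal (m n k) ∧ ENNReal.ofReal (m n k) ≤ _
  rw [← ENNReal.ofReal_mul' hMpos.le, ← ENNReal.ofReal_mul' hMpos.le]
  constructor
  · exact ENNReal.ofReal_le_ofReal (hlow k n)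
  · apply ENNReal.ofReal_le_ofReal
    refine (hup k n).trans (le_of_eq ?_)
    ring
end

section
/- For every real x > 0, writing σ̲ = liminf_{n→∞} (1/n)·Σ_{i=1}^{n} δ_i^α(x/β), one has dim̲π(x) ≤ d̄(σ̲), i.e. the lower local dimension of π at x is at most d̄ of the lower asymptotic digit average of x/β in base α. (Upper inequality of the Lemma 'dimension'.) -/
open MeasureTheory Set Filter

/-- The `i`-th digit of the base-`b` expansion of `x·b^{-(⌊log_b x⌋+1)} ∈ [1/b,1)`. -/
noncomputable def digit (b : ℕ) (x : ℝ) (i : ℕ) : ℤ :=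
  ⌊(b : ℝ) ^ i * (x * (b : ℝ) ^ (-(⌊Real.log x / Real.log b⌋ + 1)))⌋ % b

/-- The lower local dimension `liminf_{r→0+} log π(B(x,r))/log r`. -/
noncomputable def lowerLocalDim (π : Measure ℝ) (x : ℝ) : ℝ :=
  liminf (fun r : ℝ => Real.log (π (Metric.ball x r)).toReal / Real.log r)
    (nhdsWithin 0 (Ioi 0))

/-- `d̄(y) = (log(1-p) + y·log p)/log(α⁻¹)`. -/
noncomputable def dBar (α : ℕ) (p y : ℝ) : ℝ :=
  (Real.log (1 - p) + y * Real.log p) / Real.log ((α : ℝ)⁻¹)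

section aux

variable {α β : ℕ} {p : ℝ} {π : Measure ℝ}

lemma aux_step_sub [IsProbabilityMeasure π] (hp0 : 0 < p) (hp : p ≤ 1 / 2)
    (hinv : ∀ A : Set ℝ, MeasurableSet A →
      π A = ENNReal.ofReal p * π ((fun y => y + (β : ℝ)) ⁻¹' A)
          + ENNReal.ofReal (1 - p) * π ((fun y => y / (α : ℝ)) ⁻¹' A)) (x r : ℝ) :
    p * π.real (Metric.ball (x - β) r) ≤ π.real (Metric.ball x r) := by
  have h := hinv (Metric.ball x r) Metric.isOpen_ball.measurableSet
  have e : (fun y => y + (β : ℝ)) ⁻¹' (Metric.ball x r) = Metric.ball (x - β) r := by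
    ext y
    simp only [mem_preimage, Metric.mem_ball, Real.dist_eq]
    rw [show y + (β : ℝ) - x = y - (x - β) by ring]
  have h2 : ENNReal.ofReal p * π (Metric.ball (x - β) r) ≤ π (Metric.ball x r) := by
    rw [h, e]; exact le_self_add
  have h3 := ENNReal.toReal_mono (measure_ne_top π _) h2
  rwa [ENNReal.toReal_mul, ENNReal.toReal_ofReal hp0.le] at h3

lemma aux_step_mul [IsProbabilityMeasure π] (hα : 2 ≤ α) (hp0 : 0 < p) (hp : p ≤ 1 / 2)
    (hinv : ∀ A : Set ℝ, MeasurableSet A →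
      π A = ENNReal.ofReal p * π ((fun y => y + (β : ℝ)) ⁻¹' A)
          + ENNReal.ofReal (1 - p) * π ((fun y => y / (α : ℝ)) ⁻¹' A)) (x r : ℝ) :
    (1 - p) * π.real (Metric.ball (α * x) (α * r)) ≤ π.real (Metric.ball x r) := by
  have h := hinv (Metric.ball x r) Metric.isOpen_ball.measurableSet
  have hα0 : (0 : ℝ) < α := by exact_mod_cast (by omega : 0 < α)
  have e : (fun y => y / (α : ℝ)) ⁻¹' (Metric.ball x r) = Metric.ball (α * x) (α * r) := by
    ext y
    simp only [mem_preimage, Metric.mem_ball, Real.dist_eq]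
    rw [show y / (α : ℝ) - x = (y - α * x) / α by field_simp, abs_div, abs_of_pos hα0,
      div_lt_iff₀ hα0, mul_comm r]
  have h2 : ENNReal.ofReal (1 - p) * π (Metric.ball (α * x) (α * r)) ≤ π (Metric.ball x r) := by
    rw [h, e]; exact le_add_self
  have h3 := ENNReal.toReal_mono (measure_ne_top π _) h2
  rwa [ENNReal.toReal_mul, ENNReal.toReal_ofReal (by linarith)] at h3

lemma aux_sub_pow [IsProbabilityMeasure π] (hp0 : 0 < p) (hp : p ≤ 1 / 2)
    (hinv : ∀ A : Set ℝ, MeasurableSet A →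
      π A = ENNReal.ofReal p * π ((fun y => y + (β : ℝ)) ⁻¹' A)
          + ENNReal.ofReal (1 - p) * π ((fun y => y / (α : ℝ)) ⁻¹' A)) (x r : ℝ) (N : ℕ) :
    p ^ N * π.real (Metric.ball (x - N * β) r) ≤ π.real (Metric.ball x r) := by
  induction N with
  | zero => simp
  | succ N ih =>
    refine le_trans ?_ ih
    have := aux_step_sub hp0 hp hinv (x - N * β) r
    rw [pow_succ, mul_assoc]
    refine mul_le_mul_of_nonneg_left ?_ (by positivity)
    rw [show x - ((N + 1 : ℕ) : ℝ) * β = x - N * β - β by push_cast; ring]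
    exact this

lemma aux_sub_fract [IsProbabilityMeasure π] (hp0 : 0 < p) (hp : p ≤ 1 / 2)
    (hinv : ∀ A : Set ℝ, MeasurableSet A →
      π A = ENNReal.ofReal p * π ((fun y => y + (β : ℝ)) ⁻¹' A)
          + ENNReal.ofReal (1 - p) * π ((fun y => y / (α : ℝ)) ⁻¹' A)) (z r : ℝ) (hz : 0 ≤ z) :
    p ^ ⌊z⌋₊ * π.real (Metric.ball (β * Int.fract z) r) ≤ π.real (Metric.ball (β * z) r) := by
  have := aux_sub_pow hp0 hp hinv (β * z) r ⌊z⌋₊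
  convert this using 4
  rw [Int.fract, ← natCast_floor_eq_intCast_floor hz]; ring

lemma aux_main [IsProbabilityMeasure π] (hα : 2 ≤ α) (hp0 : 0 < p) (hp : p ≤ 1 / 2)
    (hinv : ∀ A : Set ℝ, MeasurableSet A →
      π A = ENNReal.ofReal p * π ((fun y => y + (β : ℝ)) ⁻¹' A)
          + ENNReal.ofReal (1 - p) * π ((fun y => y / (α : ℝ)) ⁻¹' A)) (y r : ℝ) (hy : 0 ≤ y)
    (m : ℕ) :
    p ^ ⌊y⌋₊ * (1 - p) ^ m * p ^ (∑ j ∈ Finset.range m, ⌊(α : ℝ) * Int.fract ((α : ℝ) ^ j * y)⌋₊)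
      * π.real (Metric.ball (β * Int.fract ((α : ℝ) ^ m * y)) ((α : ℝ) ^ m * r))
      ≤ π.real (Metric.ball (β * y) r) := by
  have h1p : 0 < 1 - p := by linarith
  induction m with
  | zero => simpa using aux_sub_fract hp0 hp hinv y r hy
  | succ m ih =>
    refine le_trans ?_ ih
    set f := Int.fract ((α : ℝ) ^ m * y) with hf
    have h1 := aux_step_mul hα hp0 hp hinv (β * f) ((α : ℝ) ^ m * r)
    have hf0 : 0 ≤ f := Int.fract_nonneg _
    have h2 := aux_sub_fract hp0 hp hinv (α * f) (α * ((α : ℝ) ^ m * r)) (by positivity)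
    have e : Int.fract ((α : ℝ) ^ (m + 1) * y) = Int.fract (α * f) := by
      rw [Int.fract_eq_fract]
      refine ⟨α * ⌊(α : ℝ) ^ m * y⌋, ?_⟩
      rw [hf, Int.fract]; push_cast; ring
    rw [Finset.sum_range_succ, e, ← hf, pow_add p, pow_succ (1 - p), pow_succ (α : ℝ)]
    rw [show (α : ℝ) ^ m * α * r = α * (α ^ m * r) by ring]
    rw [show (α : ℝ) * (β * f) = β * (α * f) by ring] at h1
    set P := p ^ (∑ j ∈ Finset.range m, ⌊(α : ℝ) * Int.fract ((α : ℝ) ^ j * y)⌋₊)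
    have hP : 0 < P := by positivity
    have h3 : (1 - p) * (p ^ ⌊α * f⌋₊ *
        π.real (Metric.ball (β * Int.fract (α * f)) (α * ((α : ℝ) ^ m * r))))
        ≤ π.real (Metric.ball (β * f) ((α : ℝ) ^ m * r)) :=
      (mul_le_mul_of_nonneg_left h2 h1p.le).trans h1
    have h4 := mul_le_mul_of_nonneg_left h3 (by positivity : 0 ≤ p ^ ⌊y⌋₊ * (1 - p) ^ m * P)
    refine le_trans (le_of_eq ?_) h4
    ring

lemma aux_digit (hα : 2 ≤ α) (z : ℝ) :
    ⌊(α : ℝ) * z⌋ % (α : ℤ) = (⌊(α : ℝ) * Int.fract z⌋₊ : ℤ) := by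
  have hα0 : (0 : ℝ) < α := by exact_mod_cast (by omega : 0 < α)
  have hf0 := Int.fract_nonneg z
  have hf1 := Int.fract_lt_one z
  have e : (α : ℝ) * z = α * Int.fract z + ((α * ⌊z⌋ : ℤ) : ℝ) := by
    push_cast; rw [Int.fract]; ring
  rw [Int.natCast_floor_eq_floor (by positivity : 0 ≤ (α : ℝ) * Int.fract z)]
  conv_lhs => rw [e, Int.floor_add_intCast, Int.add_mul_emod_self_left]
  apply Int.emod_eq_of_lt
  · exact Int.floor_nonneg.2 (by positivity)
  · rw [Int.floor_lt]; push_cast; nlinarith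

lemma aux_pos [IsProbabilityMeasure π] (hα : 2 ≤ α) (hβ : 1 ≤ β) (hp0 : 0 < p) (hp : p ≤ 1 / 2)
    (hsupp : π (Ici (0 : ℝ)) = 1)
    (hinv : ∀ A : Set ℝ, MeasurableSet A →
      π A = ENNReal.ofReal p * π ((fun y => y + (β : ℝ)) ⁻¹' A)
          + ENNReal.ofReal (1 - p) * π ((fun y => y / (α : ℝ)) ⁻¹' A)) :
    0 < π.real (Metric.ball 0 β) := by
  have hα1 : (1 : ℝ) < α := by exact_mod_cast (by omega : 1 < α)
  have hβ0 : (0 : ℝ) < β := by exact_mod_cast (by omega : 0 < β)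
  have h1p : 0 < 1 - p := by linarith
  have hk : ∀ j : ℕ, (1 - p) ^ j * π.real (Metric.ball 0 ((α : ℝ) ^ j * β))
      ≤ π.real (Metric.ball 0 β) := by
    intro j
    induction j with
    | zero => simp
    | succ j ih =>
      refine le_trans ?_ ih
      have := aux_step_mul hα hp0 hp hinv 0 ((α : ℝ) ^ j * β)
      rw [pow_succ, mul_assoc]
      refine mul_le_mul_of_nonneg_left ?_ (by positivity)
      rw [mul_zero] at this
      rwa [pow_succ, mul_comm ((α : ℝ) ^ j), mul_assoc]
  have hU : (⋃ j : ℕ, Metric.ball (0 : ℝ) ((α : ℝ) ^ j * β)) = univ := by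
    refine eq_univ_of_forall fun x => ?_
    obtain ⟨j, hj⟩ := pow_unbounded_of_one_lt (|x| / β) hα1
    refine mem_iUnion.2 ⟨j, ?_⟩
    rw [div_lt_iff₀ hβ0] at hj
    simpa [Real.norm_eq_abs] using hj
  have : ∃ j : ℕ, 0 < π (Metric.ball (0 : ℝ) ((α : ℝ) ^ j * β)) := by
    by_contra! hcon
    have : π univ = 0 := by
      rw [← hU, measure_iUnion_null_iff]
      intro j; exact le_antisymm (hcon j) (zero_le)
    simp at this
  obtain ⟨j, hj⟩ := this
  have hj' : 0 < π.real (Metric.ball (0 : ℝ) ((α : ℝ) ^ j * β)) :=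
    ENNReal.toReal_pos hj.ne' (measure_ne_top _ _)
  exact lt_of_lt_of_le (by positivity) (hk j)

/-- nonneg part of the ball of radius β is all that matters -/
lemma aux_pos' [IsProbabilityMeasure π] (hβ : 1 ≤ β)
    (hsupp : π (Ici (0 : ℝ)) = 1) (f R : ℝ) (hf0 : 0 ≤ f) (hf1 : f < 1) (hR : R = 2 * β) :
    π.real (Metric.ball 0 β) ≤ π.real (Metric.ball (β * f) R) := by
  have hβ0 : (0 : ℝ) < β := by exact_mod_cast (by omega : 0 < β)
  refine measureReal_mono (fun y hy => ?_)
  rw [Metric.mem_ball, Real.dist_eq, abs_lt] at hy ⊢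
  constructor <;> nlinarith

lemma aux_lim (a b c d : ℝ) (hd : d ≠ 0) :
    Tendsto (fun t : ℕ => (a + b * t) / (c + d * t)) atTop (nhds (b / d)) := by
  have h0 : Tendsto (fun t : ℕ => 1 / (t : ℝ)) atTop (nhds 0) := tendsto_one_div_atTop_nhds_zero_nat
  have h1 : Tendsto (fun t : ℕ => (a * (1 / (t : ℝ)) + b) / (c * (1 / (t : ℝ)) + d)) atTop
      (nhds ((a * 0 + b) / (c * 0 + d))) :=
    ((h0.const_mul a).add_const b).div ((h0.const_mul c).add_const d) (by simpa using hd)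
  simp only [mul_zero, zero_add] at h1
  refine h1.congr' ?_
  filter_upwards [eventually_ge_atTop 1] with t ht
  have ht0 : (0 : ℝ) < t := by exact_mod_cast ht
  rw [show a * (1 / (t : ℝ)) + b = (a + b * t) / t by field_simp,
    show c * (1 / (t : ℝ)) + d = (c + d * t) / t by field_simp, div_div_div_cancel_right₀ ht0.ne']

end aux

/-- Upper inequality of Lemma `dimension`: for every `x > 0`,
`dim̲π(x) ≤ d̄(σ̲(x/β))` where `σ̲` is the lower asymptotic base-`α` digit average. -/
theorem stmt9 (α β : ℕ) (hα : 2 ≤ α) (hβ : 1 ≤ β) (p : ℝ) (hp0 : 0 < p) (hp : p ≤ 1 / 2)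
    (π : Measure ℝ) [IsProbabilityMeasure π] (hsupp : π (Ici (0 : ℝ)) = 1)
    (hinv : ∀ A : Set ℝ, MeasurableSet A →
      π A = ENNReal.ofReal p * π ((fun y => y + (β : ℝ)) ⁻¹' A)
          + ENNReal.ofReal (1 - p) * π ((fun y => y / (α : ℝ)) ⁻¹' A)) :
    ∀ x : ℝ, 0 < x →
      lowerLocalDim π x ≤
        dBar α p
          (liminf
            (fun n : ℕ => (1 / (n : ℝ)) * ∑ i ∈ Finset.Icc 1 n, ((digit α (x / β) i : ℝ)))
            atTop) := by
  intro x hx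
  have hα0 : (0 : ℝ) < α := by exact_mod_cast (by omega : 0 < α)
  have hα1 : (1 : ℝ) < α := by exact_mod_cast (by omega : 1 < α)
  have hβ0 : (0 : ℝ) < β := by exact_mod_cast (by omega : 0 < β)
  have h1p : 0 < 1 - p := by linarith
  have hlogα : 0 < Real.log α := Real.log_pos hα1
  have hlogp : Real.log p < 0 := Real.log_neg hp0 (by linarith)
  set y := x / β with hy
  have hy0 : 0 < y := by positivity
  have hxy : (β : ℝ) * y = x := by rw [hy]; field_simp
  set k : ℤ := ⌊Real.log y / Real.log α⌋ + 1 with hk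
  set n0 := k.toNat with hn0
  set m0 := (-k).toNat with hm0
  have hnk : (n0 : ℤ) - m0 = k := by omega
  set e : ℕ → ℕ := fun j => ⌊(α : ℝ) * Int.fract ((α : ℝ) ^ j * y)⌋₊ with he
  have hdig : ∀ t : ℕ, digit α y (n0 + t + 1) = (e (m0 + t) : ℤ) := by
    intro t
    rw [he, ← aux_digit hα, digit]
    congr 2
    rw [← hk, ← hnk]
    rw [show -((n0 : ℤ) - m0) = (m0 : ℤ) - n0 by ring, zpow_sub₀ hα0.ne', zpow_natCast, zpow_natCast]
    field_simp
    ring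
  have hdig0 : ∀ i, (0 : ℤ) ≤ digit α y i := by
    intro i; exact Int.emod_nonneg _ (by omega)
  have hdig1 : ∀ i, digit α y i ≤ α := by
    intro i; exact (Int.emod_lt_of_pos _ (by omega)).le
  set T : ℕ → ℝ := fun n => ∑ i ∈ Finset.Icc 1 n, ((digit α y i : ℝ)) with hT
  have hT0 : ∀ n, 0 ≤ T n := fun n => Finset.sum_nonneg fun i _ => by exact_mod_cast hdig0 i
  have hT1 : ∀ n, T n ≤ n * α := by
    intro n
    have : T n ≤ ∑ i ∈ Finset.Icc 1 n, (α : ℝ) :=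
      Finset.sum_le_sum fun i _ => by exact_mod_cast hdig1 i
    simpa using this
  set S : ℕ → ℕ := fun m => ∑ j ∈ Finset.range m, e j with hS
  have hST : ∀ t : ℕ, (S (m0 + t) : ℝ) ≤ T (n0 + t) + S m0 := by
    intro t
    induction t with
    | zero => simpa using hT0 n0
    | succ t ih =>
      have h1 : S (m0 + (t + 1)) = S (m0 + t) + e (m0 + t) := Finset.sum_range_succ _ _
      have h2 : T (n0 + (t + 1)) = T (n0 + t) + e (m0 + t) := by
        have : T (n0 + t + 1) = T (n0 + t) + (digit α y (n0 + t + 1) : ℝ) :=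
          Finset.sum_Icc_succ_top (by omega) _
        rw [← add_assoc, this, hdig t]; simp
      rw [h1, h2]; push_cast; linarith
  set q := π.real (Metric.ball (0 : ℝ) β) with hq
  have hq0 : 0 < q := aux_pos hα hβ hp0 hp hsupp hinv
  set r : ℕ → ℝ := fun t => 2 * β / (α : ℝ) ^ (m0 + t) with hr
  have hr0 : ∀ t, 0 < r t := fun t => by positivity
  have hball : ∀ t, p ^ ⌊y⌋₊ * (1 - p) ^ (m0 + t) * p ^ (S (m0 + t)) * q
      ≤ π.real (Metric.ball x (r t)) := by
    intro t
    have h := aux_main hα hp0 hp hinv y (r t) hy0.le (m0 + t)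
    rw [hxy] at h
    refine le_trans ?_ h
    refine mul_le_mul_of_nonneg_left ?_ (by positivity)
    refine aux_pos' hβ hsupp _ _ (Int.fract_nonneg _) (Int.fract_lt_one _) ?_
    simp only [hr]; field_simp
  have hlogball : ∀ t : ℕ, ⌊y⌋₊ * Real.log p + (m0 + t : ℝ) * Real.log (1 - p)
      + S (m0 + t) * Real.log p + Real.log q ≤ Real.log (π.real (Metric.ball x (r t))) := by
    intro t
    refine le_trans (le_of_eq ?_) (Real.log_le_log (by positivity) (hball t))
    rw [Real.log_mul (by positivity) (by positivity), Real.log_mul (by positivity) (by positivity),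
      Real.log_mul (by positivity) (by positivity), Real.log_pow, Real.log_pow, Real.log_pow]
    push_cast; rfl
  have hlogr : ∀ t : ℕ, Real.log (r t) = Real.log (2 * β) - (m0 + t : ℝ) * Real.log α := by
    intro t
    simp only [hr]
    rw [Real.log_div (by positivity) (by positivity), Real.log_pow]; push_cast; rfl
  have hrt : Tendsto r atTop (nhdsWithin 0 (Ioi 0)) := by
    refine tendsto_nhdsWithin_iff.2 ⟨?_, Eventually.of_forall hr0⟩
    refine Tendsto.div_atTop tendsto_const_nhds ?_
    exact (tendsto_pow_atTop_atTop_of_one_lt hα1).comp (tendsto_atTop_mono (fun t => by simp) tendsto_id)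
  set σ := liminf (fun n : ℕ => (1 / (n : ℝ)) * T n) atTop with hσ
  have hσ' : σ = liminf (fun t : ℕ => (1 / ((t + n0 : ℕ) : ℝ)) * T (t + n0)) atTop :=
    (Filter.liminf_nat_add (fun n : ℕ => (1 / (n : ℝ)) * T n) n0).symm
  refine le_of_forall_gt_imp_ge_of_dense fun c hc => ?_
  have hcont : Continuous (fun s => dBar α p s) := by
    unfold dBar; fun_prop
  obtain ⟨s, hs, hsc⟩ : ∃ s, σ < s ∧ dBar α p s < c := by
    have : ∀ᶠ s in nhdsWithin σ (Ioi σ), dBar α p s < c :=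
      nhdsWithin_le_nhds (hcont.continuousAt.eventually_lt continuousAt_const hc)
    obtain ⟨s, h1, h2⟩ := (this.and self_mem_nhdsWithin).exists
    exact ⟨s, h2, h1⟩
  have hfreq : ∃ᶠ t : ℕ in atTop, (1 / ((t + n0 : ℕ) : ℝ)) * T (t + n0) < s := by
    refine frequently_lt_of_liminf_lt ?_ (hσ' ▸ hs)
    refine IsBoundedUnder.isCoboundedUnder_ge ?_
    refine isBoundedUnder_of ⟨(α : ℝ), fun t => ?_⟩
    rcases Nat.eq_zero_or_pos (t + n0) with h | h
    · rw [h]; simp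
    · have h' : (0 : ℝ) < ((t + n0 : ℕ) : ℝ) := by exact_mod_cast h
      rw [one_div, inv_mul_le_iff₀ h']
      exact hT1 _
  have hlim := aux_lim (⌊y⌋₊ * Real.log p + m0 * Real.log (1 - p) + (n0 * s + S m0) * Real.log p
    + Real.log q) (Real.log (1 - p) + s * Real.log p) (Real.log (2 * β) - m0 * Real.log α)
    (-Real.log α) (by linarith)
  have hdB : (Real.log (1 - p) + s * Real.log p) / (-Real.log α) = dBar α p s := by
    rw [dBar, Real.log_inv]
  rw [hdB] at hlim
  have hev := hlim.eventually_lt_const hsc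
  have hr1 : ∀ᶠ t in atTop, r t < 1 :=
    (hrt.mono_right nhdsWithin_le_nhds).eventually_lt_const one_pos
  have hfin : ∃ᶠ t : ℕ in atTop,
      Real.log (π (Metric.ball x (r t))).toReal / Real.log (r t) ≤ c := by
    refine (hfreq.and_eventually (hev.and (hr1.and (eventually_ge_atTop 1)))).mono ?_
    rintro t ⟨h1, h2, h3, h4⟩
    have hlr : Real.log (r t) < 0 := Real.log_neg (hr0 t) h3
    refine le_trans ?_ h2.le
    have hden : Real.log (2 * β) - m0 * Real.log α + -Real.log α * t = Real.log (r t) := by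
      rw [hlogr]; ring
    rw [hden]
    refine div_le_div_of_nonpos_of_le hlr.le ?_
    refine le_trans ?_ (hlogball t)
    have h' : (0 : ℝ) < ((t + n0 : ℕ) : ℝ) := by exact_mod_cast (by omega : 0 < t + n0)
    rw [one_div, inv_mul_lt_iff₀ h'] at h1
    have h5 : (S (m0 + t) : ℝ) ≤ (t + n0) * s + S m0 := by
      have := hST t
      rw [add_comm n0 t] at this
      push_cast at h1
      linarith
    nlinarith [mul_le_mul_of_nonpos_right h5 hlogp.le]
  unfold lowerLocalDim
  refine liminf_le_of_frequently_le (hrt.frequently hfin) ?_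
  refine ⟨0, ?_⟩
  rw [eventually_map]
  have hlt1 : ∀ᶠ ρ : ℝ in nhdsWithin 0 (Ioi 0), ρ < 1 :=
    nhdsWithin_le_nhds (Iio_mem_nhds one_pos)
  filter_upwards [hlt1, self_mem_nhdsWithin] with ρ h1 h2
  have h2' : 0 < ρ := h2
  refine div_nonneg_of_nonpos ?_ (Real.log_nonpos h2'.le h1.le)
  exact Real.log_nonpos ENNReal.toReal_nonneg (by
    have := measureReal_le_one (μ := π) (s := Metric.ball x ρ)
    exact this)
end

section
/- For π-almost every x one has x > 0 and, for each k ∈ {0, 1, …, α−1}, the asymptotic frequency of the digit k in the base-α expansion of x exists and equals ξ_k: lim_{n→∞} (1/n)·#{1 ≤ i ≤ n : δ_i^α(x) = k} = ξ_k. (Lemma 'erg'.) -/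
open MeasureTheory Set Filter

/-- `ξ_k = Σ_{m=0}^∞ π([mα+k, mα+k+1))`, as a real number. -/
noncomputable def xi (α : ℕ) (π : Measure ℝ) (k : ℕ) : ℝ :=
  (∑' m : ℕ, π (Ico ((m : ℝ) * α + k) ((m : ℝ) * α + k + 1))).toReal


lemma interp (y : ℕ → ℂ) (hy : ∀ i, ‖y i‖ ≤ 2)
    (h : Tendsto (fun m : ℕ => ‖∑ i ∈ Finset.range (m^2), y i‖ / (m:ℝ)^2) atTop (nhds 0)) :
    Tendsto (fun n : ℕ => (1 / (n:ℂ)) * ∑ i ∈ Finset.range n, y i) atTop (nhds 0) := by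
  have hs : Tendsto Nat.sqrt atTop atTop := by
    refine tendsto_atTop.2 fun b => ?_
    filter_upwards [eventually_ge_atTop (b*b)] with n hn
    exact Nat.le_sqrt.2 hn
  have h1 := h.comp hs
  have h2 : Tendsto (fun n : ℕ => 4 / ((Nat.sqrt n : ℕ):ℝ)) atTop (nhds 0) :=
    (tendsto_const_div_atTop_nhds_zero_nat (4:ℝ)).comp hs
  have h3 := h1.add h2
  rw [add_zero] at h3
  refine squeeze_zero_norm' ?_ h3
  filter_upwards [eventually_ge_atTop 1] with n hn
  set m := Nat.sqrt n with hm
  have hm1 : 1 ≤ m := Nat.le_sqrt.2 (by omega)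
  have hmn : m^2 ≤ n := Nat.sqrt_le' n
  have hnm : n ≤ m * m + m + m := Nat.sqrt_le_add n
  have hsplit : ∑ i ∈ Finset.range n, y i = ∑ i ∈ Finset.range (m^2), y i
      + ∑ i ∈ Finset.Ico (m^2) n, y i := (Finset.sum_range_add_sum_Ico y hmn).symm
  have hb : ‖∑ i ∈ Finset.Ico (m^2) n, y i‖ ≤ 4 * m := by
    refine (norm_sum_le_of_le _ (fun i _ => hy i)).trans ?_
    simp only [Finset.sum_const, Nat.card_Ico, nsmul_eq_mul]
    have : n - m^2 ≤ 2 * m := by rw [pow_two]; omega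
    have : ((n - m^2 : ℕ):ℝ) ≤ 2 * m := by exact_mod_cast this
    linarith
  have hm0 : (0:ℝ) < m := by exact_mod_cast hm1
  have hmn' : (m:ℝ)^2 ≤ n := by exact_mod_cast hmn
  rw [norm_mul, norm_div, norm_one, Complex.norm_natCast, hsplit]
  simp only [Function.comp]
  calc 1 / (n:ℝ) * ‖∑ i ∈ Finset.range (m^2), y i + ∑ i ∈ Finset.Ico (m^2) n, y i‖
      ≤ 1 / (m:ℝ)^2 * (‖∑ i ∈ Finset.range (m^2), y i‖ + 4 * m) := by
        gcongr
        exact (norm_add_le _ _).trans (by gcongr)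
    _ = _ := by rw [← hm]; field_simp

lemma aslem (π : Measure ℝ) [IsProbabilityMeasure π] (Y : ℕ → ℝ → ℂ)
    (hm : ∀ i, Measurable (Y i)) (hb : ∀ i x, ‖Y i x‖ ≤ 2) (K : ℝ) (hK : 0 ≤ K)
    (hc : ∀ n i, i < n → ‖∫ x, Y n x * (starRingEnd ℂ) (Y i x) ∂π‖ ≤ K * (1/2)^(n-i)) :
    ∀ᵐ x ∂π, Tendsto (fun n : ℕ => (1 / (n:ℂ)) * ∑ i ∈ Finset.range n, Y i x) atTop (nhds 0) := by
  have hSm : ∀ n, Measurable (fun x => ∑ i ∈ Finset.range n, Y i x) := fun n =>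
    Finset.measurable_fun_sum _ (fun i _ => hm i)
  have hSb : ∀ n x, ‖∑ i ∈ Finset.range n, Y i x‖ ≤ 2 * n := fun n x =>
    (norm_sum_le_of_le _ (fun i _ => hb i x)).trans (by simp [mul_comm])
  have hint : ∀ n i, Integrable (fun x => Y n x * (starRingEnd ℂ) (Y i x)) π := fun n i =>
    Integrable.of_bound (((hm n).mul (Complex.continuous_conj.measurable.comp (hm i))).aestronglyMeasurable) 4
      (ae_of_all _ fun x => by
        rw [norm_mul, RCLike.norm_conj]
        nlinarith [hb n x, hb i x, norm_nonneg (Y n x), norm_nonneg (Y i x)])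
  have hSi : ∀ n, Integrable (fun x => ‖∑ i ∈ Finset.range n, Y i x‖^2) π := fun n =>
    Integrable.of_bound (((hSm n).norm.pow_const 2).aestronglyMeasurable) ((2*n)^2)
      (ae_of_all _ fun x => by
        rw [Real.norm_of_nonneg (by positivity)]
        gcongr
        exact hSb n x)
  have hgeo : ∀ n : ℕ, ∑ i ∈ Finset.range n, ((1:ℝ)/2)^(n-i) ≤ 1 := by
    intro n
    have : ∑ i ∈ Finset.range n, ((1:ℝ)/2)^(n-i) = 1 - (1/2)^n := by
      induction n with
      | zero => simp
      | succ k ih =>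
        rw [Finset.sum_range_succ]
        have : ∑ i ∈ Finset.range k, ((1:ℝ)/2)^(k+1-i) = (1/2) * ∑ i ∈ Finset.range k, ((1:ℝ)/2)^(k-i) := by
          rw [Finset.mul_sum]
          refine Finset.sum_congr rfl fun i hi => ?_
          have := Finset.mem_range.1 hi
          rw [show k+1-i = (k-i)+1 by omega, pow_succ]; ring
        rw [this, ih]; simp; ring
    rw [this]; have : (0:ℝ) ≤ (1/2)^n := by positivity
    linarith
  have hV : ∀ n : ℕ, ∫ x, ‖∑ i ∈ Finset.range n, Y i x‖^2 ∂π ≤ (2*K+4) * n := by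
    intro n
    induction n with
    | zero => simp
    | succ n ih =>
      have e : ∀ x, ‖∑ i ∈ Finset.range (n+1), Y i x‖^2 = ‖∑ i ∈ Finset.range n, Y i x‖^2
          + (2 * (∑ i ∈ Finset.range n, Y n x * (starRingEnd ℂ) (Y i x)).re + ‖Y n x‖^2) := by
        intro x
        rw [Finset.sum_range_succ, ← Finset.mul_sum, ← map_sum]
        simp only [← Complex.normSq_eq_norm_sq]
        rw [add_comm, Complex.normSq_add]; ring
      have i1 : Integrable (fun x => ∑ i ∈ Finset.range n, Y n x * (starRingEnd ℂ) (Y i x)) π :=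
        integrable_finsetSum _ (fun i _ => hint n i)
      have i2 : Integrable (fun x => ‖Y n x‖^2) π :=
        Integrable.of_bound (((hm n).norm.pow_const 2).aestronglyMeasurable) 4
        (ae_of_all _ fun x => by
          rw [Real.norm_of_nonneg (by positivity)]
          nlinarith [hb n x, norm_nonneg (Y n x)])
      have b2 : ∫ x, ‖Y n x‖^2 ∂π ≤ 4 := by
        have := integral_mono i2 (integrable_const (4:ℝ)) (fun x => by
          show ‖Y n x‖^2 ≤ 4
          nlinarith [hb n x, norm_nonneg (Y n x)])
        simpa using this
      have b1 : (∫ x, ∑ i ∈ Finset.range n, Y n x * (starRingEnd ℂ) (Y i x) ∂π).re ≤ K := by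
        refine (Complex.re_le_norm _).trans ?_
        rw [integral_finsetSum _ (fun i _ => hint n i)]
        refine (norm_sum_le_of_le _ (fun i hi => hc n i (Finset.mem_range.1 hi))).trans ?_
        rw [← Finset.mul_sum]
        nlinarith [hgeo n]
      have b1' : ∫ x, (∑ i ∈ Finset.range n, Y n x * (starRingEnd ℂ) (Y i x)).re ∂π
          = (∫ x, ∑ i ∈ Finset.range n, Y n x * (starRingEnd ℂ) (Y i x) ∂π).re := integral_re i1
      have i1' : Integrable (fun x => (∑ i ∈ Finset.range n, Y n x * (starRingEnd ℂ) (Y i x)).re) π := i1.re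
      have i3 : Integrable (fun x => 2 * (∑ i ∈ Finset.range n, Y n x * (starRingEnd ℂ) (Y i x)).re
          + ‖Y n x‖^2) π := (i1'.const_mul 2).add i2
      simp_rw [e]
      rw [integral_add (hSi n) i3, integral_add (i1'.const_mul 2) i2,
        integral_const_mul, b1']
      push_cast
      linarith
  have hA : ∀ᵐ x ∂π, Tendsto (fun m : ℕ => ‖∑ i ∈ Finset.range (m^2), Y i x‖ / (m:ℝ)^2) atTop (nhds 0) := by
    let F : ℕ → ℝ → ℝ := fun m x => (‖∑ i ∈ Finset.range (m^2), Y i x‖ / (m:ℝ)^2)^2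
    have hFm : ∀ m, Measurable (fun x => ENNReal.ofReal (F m x)) := fun m =>
      ((((hSm (m^2)).norm).div_const _).pow_const 2).ennreal_ofReal
    have hFi : ∀ m : ℕ, ∫⁻ x, ENNReal.ofReal (F m x) ∂π ≤ ENNReal.ofReal ((2*K+4) * (1/(m:ℝ)^2)) := by
      intro m
      have : (fun x => F m x) = fun x => (1/(m:ℝ)^4) * ‖∑ i ∈ Finset.range (m^2), Y i x‖^2 := by
        ext x; simp only [F]; ring
      rw [← ofReal_integral_eq_lintegral_ofReal]
      · apply ENNReal.ofReal_le_ofReal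
        rw [this, integral_const_mul]
        have := hV (m^2)
        rcases Nat.eq_zero_or_pos m with rfl | h0
        · simp
        have h0' : (0:ℝ) < m := by exact_mod_cast h0
        calc _ ≤ 1/(m:ℝ)^4 * ((2*K+4) * (m^2 : ℕ)) := by gcongr
          _ = _ := by push_cast; field_simp
      · rw [show F m = fun x => F m x from rfl, this]; exact (hSi _).const_mul _
      · exact ae_of_all _ fun x => by simp only [F]; positivity
    have hfin : ∫⁻ x, ∑' m, ENNReal.ofReal (F m x) ∂π ≠ ⊤ := by
      rw [lintegral_tsum (fun m => (hFm m).aemeasurable)]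
      refine ne_top_of_le_ne_top ?_ (ENNReal.tsum_le_tsum hFi)
      have hs : Summable (fun m : ℕ => (2*K+4) * (1/(m:ℝ)^2)) :=
        (Real.summable_one_div_nat_pow.2 (by norm_num)).mul_left _
      exact hs.tsum_ofReal_ne_top
    filter_upwards [ae_lt_top (Measurable.tsum hFm) hfin] with x hx
    have h1 := ENNReal.tendsto_atTop_zero_of_tsum_ne_top hx.ne
    have h2 : Tendsto (fun m => F m x) atTop (nhds 0) := by
      have := (ENNReal.tendsto_toReal ENNReal.zero_ne_top).comp h1
      refine this.congr fun m => ?_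
      simp only [Function.comp]
      rw [ENNReal.toReal_ofReal]; simp only [F]; positivity
    have h3 := h2.sqrt
    rw [Real.sqrt_zero] at h3
    refine h3.congr fun m => ?_
    simp only [F]
    rw [Real.sqrt_sq (by positivity)]
  filter_upwards [hA] with x hx
  exact interp (fun i => Y i x) (fun i => hb i x) hx

noncomputable def ee (t x : ℝ) : ℂ := Complex.exp (Complex.I * ((t * x : ℝ) : ℂ))

lemma ee_norm (t x : ℝ) : ‖ee t x‖ = 1 := by
  unfold ee; rw [mul_comm]; exact Complex.norm_exp_ofReal_mul_I _

lemma ee_meas (t : ℝ) : Continuous (ee t) := by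
  unfold ee; fun_prop

lemma ee_add (s t x : ℝ) : ee (s + t) x = ee s x * ee t x := by
  unfold ee; rw [← Complex.exp_add]; congr 1; push_cast; ring

lemma ee_add' (t x y : ℝ) : ee t (x + y) = ee t x * ee t y := by
  unfold ee; rw [← Complex.exp_add]; congr 1; push_cast; ring

lemma ee_conj (t x : ℝ) : (starRingEnd ℂ) (ee t x) = ee (-t) x := by
  unfold ee; rw [← Complex.exp_conj]; congr 1; simp

lemma ee_div (t x a : ℝ) : ee t (x / a) = ee (t / a) x := by
  unfold ee; congr 3; ring

lemma ee_int (l : ℤ) (β : ℕ) : ee (2 * Real.pi * l) β = 1 := by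
  unfold ee
  rw [Complex.exp_eq_one_iff]
  exact ⟨l * β, by push_cast; ring⟩

lemma ee_int' (t : ℝ) (l : ℤ) (β : ℕ) : ee (2 * Real.pi * l + t) β = ee t β := by
  rw [ee_add, ee_int, one_mul]

lemma ee_sub_one (t x : ℝ) : ‖ee t x - 1‖ ≤ |t| * |x| := by
  unfold ee
  rw [← abs_mul]; exact Real.norm_exp_I_mul_ofReal_sub_one_le

noncomputable def ph (π : Measure ℝ) (t : ℝ) : ℂ := ∫ x, ee t x ∂π

noncomputable def DD (π : Measure ℝ) (t : ℝ) : ℝ := ∫ x, ‖ee t x - 1‖ ∂π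

lemma inv_int {E : Type*} [NormedAddCommGroup E] [NormedSpace ℝ E]
    (α β : ℕ) (p : ℝ) (hp0 : 0 < p) (hp : p ≤ 1 / 2)
    (π : Measure ℝ) [IsProbabilityMeasure π]
    (hinv : ∀ A : Set ℝ, MeasurableSet A →
      π A = ENNReal.ofReal p * π ((fun y => y + (β : ℝ)) ⁻¹' A)
          + ENNReal.ofReal (1 - p) * π ((fun y => y / (α : ℝ)) ⁻¹' A))
    (g : ℝ → E) (hg : Continuous g) [SecondCountableTopology E] [MeasurableSpace E] [BorelSpace E]
    (C : ℝ) (hb : ∀ x, ‖g x‖ ≤ C) :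
    ∫ x, g x ∂π = p • ∫ x, g (x + β) ∂π + (1 - p) • ∫ x, g (x / α) ∂π := by
  have m1 : Measurable (fun y : ℝ => y + (β : ℝ)) := by fun_prop
  have m2 : Measurable (fun y : ℝ => y / (α : ℝ)) := by fun_prop
  have hπ : π = ENNReal.ofReal p • π.map (fun y => y + (β : ℝ))
      + ENNReal.ofReal (1 - p) • π.map (fun y => y / (α : ℝ)) := by
    ext A hA
    rw [hinv A hA]
    simp [Measure.map_apply m1 hA, Measure.map_apply m2 hA]
  have := Measure.isProbabilityMeasure_map (μ := π) m1.aemeasurable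
  have := Measure.isProbabilityMeasure_map (μ := π) m2.aemeasurable
  have hi : ∀ μ : Measure ℝ, IsProbabilityMeasure μ → Integrable g μ := fun μ _ =>
    Integrable.of_bound hg.aestronglyMeasurable C (ae_of_all _ hb)
  conv_lhs => rw [hπ]
  rw [integral_add_measure ((hi _ inferInstance).smul_measure ENNReal.ofReal_ne_top)
    ((hi _ inferInstance).smul_measure ENNReal.ofReal_ne_top), integral_smul_measure,
    integral_smul_measure, integral_map m1.aemeasurable hg.aestronglyMeasurable,
    integral_map m2.aemeasurable hg.aestronglyMeasurable, ENNReal.toReal_ofReal hp0.le,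
    ENNReal.toReal_ofReal (by linarith)]

section
variable (π : Measure ℝ) [IsProbabilityMeasure π]

lemma ee_integrable (t : ℝ) : Integrable (ee t) π :=
  Integrable.of_bound (ee_meas t).aestronglyMeasurable 1 (ae_of_all _ fun x => (ee_norm t x).le)

lemma eD_integrable (t : ℝ) : Integrable (fun x => ‖ee t x - 1‖) π :=
  ((ee_integrable π t).sub (integrable_const 1)).norm

lemma ph_norm (t : ℝ) : ‖ph π t‖ ≤ 1 := by
  refine (norm_integral_le_of_norm_le_const (C := 1) (ae_of_all _ fun x => (ee_norm t x).le)).trans ?_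
  simp

lemma ph_zero : ph π 0 = 1 := by simp [ph, ee]

omit [IsProbabilityMeasure π] in
lemma ph_neg (t : ℝ) : ph π (-t) = (starRingEnd ℂ) (ph π t) := by
  unfold ph; rw [← integral_conj]; simp_rw [ee_conj]

lemma ph_lip (t s : ℝ) : ‖ph π (t + s) - ph π t‖ ≤ DD π s := by
  unfold ph DD
  rw [← integral_sub (ee_integrable π _) (ee_integrable π _)]
  refine (norm_integral_le_integral_norm _).trans (le_of_eq ?_)
  congr 1; ext x
  rw [ee_add, ← mul_sub_one, norm_mul, ee_norm, one_mul]
end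

lemma DD_tendsto (π : Measure ℝ) [IsProbabilityMeasure π] (a s : ℝ) (ha : 2 ≤ a) :
    Tendsto (fun n : ℕ => DD π (s / a^n)) atTop (nhds 0) := by
  have h0 : (0:ℝ) = ∫ x : ℝ, (0:ℝ) ∂π := by simp
  rw [h0]
  unfold DD
  refine tendsto_integral_of_dominated_convergence (fun _ => 2) (fun n => (eD_integrable π _).1)
    (integrable_const _) (fun n => ae_of_all _ fun x => ?_) (ae_of_all _ fun x => ?_)
  · rw [norm_norm]
    refine (norm_sub_le _ _).trans ?_
    rw [ee_norm]; norm_num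
  · refine squeeze_zero (fun _ => norm_nonneg _) (fun n => ee_sub_one _ _) ?_
    have : Tendsto (fun n : ℕ => |s / a^n| * |x|) atTop (nhds (|s * 0| * |x|)) := by
      refine Tendsto.mul_const _ (Tendsto.abs ?_)
      simp_rw [div_eq_mul_inv, ← inv_pow]
      exact (tendsto_pow_atTop_nhds_zero_of_lt_one (by positivity) (inv_lt_one_of_one_lt₀ (by linarith))).const_mul s
    simpa using this

section
variable (α β : ℕ) (hα : 2 ≤ α) (p : ℝ) (hp0 : 0 < p) (hp : p ≤ 1 / 2)
    (π : Measure ℝ) [IsProbabilityMeasure π]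
    (hinv : ∀ A : Set ℝ, MeasurableSet A →
      π A = ENNReal.ofReal p * π ((fun y => y + (β : ℝ)) ⁻¹' A)
          + ENNReal.ofReal (1 - p) * π ((fun y => y / (α : ℝ)) ⁻¹' A))
include hp0 hp hinv

lemma ph_eq (t : ℝ) : ph π t * (1 - p * ee t β) = (1 - p) * ph π (t / α) := by
  have := inv_int α β p hp0 hp π hinv (ee t) (ee_meas t) 1 (fun x => (ee_norm t x).le)
  simp_rw [ee_add', ee_div] at this
  rw [integral_mul_const] at this
  simp only [Complex.real_smul] at this
  push_cast at this
  unfold ph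
  linear_combination this

lemma DD_le (s : ℝ) : DD π s ≤ β * |s| + DD π (s / α) := by
  have := inv_int α β p hp0 hp π hinv (fun x => ‖ee s x - 1‖) ((ee_meas s).sub continuous_const).norm 2
    (fun x => by
      rw [norm_norm]
      refine (norm_sub_le _ _).trans ?_
      rw [ee_norm]; norm_num)
  have h1 : ∫ x, ‖ee s (x + β) - 1‖ ∂π ≤ DD π s + β * |s| := by
    have hi : Integrable (fun x => ‖ee s x - 1‖ + β * |s|) π :=
      (eD_integrable π s).add (integrable_const _)
    have : ∫ x, ‖ee s (x + β) - 1‖ ∂π ≤ ∫ x, (‖ee s x - 1‖ + β * |s|) ∂π := by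
      refine integral_mono_of_nonneg (ae_of_all _ fun x => norm_nonneg _) hi (ae_of_all _ fun x => ?_)
      have e : ee s (x + β) - 1 = ee s β * (ee s x - 1) + (ee s β - 1) := by rw [ee_add']; ring
      show ‖ee s (x + β) - 1‖ ≤ ‖ee s x - 1‖ + β * |s|
      rw [e]
      refine (norm_add_le _ _).trans ?_
      rw [norm_mul, ee_norm, one_mul]
      have := ee_sub_one s β
      rw [Nat.abs_cast] at this
      linarith
    rw [integral_add (eD_integrable π s) (integrable_const _)] at this
    simpa [DD] using this
  simp_rw [ee_div] at this
  change DD π s = p • (∫ x, ‖ee s (x + β) - 1‖ ∂π) + (1 - p) • DD π (s / α) at this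
  simp only [smul_eq_mul] at this
  have h2 : p * (∫ x, ‖ee s (x + β) - 1‖ ∂π) ≤ p * (DD π s + β * |s|) := by gcongr
  have h3 : (1-p) * DD π s ≤ p * (β * |s|) + (1-p) * DD π (s/α) := by linarith
  have h4 : p * (β * |s|) ≤ (1-p) * (β * |s|) := by
    have : 0 ≤ (β:ℝ) * |s| := by positivity
    nlinarith
  have h5 : (1-p) * DD π s ≤ (1-p) * (β * |s| + DD π (s/α)) := by linarith
  exact le_of_mul_le_mul_left h5 (by linarith)

include hα
lemma DD_bound (s : ℝ) : DD π s ≤ 2 * β * |s| := by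
  have ha : (2:ℝ) ≤ α := by exact_mod_cast hα
  have h : ∀ n : ℕ, DD π s ≤ 2 * β * |s| - 2 * β * |s| / α^n + DD π (s / α^n) := by
    intro n
    induction n with
    | zero => simp
    | succ n ih =>
      have := DD_le α β p hp0 hp π hinv (s / α^n)
      rw [div_div, ← pow_succ, abs_div, abs_of_nonneg (by positivity : (0:ℝ) ≤ (α:ℝ)^n)] at this
      have h2 : 2 * β * |s| / α^(n+1) ≤ β * (|s| / α^n) := by
        rw [pow_succ, div_le_iff₀ (by positivity)]
        have : β * (|s| / (α:ℝ)^n) * (α^n * α) = β * |s| * α := by field_simp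
        rw [this]
        have : 0 ≤ (β:ℝ) * |s| := by positivity
        nlinarith
      have h3 : 2 * β * |s| / (α:ℝ)^n = 2 * (β * (|s| / α^n)) := by ring
      linarith
  have h2 : ∀ n : ℕ, DD π s ≤ 2 * β * |s| + DD π (s / α^n) := fun n =>
    (h n).trans (by have : 0 ≤ 2 * β * |s| / (α:ℝ)^n := by positivity
                    linarith)
  have := (DD_tendsto π α s ha).const_add (2 * β * |s|)
  rw [add_zero] at this
  exact ge_of_tendsto' this h2

lemma ph_inv (l : ℤ) (j : ℕ) : ph π (2 * Real.pi * l / α * α^j) = ph π (2 * Real.pi * l / α) := by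
  have ha : (α:ℝ) ≠ 0 := by positivity
  induction j with
  | zero => simp
  | succ j ih =>
    have e : 2 * Real.pi * l / α * (α:ℝ)^(j+1) = 2 * Real.pi * ((l * α^j : ℤ) : ℝ) := by
      push_cast; field_simp; ring
    have := ph_eq α β p hp0 hp π hinv (2 * Real.pi * l / α * (α:ℝ)^(j+1))
    have e2 : 2 * Real.pi * l / α * (α:ℝ)^(j+1) / α = 2 * Real.pi * l / α * α^j := by
      field_simp; ring
    have e3 : ee (2 * Real.pi * l / α * (α:ℝ)^(j+1)) β = 1 := by rw [e]; exact ee_int _ _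
    rw [e3, e2, ih] at this
    have hp1 : (1 - p : ℂ) ≠ 0 := by
      have : (1 - p : ℝ) ≠ 0 := by linarith
      exact_mod_cast this
    apply mul_left_cancel₀ hp1
    rw [← this]; ring

lemma ph_cov (l : ℤ) (d : ℕ) :
    ‖ph π (2 * Real.pi * l / α * (α^d - 1)) - ph π (2 * Real.pi * l / α) *
      (starRingEnd ℂ) (ph π (2 * Real.pi * l / α))‖
      ≤ (4 * β * |2 * Real.pi * l / α|) * (1/2)^d := by
  have ha2 : (2:ℝ) ≤ α := by exact_mod_cast hα
  have ha : (α:ℝ) ≠ 0 := by positivity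
  set u : ℝ := 2 * Real.pi * l / α with hu
  clear_value u
  have key : ∀ r : ℕ, r ≤ d → ∃ Q : ℂ, ph π (u * (α^d - 1)) = Q * ph π (u * (α^d - 1) / α^r) ∧
      ph π (-u) = Q * ph π (-u / α^r) := by
    intro r
    induction r with
    | zero => intro _; exact ⟨1, by simp, by simp⟩
    | succ r ih =>
      intro hr
      obtain ⟨Q, h1, h2⟩ := ih (by omega)
      have e1 := ph_eq α β p hp0 hp π hinv (u * (α^d - 1) / α^r)
      have e2 := ph_eq α β p hp0 hp π hinv (-u / α^r)
      obtain ⟨k, rfl⟩ := Nat.exists_eq_add_of_lt (show r < d by omega)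
      have e3 : u * ((α:ℝ)^(r+k+1) - 1) / α^r = 2 * Real.pi * ((l * α^k : ℤ):ℝ) + (-u / α^r) := by
        rw [hu]; push_cast; field_simp; ring
      have e4 : ee (u * ((α:ℝ)^(r+k+1) - 1) / α^r) β = ee (-u / α^r) β := by
        rw [e3, ee_int']
      rw [e4, div_div, ← pow_succ] at e1
      rw [div_div, ← pow_succ] at e2
      have hm : (1 - p * ee (-u / α^r) β : ℂ) ≠ 0 := by
        intro h
        have h' : (p:ℂ) * ee (-u / α^r) β = 1 := by linear_combination -h
        have := congrArg norm h'
        rw [norm_mul, ee_norm, norm_one, mul_one, Complex.norm_real, Real.norm_of_nonneg hp0.le] at this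
        linarith
      refine ⟨Q * ((1 - p) / (1 - p * ee (-u / α^r) β)), ?_, ?_⟩
      · rw [h1, mul_assoc, div_mul_eq_mul_div, ← e1, mul_div_cancel_right₀ _ hm]
      · rw [h2, mul_assoc, div_mul_eq_mul_div, ← e2, mul_div_cancel_right₀ _ hm]
  obtain ⟨Q, h1, h2⟩ := key d le_rfl
  have h3 : ph π (u * (α^d - 1)) * ph π (-u / α^d) = ph π (-u) * ph π (u + -u / α^d) := by
    have : u * ((α:ℝ)^d - 1) / α^d = u + -u / α^d := by field_simp; ring
    rw [h1, h2, this]; ring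
  have hD : DD π (-u / α^d) ≤ 2 * β * |u| * (1/2)^d := by
    refine (DD_bound α β hα p hp0 hp π hinv _).trans ?_
    rw [abs_div, abs_neg, abs_of_nonneg (by positivity : (0:ℝ) ≤ (α:ℝ)^d), one_div, inv_pow,
      div_eq_mul_inv, ← mul_assoc]
    gcongr
  have a1 := ph_lip π u (-u / α^d)
  have a2 := ph_lip π 0 (-u / α^d)
  rw [zero_add, ph_zero] at a2
  rw [← ph_neg]
  have : ph π (u * (α^d - 1)) - ph π u * ph π (-u) =
      - (ph π (u * (α^d - 1)) * (ph π (-u / α^d) - 1)) + ph π (-u) * (ph π (u + -u/α^d) - ph π u) := by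
    linear_combination h3
  rw [this]
  refine (norm_add_le _ _).trans ?_
  rw [norm_neg, norm_mul, norm_mul]
  have b1 := ph_norm π (u * (α^d - 1))
  have b2 := ph_norm π (-u)
  have c1 : ‖ph π (u * (α^d - 1))‖ * ‖ph π (-u / α^d) - 1‖ ≤ 1 * DD π (-u / α^d) := by gcongr
  have c2 : ‖ph π (-u)‖ * ‖ph π (u + -u/α^d) - ph π u‖ ≤ 1 * DD π (-u / α^d) := by gcongr
  linarith

end

lemma weyl {T : ℝ} [Fact (0 < T)] (y : ℕ → AddCircle T) (ν : Measure (AddCircle T))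
    [IsProbabilityMeasure ν]
    (h : ∀ l : ℤ, Tendsto (fun n : ℕ => (1 / (n:ℂ)) * ∑ i ∈ Finset.range n, fourier l (y i)) atTop
      (nhds (∫ z, fourier l z ∂ν))) (f : C(AddCircle T, ℂ)) :
    Tendsto (fun n : ℕ => (1 / (n:ℂ)) * ∑ i ∈ Finset.range n, f (y i)) atTop (nhds (∫ z, f z ∂ν)) := by
  have hint : ∀ f : C(AddCircle T, ℂ), Integrable f ν := fun f =>
    Integrable.of_bound f.continuous.aestronglyMeasurable ‖f‖ (ae_of_all _ f.norm_coe_le_norm)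
  have hspan : ∀ g ∈ Submodule.span ℂ (range (@fourier T)),
      Tendsto (fun n : ℕ => (1 / (n:ℂ)) * ∑ i ∈ Finset.range n, g (y i)) atTop (nhds (∫ z, g z ∂ν)) := by
    intro g hg
    induction hg using Submodule.span_induction with
    | mem x hx => obtain ⟨l, rfl⟩ := hx; exact h l
    | zero => simp
    | add f g _ _ hf hg =>
      have := hf.add hg
      rw [← integral_add (hint f) (hint g)] at this
      refine this.congr fun n => ?_
      simp only [ContinuousMap.add_apply, Finset.sum_add_distrib]; ring
    | smul c f _ hf =>
      have := hf.const_mul c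
      rw [← integral_const_mul] at this
      refine this.congr fun n => ?_
      simp only [ContinuousMap.smul_apply, smul_eq_mul, ← Finset.mul_sum]; ring
  have hcl : f ∈ closure ((Submodule.span ℂ (range (@fourier T)) : Submodule ℂ C(AddCircle T, ℂ)) : Set C(AddCircle T, ℂ)) := by
    rw [← Submodule.topologicalClosure_coe, span_fourier_closure_eq_top]; trivial
  rw [Metric.tendsto_atTop]
  intro ε hε
  obtain ⟨g, hg, hfg⟩ := Metric.mem_closure_iff.1 hcl (ε/3) (by positivity)
  obtain ⟨N, hN⟩ := Metric.tendsto_atTop.1 (hspan g hg) (ε/3) (by positivity)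
  refine ⟨N, fun n hn => ?_⟩
  have h1 := hN n hn
  have hpt : ∀ z, ‖f z - g z‖ ≤ ε/3 := fun z => by
    rw [← dist_eq_norm]; exact (ContinuousMap.dist_apply_le_dist z).trans hfg.le
  have h2 : dist (∫ z, g z ∂ν) (∫ z, f z ∂ν) ≤ ε/3 := by
    rw [dist_comm, dist_eq_norm, ← integral_sub (hint f) (hint g)]
    simpa using norm_integral_le_of_norm_le_const (μ := ν) (ae_of_all _ hpt)
  have h3 : dist ((1 / (n:ℂ)) * ∑ i ∈ Finset.range n, f (y i)) ((1 / (n:ℂ)) * ∑ i ∈ Finset.range n, g (y i)) ≤ ε/3 := by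
    rw [dist_eq_norm, ← mul_sub, ← Finset.sum_sub_distrib, norm_mul, norm_div, norm_one, Complex.norm_natCast]
    have : ‖∑ i ∈ Finset.range n, (f (y i) - g (y i))‖ ≤ n * (ε/3) :=
      (norm_sum_le_of_le _ (fun i _ => hpt (y i))).trans (by simp)
    rcases Nat.eq_zero_or_pos n with rfl | h0
    · simp; positivity
    have h0' : (0:ℝ) < n := by exact_mod_cast h0
    rw [one_div_mul_eq_div, div_le_iff₀ h0']; linarith
  linarith [dist_triangle4 ((1 / (n:ℂ)) * ∑ i ∈ Finset.range n, f (y i)) ((1 / (n:ℂ)) * ∑ i ∈ Finset.range n, g (y i)) (∫ z, g z ∂ν) (∫ z, f z ∂ν)]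

open Classical in
lemma portm {T : ℝ} [Fact (0 < T)] (y : ℕ → AddCircle T) (ν : Measure (AddCircle T))
    [IsProbabilityMeasure ν]
    (h : ∀ l : ℤ, Tendsto (fun n : ℕ => (1 / (n:ℂ)) * ∑ i ∈ Finset.range n, fourier l (y i)) atTop
      (nhds (∫ z, fourier l z ∂ν))) (E : Set (AddCircle T)) (hE : MeasurableSet E)
      (hf : ν (frontier E) = 0) :
    Tendsto (fun n : ℕ => (1 / (n:ℝ)) * ∑ i ∈ Finset.range n, (if y i ∈ E then (1:ℝ) else 0)) atTop
      (nhds (ν E).toReal) := by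
  let μ : ℕ → Measure (AddCircle T) := fun n =>
    ((n + 1 : ℕ) : ENNReal)⁻¹ • ∑ i ∈ Finset.range (n+1), Measure.dirac (y i)
  have hμ : ∀ n, IsProbabilityMeasure (μ n) := fun n => ⟨by
    simp only [μ, Measure.smul_apply, Measure.finsetSum_apply, measure_univ, smul_eq_mul,
      Finset.sum_const, Finset.card_range, nsmul_eq_mul, mul_one]
    exact ENNReal.inv_mul_cancel (by simp) (by simp)⟩
  let P : ℕ → ProbabilityMeasure (AddCircle T) := fun n => ⟨μ n, hμ n⟩
  let Q : ProbabilityMeasure (AddCircle T) := ⟨ν, inferInstance⟩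
  have hlim : Tendsto P atTop (nhds Q) := by
    rw [ProbabilityMeasure.tendsto_iff_forall_integral_tendsto]
    intro f
    let g : C(AddCircle T, ℂ) := ⟨fun z => ((f z : ℝ) : ℂ), by fun_prop⟩
    have h1 := (weyl y ν h g).comp (tendsto_add_atTop_nat 1)
    have h2 := (Complex.continuous_re.tendsto _).comp h1
    have e : (∫ z, g z ∂ν).re = ∫ z, f z ∂ν := by
      simp only [g, ContinuousMap.coe_mk]
      rw [integral_complex_ofReal, Complex.ofReal_re]
    rw [e] at h2
    refine h2.congr fun n => ?_
    simp only [Function.comp, g, ContinuousMap.coe_mk, P, ProbabilityMeasure.coe_mk, μ]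
    rw [integral_smul_measure, integral_finsetSum_measure]
    · simp only [integral_dirac]
      rw [← Complex.ofReal_sum, ENNReal.toReal_inv, ENNReal.toReal_natCast, smul_eq_mul, ← Complex.ofReal_natCast, one_div, ← Complex.ofReal_inv, ← Complex.ofReal_mul, Complex.ofReal_re]
    · intro i _
      exact f.integrable _
  have h3 := ProbabilityMeasure.tendsto_measure_of_null_frontier_of_tendsto' hlim (E := E) (show (Q : Measure (AddCircle T)) (frontier E) = 0 from hf)
  have h4 := (ENNReal.tendsto_toReal (measure_ne_top ν E)).comp h3
  rw [← tendsto_add_atTop_iff_nat 1]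
  refine h4.congr fun n => ?_
  simp only [Function.comp, P, ProbabilityMeasure.coe_mk, μ, Measure.smul_apply, Measure.finsetSum_apply, smul_eq_mul,
    Measure.dirac_apply' _ hE, ENNReal.toReal_mul, ENNReal.toReal_inv, ENNReal.toReal_natCast, one_div]
  congr 1
  rw [ENNReal.toReal_sum]
  · refine Finset.sum_congr rfl fun i _ => ?_
    by_cases hy : y i ∈ E <;> simp [hy]
  · intro i _
    by_cases hy : y i ∈ E <;> simp [hy]

lemma noatom (α β : ℕ) (hβ : 1 ≤ β) (hα : 2 ≤ α) (p : ℝ) (hp0 : 0 < p) (hp : p ≤ 1 / 2)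
    (π : Measure ℝ) [IsProbabilityMeasure π] (hsupp : π (Ici (0 : ℝ)) = 1)
    (hinv : ∀ A : Set ℝ, MeasurableSet A →
      π A = ENNReal.ofReal p * π ((fun y => y + (β : ℝ)) ⁻¹' A)
          + ENNReal.ofReal (1 - p) * π ((fun y => y / (α : ℝ)) ⁻¹' A)) (x₀ : ℝ) : π {x₀} = 0 := by
  by_contra h0
  have hrec : ∀ x, π.real {x} = p * π.real {x - β} + (1 - p) * π.real {α * x} := by
    intro x
    have e1 : (fun y => y + (β : ℝ)) ⁻¹' {x} = {x - (β:ℝ)} := by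
      ext y; simp only [mem_preimage, mem_singleton_iff, eq_sub_iff_add_eq]
    have e2 : (fun y => y / (α : ℝ)) ⁻¹' {x} = {α * x} := by
      have : (α:ℝ) ≠ 0 := by positivity
      ext y; simp [div_eq_iff this, mul_comm]
    have := hinv {x} (measurableSet_singleton x)
    rw [e1, e2] at this
    simp only [Measure.real]
    rw [this, ENNReal.toReal_add (by finiteness) (by finiteness), ENNReal.toReal_mul, ENNReal.toReal_mul,
      ENNReal.toReal_ofReal hp0.le, ENNReal.toReal_ofReal (by linarith)]
  have hfin : Set.Finite {x : ℝ | π {x₀} ≤ π {x}} := by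
    refine Measure.finite_const_le_meas_of_disjoint_iUnion π (pos_iff_ne_zero.2 h0) (As := fun x : ℝ => {x})
      (fun x => measurableSet_singleton x) ?_ (by finiteness)
    intro a b hab
    simpa using hab
  obtain ⟨x, hx, hmax⟩ := Set.exists_max_image _ (fun x => π {x}) hfin ⟨x₀, le_refl (π {x₀})⟩
  have hmax' : ∀ z, π.real {z} ≤ π.real {x} := by
    intro z
    apply ENNReal.toReal_mono (by finiteness)
    by_cases hz : π {x₀} ≤ π {z}
    · exact hmax z hz
    · exact (not_le.1 hz).le.trans hx
  have hj : ∀ j : ℕ, π.real {x - j * β} = π.real {x} := by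
    intro j
    induction j with
    | zero => simp
    | succ j ih =>
      have h1 := hrec (x - j * β)
      rw [ih] at h1
      have h2 := hmax' (α * (x - j * β))
      have h3 := hmax' (x - j * β - β)
      have e : x - ((j+1 : ℕ):ℝ) * β = x - j * β - β := by push_cast; ring
      rw [e]
      apply le_antisymm h3
      have h4 : (1-p) * π.real {α * (x - j * β)} ≤ (1-p) * π.real {x} := by
        apply mul_le_mul_of_nonneg_left h2; linarith
      have : p * π.real {x} ≤ p * π.real {x - j * β - β} := by linarith
      exact le_of_mul_le_mul_left this hp0
  have hneg : ∀ z < 0, π.real {z} = 0 := by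
    intro z hz
    have h1 : π (Ici (0:ℝ))ᶜ = 0 := by
      rw [prob_compl_eq_zero_iff measurableSet_Ici]; exact hsupp
    have : π {z} = 0 := measure_mono_null (by simpa using hz) h1
    simp [Measure.real, this]
  obtain ⟨j, hjx⟩ := exists_nat_gt x
  have hb : (1:ℝ) ≤ β := by exact_mod_cast hβ
  have h1 := hj j
  rw [hneg] at h1
  · have : π.real {x₀} ≤ 0 := by rw [h1]; exact hmax' x₀
    have h2 : π.real {x₀} = 0 := le_antisymm this measureReal_nonneg
    rw [measureReal_eq_zero_iff] at h2
    exact h0 h2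
  · have : (0:ℝ) ≤ j := by positivity
    nlinarith

lemma freq_shift (u : ℕ → ℝ) (h0 : ∀ i, 0 ≤ u i) (h1 : ∀ i, u i ≤ 1) (m : ℕ) (L : ℝ) :
    Tendsto (fun n : ℕ => (1 / (n:ℝ)) * ∑ i ∈ Finset.range n, u (i + m)) atTop (nhds L) ↔
    Tendsto (fun n : ℕ => (1 / (n:ℝ)) * ∑ i ∈ Finset.range n, u i) atTop (nhds L) := by
  have hd : Tendsto (fun n : ℕ => (1 / (n:ℝ)) * ∑ i ∈ Finset.range n, u (i + m) -
      (1 / (n:ℝ)) * ∑ i ∈ Finset.range n, u i) atTop (nhds 0) := by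
    refine squeeze_zero_norm (fun n => ?_) (tendsto_const_div_atTop_nhds_zero_nat (m:ℝ))
    have e : ∑ i ∈ Finset.range n, u (i + m) - ∑ i ∈ Finset.range n, u i
        = ∑ i ∈ Finset.range m, u (n + i) - ∑ i ∈ Finset.range m, u i := by
      have a := Finset.sum_range_add u n m
      have b := Finset.sum_range_add u m n
      rw [add_comm m n] at b
      simp_rw [add_comm m] at b
      linarith
    have hA : ∀ v : ℕ → ℝ, (∀ i, 0 ≤ v i) → (∀ i, v i ≤ 1) → 0 ≤ ∑ i ∈ Finset.range m, v i ∧ ∑ i ∈ Finset.range m, v i ≤ m :=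
      fun v hv0 hv1 => ⟨Finset.sum_nonneg fun i _ => hv0 i,
        (Finset.sum_le_sum fun i _ => hv1 i).trans (by simp)⟩
    obtain ⟨a, b⟩ := hA u h0 h1
    obtain ⟨c, d⟩ := hA (fun i => u (n+i)) (fun i => h0 _) (fun i => h1 _)
    rw [← mul_sub, e, norm_mul, Real.norm_of_nonneg (by positivity), one_div_mul_eq_div]
    gcongr
    rw [Real.norm_eq_abs, abs_le]; constructor <;> linarith
  constructor
  · intro h
    have := h.sub hd
    simpa using this
  · intro h
    have := h.add hd
    simpa using this

lemma main_ae (α β : ℕ) (hα : 2 ≤ α) (p : ℝ) (hp0 : 0 < p) (hp : p ≤ 1 / 2)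
    (π : Measure ℝ) [IsProbabilityMeasure π]
    (hinv : ∀ A : Set ℝ, MeasurableSet A →
      π A = ENNReal.ofReal p * π ((fun y => y + (β : ℝ)) ⁻¹' A)
          + ENNReal.ofReal (1 - p) * π ((fun y => y / (α : ℝ)) ⁻¹' A)) (l : ℤ) :
    ∀ᵐ x ∂π, Tendsto (fun n : ℕ => (1 / (n:ℂ)) * ∑ i ∈ Finset.range n,
      ee (2 * Real.pi * l / α * α^i) x) atTop (nhds (ph π (2 * Real.pi * l / α))) := by
  set u : ℝ := 2 * Real.pi * l / α with hu
  have hcov := ph_cov α β hα p hp0 hp π hinv l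
  have hin := ph_inv α β hα p hp0 hp π hinv
  have hin' := hin l
  rw [← hu] at hcov hin'
  have ha : (α:ℝ) ≠ 0 := by positivity
  set c := ph π u with hc
  have := aslem π (fun i x => ee (u * α^i) x - c)
    (fun i => ((ee_meas _).measurable).sub_const _)
    (fun i x => (norm_sub_le _ _).trans (by
      have := ph_norm π u
      rw [ee_norm]; linarith)) (4 * β * |u|) (by positivity) (by
    intro n i hi
    obtain ⟨d, rfl⟩ := Nat.exists_eq_add_of_lt hi
    have e : ∀ x, (ee (u * α^(i+d+1)) x - c) * (starRingEnd ℂ) (ee (u * α^i) x - c)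
        = ee (u * α^i * (α^(d+1) - 1)) x - (starRingEnd ℂ) c * ee (u * α^(i+d+1)) x
          - (c * ee (-(u * α^i)) x - c * (starRingEnd ℂ) c) := by
      intro x
      rw [map_sub, ee_conj, show u * (α:ℝ)^i * (α^(d+1) - 1) = u * α^(i+d+1) + -(u*α^i) by ring, ee_add]
      ring
    simp_rw [e]
    have I1 := ee_integrable π (u * α^i * (α^(d+1) - 1))
    have I2 := (ee_integrable π (u * α^(i+d+1))).const_mul ((starRingEnd ℂ) c)
    have I3 := (ee_integrable π (-(u * α^i))).const_mul c
    have I12 : Integrable (fun x => ee (u * α^i * (α^(d+1) - 1)) x - (starRingEnd ℂ) c * ee (u * α^(i+d+1)) x) π := I1.sub I2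
    have I34 : Integrable (fun x => c * ee (-(u * α^i)) x - c * (starRingEnd ℂ) c) π := I3.sub (integrable_const _)
    rw [integral_sub I12 I34, integral_sub I1 I2, integral_sub I3 (integrable_const _), integral_const_mul, integral_const_mul]
    change ‖ph π _ - (starRingEnd ℂ) c * ph π _ - (c * ph π _ - _)‖ ≤ _
    rw [ph_neg, hin', hin', show i + d + 1 - i = d + 1 by omega]
    have e1 : u * (α:ℝ)^i * (α^(d+1) - 1) = 2 * Real.pi * ((l * (α^(d+1) - 1) : ℤ):ℝ) / α * α^i := by
      rw [hu]; push_cast; ring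
    have e2 : u * ((α:ℝ)^(d+1) - 1) = 2 * Real.pi * ((l * (α^(d+1) - 1) : ℤ):ℝ) / α := by
      rw [hu]; push_cast; ring
    rw [e1, hin, ← e2]
    have := hcov (d+1)
    convert this using 2
    simp
    ring)
  filter_upwards [this] with x hx
  have h2 := hx.add_const c
  rw [zero_add] at h2
  refine h2.congr' ?_
  filter_upwards [eventually_ge_atTop 1] with n hn
  have : (n:ℂ) ≠ 0 := by exact_mod_cast (by omega : n ≠ 0)
  rw [Finset.sum_sub_distrib]
  simp
  field_simp
  ring

/-- the arc -/
def arc (α k : ℕ) : Set (AddCircle (α:ℝ)) := (fun z : ℝ => (z : AddCircle (α:ℝ))) '' Ico (k:ℝ) (k+1)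

lemma mem_arc (α k : ℕ) (hk : k < α) (y : ℝ) : (y : AddCircle (α:ℝ)) ∈ arc α k ↔ ⌊y⌋ % (α:ℤ) = k := by
  constructor
  · rintro ⟨z, hz, hzy⟩
    have h1 := QuotientAddGroup.eq.1 hzy
    obtain ⟨m, hm⟩ := AddSubgroup.mem_zmultiples_iff.1 h1
    have hy : y = z + ((m * α : ℤ):ℝ) := by
      simp only [zsmul_eq_mul] at hm; push_cast; linarith
    have hz' : ⌊z⌋ = (k:ℤ) := by
      rw [Int.floor_eq_iff]; exact_mod_cast hz
    rw [hy, Int.floor_add_intCast, hz', Int.add_mul_emod_self_right]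
    exact Int.emod_eq_of_lt (by positivity) (by exact_mod_cast hk)
  · intro h
    refine ⟨y - ((⌊y⌋ / (α:ℤ) * α : ℤ):ℝ), ?_, ?_⟩
    · have : ⌊y - ((⌊y⌋ / (α:ℤ) * α : ℤ):ℝ)⌋ = (k:ℤ) := by
        rw [Int.floor_sub_intCast]
        have := Int.emod_add_mul_ediv ⌊y⌋ α
        rw [h] at this; linarith
      rw [Int.floor_eq_iff] at this
      exact_mod_cast this
    · refine QuotientAddGroup.eq.2 (AddSubgroup.mem_zmultiples_iff.2 ⟨⌊y⌋ / (α:ℤ), ?_⟩)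
      simp

lemma arc_meas (α k : ℕ) : MeasurableSet (arc α k) := by
  have : arc α k = (fun z : ℝ => (z : AddCircle (α:ℝ))) '' Ioo (k:ℝ) (k+1) ∪ {((k:ℝ) : AddCircle (α:ℝ))} := by
    unfold arc
    rw [← Ioo_union_left (by linarith : (k:ℝ) < k+1), image_union, image_singleton]
  rw [this]
  exact ((QuotientAddGroup.isOpenMap_coe _ isOpen_Ioo).measurableSet).union (measurableSet_singleton _)

lemma arc_frontier (α k : ℕ) : frontier (arc α k) ⊆
    (fun z : ℝ => (z : AddCircle (α:ℝ))) '' {(k:ℝ), (k:ℝ)+1} := by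
  have hc : closure (arc α k) ⊆ (fun z : ℝ => (z : AddCircle (α:ℝ))) '' Icc (k:ℝ) (k+1) :=
    closure_minimal (image_mono Ico_subset_Icc_self)
      ((isCompact_Icc.image (AddCircle.continuous_mk' _)).isClosed)
  have hi : (fun z : ℝ => (z : AddCircle (α:ℝ))) '' Ioo (k:ℝ) (k+1) ⊆ interior (arc α k) :=
    interior_maximal (image_mono Ioo_subset_Ico_self) (QuotientAddGroup.isOpenMap_coe _ isOpen_Ioo)
  rintro w ⟨hw1, hw2⟩
  obtain ⟨z, hz, rfl⟩ := hc hw1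
  refine ⟨z, ?_, rfl⟩
  by_contra hne
  simp only [mem_insert_iff, mem_singleton_iff, not_or] at hne
  exact hw2 (hi ⟨z, ⟨lt_of_le_of_ne hz.1 (Ne.symm hne.1), lt_of_le_of_ne hz.2 hne.2⟩, rfl⟩)

lemma arc_null (α k : ℕ) (π : Measure ℝ) (h : ∀ x, π {x} = 0) :
    (π.map (fun z : ℝ => (z : AddCircle (α:ℝ)))) (frontier (arc α k)) = 0 := by
  have hmm : Measurable (fun z : ℝ => (z : AddCircle (α:ℝ))) := (AddCircle.continuous_mk' _).measurable
  rw [Measure.map_apply hmm isClosed_frontier.measurableSet]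
  have hs : (fun z : ℝ => (z : AddCircle (α:ℝ))) ⁻¹' (frontier (arc α k)) ⊆ range (fun n : ℤ => (n:ℝ)) := by
    intro y hy
    obtain ⟨z, hz, hzy⟩ := arc_frontier α k hy
    obtain ⟨m, hm⟩ := AddSubgroup.mem_zmultiples_iff.1 (QuotientAddGroup.eq.1 hzy)
    simp only [zsmul_eq_mul] at hm
    rcases hz with hz | hz
    · exact ⟨k + m * α, by push_cast; rw [hz] at hm; linarith⟩
    · exact ⟨k + 1 + m * α, by push_cast; rw [mem_singleton_iff.1 hz] at hm; linarith⟩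
  refine measure_mono_null hs ?_
  have : NullSingletonClass π := ⟨h⟩
  exact (countable_range _).measure_zero π

lemma arc_xi (α k : ℕ) (hk : k < α) (π : Measure ℝ) [IsProbabilityMeasure π]
    (hsupp : π (Ici (0 : ℝ)) = 1) :
    ((π.map (fun z : ℝ => (z : AddCircle (α:ℝ)))) (arc α k)).toReal = xi α π k := by
  unfold xi
  congr 1
  have hmm : Measurable (fun z : ℝ => (z : AddCircle (α:ℝ))) := (AddCircle.continuous_mk' _).measurable
  rw [Measure.map_apply hmm (arc_meas α k)]
  have h1 : π (Ici (0:ℝ))ᶜ = 0 := by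
    rw [prob_compl_eq_zero_iff measurableSet_Ici]; exact hsupp
  rw [← measure_iUnion]
  · apply measure_congr
    have : ∀ᵐ x ∂π, x ∈ Ici (0:ℝ) := h1
    filter_upwards [this] with x hx
    have hx0 : (0:ℝ) ≤ x := hx
    apply propext
    change ((x : AddCircle (α:ℝ)) ∈ arc α k) ↔ x ∈ ⋃ m : ℕ, Ico ((m : ℝ) * α + k) ((m : ℝ) * α + k + 1)
    rw [mem_arc α k hk, mem_iUnion]
    constructor
    · intro h
      have hf : 0 ≤ ⌊x⌋ := Int.floor_nonneg.2 hx0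
      have hq : 0 ≤ ⌊x⌋ / (α:ℤ) := Int.ediv_nonneg hf (by positivity)
      obtain ⟨m, hm⟩ := Int.eq_ofNat_of_zero_le hq
      refine ⟨m, ?_⟩
      have h3 : ⌊x⌋ = ((m * α + k : ℕ):ℤ) := by
        have := Int.emod_add_mul_ediv ⌊x⌋ α
        rw [h, hm] at this; push_cast; linarith
      rw [Int.floor_eq_iff] at h3
      exact_mod_cast h3
    · rintro ⟨m, hm⟩
      have h3 : ⌊x⌋ = ((k:ℤ) + m * α) := by
        rw [Int.floor_eq_iff]; push_cast
        constructor <;> linarith [hm.1, hm.2]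
      rw [h3, Int.add_mul_emod_self_right]
      exact Int.emod_eq_of_lt (by positivity) (by exact_mod_cast hk)
  · intro m n hmn
    rw [Function.onFun, Set.disjoint_left]
    intro x hm hn
    apply hmn
    have h3 : ⌊x⌋ = ((m:ℤ) * α + k) := by
      rw [Int.floor_eq_iff]; push_cast; exact hm
    have h4 : ⌊x⌋ = ((n:ℤ) * α + k) := by
      rw [Int.floor_eq_iff]; push_cast; exact hn
    have h5 : (m:ℤ) * α = n * α := by linarith
    have h6 : (α:ℤ) ≠ 0 := by omega
    exact_mod_cast mul_right_cancel₀ h6 h5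
  · intro m; exact measurableSet_Ico


theorem stmt10 (α β : ℕ) (hα : 2 ≤ α) (hβ : 1 ≤ β) (p : ℝ) (hp0 : 0 < p) (hp : p ≤ 1 / 2)
    (π : Measure ℝ) [IsProbabilityMeasure π] (hsupp : π (Ici (0 : ℝ)) = 1)
    (hinv : ∀ A : Set ℝ, MeasurableSet A →
      π A = ENNReal.ofReal p * π ((fun y => y + (β : ℝ)) ⁻¹' A)
          + ENNReal.ofReal (1 - p) * π ((fun y => y / (α : ℝ)) ⁻¹' A)) :
    ∀ᵐ x ∂π, 0 < x ∧ ∀ k : ℕ, k < α →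
      Tendsto
        (fun n : ℕ =>
          (1 / (n : ℝ)) * ((Finset.Icc 1 n).filter fun i => digit α x i = (k : ℤ)).card)
        atTop (nhds (xi α π k)) := by
  have hna := noatom α β hβ hα p hp0 hp π hsupp hinv
  have h1 : π (Ici (0:ℝ))ᶜ = 0 := by
    rw [prob_compl_eq_zero_iff measurableSet_Ici]; exact hsupp
  have hae0 : ∀ᵐ x ∂π, x ∈ Ici (0:ℝ) := h1
  have hae1 : ∀ᵐ x ∂π, x ≠ 0 := by
    rw [ae_iff]; simpa using hna 0
  have hall := ae_all_iff.2 (main_ae α β hα p hp0 hp π hinv)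
  have hapos : (0:ℝ) < α := by positivity
  have : Fact ((0:ℝ) < α) := ⟨hapos⟩
  have hmm : Measurable (fun z : ℝ => (z : AddCircle (α:ℝ))) := (AddCircle.continuous_mk' _).measurable
  have := Measure.isProbabilityMeasure_map (μ := π) hmm.aemeasurable
  have hfe : ∀ (l : ℤ) (i : ℕ) (x : ℝ), fourier l (((α:ℝ)^i * x : ℝ) : AddCircle (α:ℝ)) =
      ee (2 * Real.pi * l / α * α^i) x := by
    intro l i x
    rw [fourier_coe_apply]; unfold ee; congr 1; push_cast; ring
  have hfi : ∀ l : ℤ, ∫ z, fourier l z ∂(π.map (fun z : ℝ => (z : AddCircle (α:ℝ)))) =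
      ph π (2 * Real.pi * l / α) := by
    intro l
    rw [integral_map hmm.aemeasurable (fourier l).continuous.aestronglyMeasurable]
    unfold ph; congr 1; ext x
    have := hfe l 0 x
    simpa only [pow_zero, one_mul, mul_one] using this
  filter_upwards [hae0, hae1, hall] with x hx0 hx1 hx
  have hxpos : 0 < x := lt_of_le_of_ne hx0 (Ne.symm hx1)
  refine ⟨hxpos, fun k hk => ?_⟩
  have hp1 := portm (fun i : ℕ => (((α:ℝ)^i * x : ℝ) : AddCircle (α:ℝ)))
    (π.map (fun z : ℝ => (z : AddCircle (α:ℝ)))) (fun l => by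
      rw [hfi]; simp_rw [hfe]; exact hx l) (arc α k) (arc_meas α k) (arc_null α k π hna)
  rw [arc_xi α k hk π hsupp] at hp1
  simp_rw [mem_arc α k hk] at hp1
  set w : ℕ → ℝ := fun i => if ⌊(α:ℝ)^i * x⌋ % (α:ℤ) = k then (1:ℝ) else 0 with hw
  let v : ℕ → ℝ := fun i => if digit α x i = (k:ℤ) then (1:ℝ) else 0
  have hw0 : ∀ i, 0 ≤ w i := fun i => by simp only [hw]; split_ifs <;> norm_num
  have hw1 : ∀ i, w i ≤ 1 := fun i => by simp only [hw]; split_ifs <;> norm_num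
  have hv0 : ∀ i, 0 ≤ v i := fun i => by simp only [v]; split_ifs <;> norm_num
  have hv1 : ∀ i, v i ≤ 1 := fun i => by simp only [v]; split_ifs <;> norm_num
  have hw' : Tendsto (fun n : ℕ => (1 / (n:ℝ)) * ∑ i ∈ Finset.range n, w i) atTop (nhds (xi α π k)) := by
    refine hp1.congr fun n => ?_
    congr 1
  have hv : Tendsto (fun n : ℕ => (1 / (n:ℝ)) * ∑ i ∈ Finset.range n, v i) atTop (nhds (xi α π k)) := by
    obtain ⟨m, hm | hm⟩ := Int.eq_nat_or_neg (⌊Real.log x / Real.log α⌋ + 1)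
    · rw [← freq_shift v hv0 hv1 m]
      have : ∀ i, v (i + m) = w i := by
        intro i
        have : (α:ℝ)^(i+m) * (x * (α:ℝ) ^ (-(⌊Real.log x / Real.log α⌋ + 1))) = (α:ℝ)^i * x := by
          rw [hm, zpow_neg, zpow_natCast, pow_add]; field_simp
        simp only [v, hw, digit, this]
      simp_rw [this]; exact hw'
    · rw [← freq_shift w hw0 hw1 m] at hw'
      have : ∀ i, v i = w (i + m) := by
        intro i
        have : (α:ℝ)^i * (x * (α:ℝ) ^ (-(⌊Real.log x / Real.log α⌋ + 1))) = (α:ℝ)^(i+m) * x := by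
          rw [hm, neg_neg, zpow_natCast, pow_add]; ring
        simp only [v, hw, digit, this]
      simp_rw [this]; exact hw'
  rw [← freq_shift v hv0 hv1 1] at hv
  refine hv.congr fun n => ?_
  congr 1
  rw [Finset.card_filter, Finset.range_eq_Ico, Finset.sum_Ico_add' v 0 n 1]
  push_cast
  rfl
end

section
/- Suppose β = α^t for some integer t ≥ 0. Define the upper local dimension dim̄π(x) = limsup_{r→0+} log π(B(x,r))/log r, and the lower and upper packing dimensions of π by dim_P π = sup{ s ∈ ℝ : dim̄π(x) ≥ s for π-almost every x } and dim_P^* π = inf{ s ∈ ℝ : dim̄π(x) ≤ s for π-almost every x }. Then d̲(Σ_{i=0}^{α−1} i·ξ_i) ≤ dim_P π ≤ dim_P^* π ≤ d̄(Σ_{i=0}^{α−1} i·ξ_i). (Remark on packing dimensions.) -/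
open MeasureTheory Set Filter

/-- The upper local dimension `limsup_{r→0+} log π(B(x,r))/log r`. -/
noncomputable def upperLocalDim (π : Measure ℝ) (x : ℝ) : ℝ :=
  limsup (fun r : ℝ => Real.log (π (Metric.ball x r)).toReal / Real.log r)
    (nhdsWithin 0 (Ioi 0))

/-- `d̲(y) = d̄(y) - log(1-p^{α-1})/log(α⁻¹)`. -/
noncomputable def dLow (α : ℕ) (p y : ℝ) : ℝ :=
  dBar α p y - Real.log (1 - p ^ (α - 1)) / Real.log ((α : ℝ)⁻¹)


structure PHyp (α β : ℕ) (p : ℝ) (π : Measure ℝ) : Prop where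
  ha : 2 ≤ α
  hb : 1 ≤ β
  p0 : 0 < p
  p1 : p ≤ 1 / 2
  prob : IsProbabilityMeasure π
  supp : π (Ici (0 : ℝ)) = 1
  inv : ∀ A : Set ℝ, MeasurableSet A →
      π A = ENNReal.ofReal p * π ((fun y => y + (β : ℝ)) ⁻¹' A)
          + ENNReal.ofReal (1 - p) * π ((fun y => y / (α : ℝ)) ⁻¹' A)

namespace PHyp

variable {α β : ℕ} {p : ℝ} {π : Measure ℝ}

theorem intble (H : PHyp α β p π) {f : ℝ → ℝ} (hf : Measurable f) {B : ℝ}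
    (hB : ∀ x, |f x| ≤ B) : Integrable f π := by
  have := H.prob
  exact Integrable.of_bound hf.aestronglyMeasurable B (Eventually.of_forall hB)

theorem absint (H : PHyp α β p π) {f : ℝ → ℝ} {B : ℝ}
    (hB : ∀ x, |f x| ≤ B) : |∫ x, f x ∂π| ≤ B := by
  have := H.prob
  have := norm_integral_le_of_norm_le_const (μ := π) (f := f) (C := B) (Eventually.of_forall hB)
  simpa using this

theorem integral_inv (H : PHyp α β p π) {f : ℝ → ℝ} (hf : Measurable f) {B : ℝ}
    (hB : ∀ x, |f x| ≤ B) :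
    ∫ x, f x ∂π = p * ∫ x, f (x + β) ∂π + (1 - p) * ∫ x, f (x / α) ∂π := by
  have := H.prob
  have h1 : Measurable (fun y : ℝ => y + (β : ℝ)) := by fun_prop
  have h2 : Measurable (fun y : ℝ => y / (α : ℝ)) := by fun_prop
  have e : π = ENNReal.ofReal p • π.map (fun y : ℝ => y + (β : ℝ))
      + ENNReal.ofReal (1 - p) • π.map (fun y : ℝ => y / (α : ℝ)) := by
    ext A hA
    rw [H.inv A hA]
    simp [Measure.map_apply h1 hA, Measure.map_apply h2 hA]
  have := Measure.isProbabilityMeasure_map (μ := π) h1.aemeasurable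
  have := Measure.isProbabilityMeasure_map (μ := π) h2.aemeasurable
  have i1 : Integrable f (π.map (fun y : ℝ => y + (β : ℝ))) :=
    Integrable.of_bound hf.aestronglyMeasurable B (Eventually.of_forall hB)
  have i2 : Integrable f (π.map (fun y : ℝ => y / (α : ℝ))) :=
    Integrable.of_bound hf.aestronglyMeasurable B (Eventually.of_forall hB)
  conv_lhs => rw [e]
  rw [integral_add_measure (i1.smul_measure ENNReal.ofReal_ne_top)
    (i2.smul_measure ENNReal.ofReal_ne_top), integral_smul_measure, integral_smul_measure,
    integral_map h1.aemeasurable hf.aestronglyMeasurable,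
    integral_map h2.aemeasurable hf.aestronglyMeasurable]
  rw [ENNReal.toReal_ofReal H.p0.le, ENNReal.toReal_ofReal (by linarith [H.p1])]
  simp

theorem apos (H : PHyp α β p π) : (0 : ℝ) < α := by
  have := H.ha
  positivity

theorem a2 (H : PHyp α β p π) : (2 : ℝ) ≤ α := by
  exact_mod_cast H.ha

theorem moment (H : PHyp α β p π) : Integrable (fun x : ℝ => x) π := by
  have := H.prob
  have hp0 := H.p0
  have hp1 := H.p1
  have ha := H.a2
  have hcov : AECover π atTop (fun n : ℕ => Icc (-(n : ℝ)) (n : ℝ)) :=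
    aecover_Icc (tendsto_neg_atTop_atBot.comp tendsto_natCast_atTop_atTop)
      tendsto_natCast_atTop_atTop
  refine hcov.integrable_of_integral_norm_bounded (2 * β) ?_ ?_
  · intro n
    exact (continuous_id.continuousOn).integrableOn_Icc
  · refine Eventually.of_forall fun n => ?_
    set f : ℝ → ℝ := fun x => min |x| n with hf
    have fm : Measurable f := by fun_prop
    have fb : ∀ x, |f x| ≤ n := by
      intro x
      rw [abs_of_nonneg (by positivity)]
      exact min_le_right _ _
    have e := H.integral_inv fm fb
    have i0 := H.intble fm fb
    have i1 : Integrable (fun x => f (x + β)) π := H.intble (by fun_prop) (fun x => fb _)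
    have i2 : Integrable (fun x => f (x / α)) π := H.intble (by fun_prop) (fun x => fb _)
    have b1 : ∫ x, f (x + β) ∂π ≤ ∫ x, f x ∂π + β := by
      calc ∫ x, f (x + β) ∂π ≤ ∫ x, (f x + β) ∂π := by
            refine integral_mono i1 (i0.add (integrable_const _)) (fun x => ?_)
            change min |x + (β : ℝ)| n ≤ min |x| n + β
            have : |x + (β : ℝ)| ≤ |x| + β := by
              have := abs_add_le x (β : ℝ)
              simpa using this
            have hb : (0 : ℝ) ≤ β := by positivity
            rcases le_total |x| n with h | h
            · rw [min_eq_left h]; exact (min_le_left _ _).trans this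
            · rw [min_eq_right h]; exact (min_le_right _ _).trans (by linarith)
        _ = _ := by rw [integral_add i0 (integrable_const _)]; simp
    have b2 : ∫ x in Icc (-(n : ℝ)) n, ‖x‖ ∂π ≤ 2 * (∫ x, f x ∂π - ∫ x, f (x / α) ∂π) := by
      rw [← integral_indicator measurableSet_Icc, ← integral_sub i0 i2, ← integral_const_mul]
      apply integral_mono
      · rw [integrable_indicator_iff measurableSet_Icc]
        exact (continuous_norm.continuousOn).integrableOn_Icc
      · exact (i0.sub i2).const_mul _
      · intro x
        have h3 : |x / (α : ℝ)| ≤ |x| / 2 := by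
          rw [abs_div, abs_of_pos H.apos]
          gcongr
        have h4 : min |x / (α : ℝ)| n ≤ min |x| n := by
          apply min_le_min_right
          have := abs_nonneg x
          linarith
        by_cases hx : x ∈ Icc (-(n : ℝ)) n
        · rw [indicator_of_mem hx]
          have : |x| ≤ n := abs_le.2 hx
          simp only [hf, Real.norm_eq_abs]
          rw [min_eq_left this]
          have := min_le_left |x / (α : ℝ)| (n : ℝ)
          linarith
        · rw [indicator_of_notMem hx]
          simp only [hf]
          linarith
    have hb : (0 : ℝ) ≤ β := by positivity
    have : (1 - p) * (∫ x, f x ∂π - ∫ x, f (x / α) ∂π) ≤ p * β := by nlinarith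
    have : (∫ x, f x ∂π - ∫ x, f (x / α) ∂π) ≤ β := by
      by_contra hc
      push Not at hc
      nlinarith
    linarith

theorem station (H : PHyp α β p π) {g : ℝ → ℝ} (hg : Measurable g) {B : ℝ}
    (hB : ∀ x, |g x| ≤ B) (hper : Function.Periodic g α) :
    ∫ x, g (α * x) ∂π = ∫ x, g x ∂π := by
  have e := H.integral_inv (f := fun x => g (α * x)) (by fun_prop) (fun x => hB _)
  have h1 : ∀ x : ℝ, g (α * (x + β)) = g (α * x) := by
    intro x
    have := (hper.nat_mul β) (α * x)
    rw [← this]; congr 1; ring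
  have h2 : ∀ x : ℝ, (α : ℝ) * (x / α) = x := fun x => by
    have := H.apos
    field_simp
  simp only [h1, h2] at e
  have := H.p1
  have h3 : (1 - p) * (∫ x, g (α * x) ∂π - ∫ x, g x ∂π) = 0 := by linarith
  rcases mul_eq_zero.1 h3 with h | h <;> linarith

theorem per_pow {g : ℝ → ℝ} (hper : Function.Periodic g α) (k : ℕ) :
    Function.Periodic (fun x => g ((α : ℝ) ^ k * x)) α := by
  intro x
  have := (hper.nat_mul (α ^ k)) ((α : ℝ) ^ k * x)
  simp only
  rw [← this]; congr 1; push_cast; ring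

theorem station_pow (H : PHyp α β p π) {g : ℝ → ℝ} (hg : Measurable g) {B : ℝ}
    (hB : ∀ x, |g x| ≤ B) (hper : Function.Periodic g α) (k : ℕ) :
    ∫ x, g ((α : ℝ) ^ k * x) ∂π = ∫ x, g x ∂π := by
  induction k with
  | zero => simp
  | succ k ih =>
    rw [← ih, ← H.station (g := fun x => g ((α : ℝ) ^ k * x)) (by fun_prop) (fun x => hB _)
      (per_pow hper k)]
    congr 1; ext x; congr 1; ring

theorem cov_bound (H : PHyp α β p π) {g : ℝ → ℝ} (hg : Measurable g) {B : ℝ}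
    (hB : ∀ x, |g x| ≤ B) (hper : Function.Periodic g α) (C : ℝ) (k : ℕ) :
    ∀ K : ℝ, 0 ≤ K → ∀ h : ℝ → ℝ, Measurable h → (∀ x, |h x| ≤ C) →
      (∀ x y, |h x - h y| ≤ K * |x - y|) →
      |∫ x, h x * g ((α : ℝ) ^ k * x) ∂π - (∫ x, h x ∂π) * ∫ x, g x ∂π|
        ≤ 2 * B * (∫ x, |x| ∂π) * (K / (α : ℝ) ^ k) := by
  have := H.prob
  have hp0 := H.p0
  have hp1 := H.p1
  have ha := H.a2
  have hB0 : 0 ≤ B := (abs_nonneg _).trans (hB 0)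
  have gI : |∫ x, g x ∂π| ≤ B := by
    exact H.absint hB
  have gint := H.intble hg hB
  induction k with
  | zero =>
    intro K hK h hm hC hL
    have hint := H.intble hm hC
    have i2 : Integrable (fun x => h x * g x) π := H.intble (B := C * B) (by fun_prop) (fun x => by
      rw [abs_mul]; exact mul_le_mul (hC x) (hB x) (abs_nonneg _) ((abs_nonneg _).trans (hC x)))
    have e : ∫ x, h x * g ((α : ℝ) ^ 0 * x) ∂π - (∫ x, h x ∂π) * ∫ x, g x ∂π
        = ∫ x, (h x - h 0) * (g x - ∫ y, g y ∂π) ∂π := by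
      have : ∀ x, (h x - h 0) * (g x - ∫ y, g y ∂π)
          = h x * g x - (∫ y, g y ∂π) * h x - h 0 * g x + h 0 * (∫ y, g y ∂π) := fun x => by ring
      simp only [this, pow_zero, one_mul]
      rw [integral_add, integral_sub, integral_sub, integral_const_mul, integral_const_mul]
      · simp
        ring
      · exact i2
      · exact hint.const_mul _
      · exact i2.sub (hint.const_mul _)
      · exact gint.const_mul _
      · exact (i2.sub (hint.const_mul _)).sub (gint.const_mul _)
      · exact integrable_const _
    rw [e, ← Real.norm_eq_abs]
    refine (norm_integral_le_of_norm_le (g := fun x => 2 * B * K * |x|)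
      (H.moment.abs.const_mul _) (Eventually.of_forall fun x => ?_)).trans ?_
    · rw [Real.norm_eq_abs, abs_mul]
      have h1 := hL x 0
      rw [sub_zero] at h1
      have h2 : |g x - ∫ y, g y ∂π| ≤ 2 * B := by
        have := abs_sub (g x) (∫ y, g y ∂π)
        have := hB x
        linarith
      calc _ ≤ (K * |x|) * (2 * B) := by gcongr
        _ = _ := by ring
    · rw [integral_const_mul]
      apply le_of_eq; simp; ring
  | succ k ih =>
    intro K hK h hm hC hL
    set b := 2 * B * (∫ x, |x| ∂π) * (K / (α : ℝ) ^ (k + 1)) with hb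
    have key : ∀ n : ℕ, ∀ h : ℝ → ℝ, Measurable h → (∀ x, |h x| ≤ C) →
      (∀ x y, |h x - h y| ≤ K * |x - y|) →
      |∫ x, h x * g ((α : ℝ) ^ (k + 1) * x) ∂π - (∫ x, h x ∂π) * ∫ x, g x ∂π|
        ≤ p ^ n * (2 * (C * B)) + b := by
      intro n
      have hb0 : 0 ≤ b := by
        have : 0 ≤ ∫ x, |x| ∂π := integral_nonneg (fun x => abs_nonneg x)
        positivity
      induction n with
      | zero =>
        intro h hm hC hL
        have hC0 : 0 ≤ C := (abs_nonneg _).trans (hC 0)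
        have h1 : |∫ x, h x * g ((α : ℝ) ^ (k + 1) * x) ∂π| ≤ C * B := by
          exact H.absint (fun x => by
            rw [abs_mul]
            exact mul_le_mul (hC x) (hB _) (abs_nonneg _) hC0)
        have h2 : |∫ x, h x ∂π| ≤ C := by
          exact H.absint hC
        have h3 : |(∫ x, h x ∂π) * ∫ x, g x ∂π| ≤ C * B := by
          rw [abs_mul]; exact mul_le_mul h2 gI (abs_nonneg _) hC0
        have := abs_sub (∫ x, h x * g ((α : ℝ) ^ (k + 1) * x) ∂π) ((∫ x, h x ∂π) * ∫ x, g x ∂π)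
        linarith
      | succ n ihn =>
        intro h hm hC hL
        have hC0 : 0 ≤ C := (abs_nonneg _).trans (hC 0)
        have e1 := H.integral_inv hm hC
        have e2 := H.integral_inv (f := fun x => h x * g ((α : ℝ) ^ (k + 1) * x)) (B := C * B)
          (by fun_prop) (fun x => by
            rw [abs_mul]; exact mul_le_mul (hC x) (hB _) (abs_nonneg _) hC0)
        have r1 : ∀ x : ℝ, g ((α : ℝ) ^ (k + 1) * (x + β)) = g ((α : ℝ) ^ (k + 1) * x) := by
          intro x
          have := (hper.nat_mul (α ^ k * β)) ((α : ℝ) ^ (k + 1) * x)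
          rw [← this]; congr 1; push_cast; ring
        have r2 : ∀ x : ℝ, (α : ℝ) ^ (k + 1) * (x / α) = (α : ℝ) ^ k * x := fun x => by
          have := H.apos
          field_simp
          ring
        simp only [r1, r2] at e2
        have q1 := ihn (fun x => h (x + β)) (by fun_prop) (fun x => hC _) (fun x y => by
          have := hL (x + β) (y + β)
          simpa using this)
        have q2 := ih (K / α) (by positivity) (fun x => h (x / α)) (by fun_prop) (fun x => hC _)
          (fun x y => by
            have := hL (x / α) (y / α)
            rw [← sub_div, abs_div, abs_of_pos H.apos] at this
            calc _ ≤ _ := this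
              _ = _ := by ring)
        have q3 : 2 * B * (∫ x, |x| ∂π) * (K / α / (α : ℝ) ^ k) = b := by
          rw [hb, pow_succ, div_div]; ring
        rw [q3] at q2
        rw [e2, e1]
        have : p * ∫ x, h (x + β) * g ((α : ℝ) ^ (k + 1) * x) ∂π
            + (1 - p) * ∫ x, h (x / α) * g ((α : ℝ) ^ k * x) ∂π
            - (p * ∫ x, h (x + β) ∂π + (1 - p) * ∫ x, h (x / α) ∂π) * ∫ x, g x ∂π
            = p * (∫ x, h (x + β) * g ((α : ℝ) ^ (k + 1) * x) ∂π
                - (∫ x, h (x + β) ∂π) * ∫ x, g x ∂π)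
              + (1 - p) * (∫ x, h (x / α) * g ((α : ℝ) ^ k * x) ∂π
                - (∫ x, h (x / α) ∂π) * ∫ x, g x ∂π) := by ring
        rw [this]
        refine (abs_add_le _ _).trans ?_
        rw [abs_mul, abs_mul, abs_of_pos hp0, abs_of_pos (by linarith : 0 < 1 - p)]
        calc _ ≤ p * (p ^ n * (2 * (C * B)) + b) + (1 - p) * b := by
              apply add_le_add
              · exact mul_le_mul_of_nonneg_left q1 hp0.le
              · exact mul_le_mul_of_nonneg_left q2 (by linarith)
          _ = _ := by ring
    have lim : Tendsto (fun n : ℕ => p ^ n * (2 * (C * B)) + b) atTop (nhds (0 * (2 * (C * B)) + b)) :=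
      ((tendsto_pow_atTop_nhds_zero_of_lt_one hp0.le (by linarith)).mul_const _).add_const _
    rw [zero_mul, zero_add] at lim
    exact ge_of_tendsto' lim (fun n => key n h hm hC hL)


theorem var_bound (H : PHyp α β p π) {F : ℝ → ℝ} (hF : Measurable F) {B K : ℝ}
    (hB : ∀ x, |F x| ≤ B) (hK : 0 ≤ K) (hL : ∀ x y, |F x - F y| ≤ K * |x - y|)
    (hper : Function.Periodic F α) (h0 : ∫ x, F x ∂π = 0) :
    ∃ C : ℝ, 0 ≤ C ∧ ∀ n : ℕ, ∫ x, (∑ i ∈ Finset.range n, F ((α : ℝ) ^ i * x)) ^ 2 ∂π ≤ C * n := by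
  have := H.prob
  have ha := H.a2
  have hB0 : 0 ≤ B := (abs_nonneg _).trans (hB 0)
  set c := 2 * B * (∫ x, |x| ∂π) * K with hc
  have hc0 : 0 ≤ c := by
    have : 0 ≤ ∫ x, |x| ∂π := integral_nonneg (fun x => abs_nonneg x)
    positivity
  have hcov : ∀ i k : ℕ, |∫ x, F ((α : ℝ) ^ i * x) * F ((α : ℝ) ^ (i + k) * x) ∂π|
      ≤ c * (1 / 2) ^ k := by
    intro i k
    have e : ∫ x, F ((α : ℝ) ^ i * x) * F ((α : ℝ) ^ (i + k) * x) ∂π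
        = ∫ x, F x * F ((α : ℝ) ^ k * x) ∂π := by
      rw [← H.station_pow (g := fun x => F x * F ((α : ℝ) ^ k * x)) (B := B * B) (by fun_prop)
        (fun x => by rw [abs_mul]; exact mul_le_mul (hB _) (hB _) (abs_nonneg _) hB0)
        (hper.mul (per_pow hper k)) i]
      congr 1; ext x; congr 2; ring
    rw [e]
    have h := H.cov_bound hF hB hper B k K hK F hF hB hL
    rw [h0, mul_zero, sub_zero] at h
    refine h.trans ?_
    rw [hc, mul_assoc (2 * B * (∫ x, |x| ∂π)) K]
    have : 0 ≤ ∫ x, |x| ∂π := integral_nonneg (fun x => abs_nonneg x)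
    apply mul_le_mul_of_nonneg_left _ (by positivity)
    rw [div_eq_mul_inv, one_div, inv_pow]
    gcongr
  refine ⟨2 * c + B ^ 2, by positivity, fun n => ?_⟩
  have hm : ∀ n : ℕ, Measurable (fun x => ∑ i ∈ Finset.range n, F ((α : ℝ) ^ i * x)) := by
    intro n; fun_prop
  have hb : ∀ n : ℕ, ∀ x, |∑ i ∈ Finset.range n, F ((α : ℝ) ^ i * x)| ≤ n * B := by
    intro n x
    refine (Finset.abs_sum_le_sum_abs _ _).trans ?_
    refine (Finset.sum_le_card_nsmul _ _ B (fun i _ => hB _)).trans ?_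
    simp
  have hprod : ∀ {f g : ℝ → ℝ} {b c : ℝ}, Measurable f → Measurable g → (∀ x, |f x| ≤ b) →
      (∀ x, |g x| ≤ c) → Integrable (fun x => f x * g x) π := by
    intro f g b c hf hg hb hc
    refine H.intble (B := b * c) (by fun_prop) (fun x => ?_)
    rw [abs_mul]; exact mul_le_mul (hb _) (hc _) (abs_nonneg _) ((abs_nonneg _).trans (hb x))
  induction n with
  | zero => simp
  | succ n ih =>
    have hY : Measurable (fun x => F ((α : ℝ) ^ n * x)) := by fun_prop
    have i1 := hprod (hm n) (hm n) (hb n) (hb n)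
    have i2 := hprod (hm n) hY (hb n) (fun x => hB _)
    have i3 := hprod hY hY (fun x => hB _) (fun x => hB _)
    have e : ∫ x, (∑ i ∈ Finset.range (n + 1), F ((α : ℝ) ^ i * x)) ^ 2 ∂π
        = ∫ x, (∑ i ∈ Finset.range n, F ((α : ℝ) ^ i * x)) ^ 2 ∂π
          + 2 * ∫ x, (∑ i ∈ Finset.range n, F ((α : ℝ) ^ i * x)) * F ((α : ℝ) ^ n * x) ∂π
          + ∫ x, F ((α : ℝ) ^ n * x) * F ((α : ℝ) ^ n * x) ∂π := by
      have : ∀ x, (∑ i ∈ Finset.range (n + 1), F ((α : ℝ) ^ i * x)) ^ 2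
        = (∑ i ∈ Finset.range n, F ((α : ℝ) ^ i * x)) * (∑ i ∈ Finset.range n, F ((α : ℝ) ^ i * x))
          + 2 * ((∑ i ∈ Finset.range n, F ((α : ℝ) ^ i * x)) * F ((α : ℝ) ^ n * x))
          + F ((α : ℝ) ^ n * x) * F ((α : ℝ) ^ n * x) := by
        intro x; rw [Finset.sum_range_succ]; ring
      simp only [this]
      rw [integral_add, integral_add, integral_const_mul]
      · simp only [sq]
      · exact i1
      · exact i2.const_mul _
      · exact i1.add (i2.const_mul _)
      · exact i3
    have b3 : ∫ x, F ((α : ℝ) ^ n * x) * F ((α : ℝ) ^ n * x) ∂π ≤ B ^ 2 := by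
      refine (le_abs_self _).trans (H.absint fun x => ?_)
      rw [abs_mul, sq]; exact mul_le_mul (hB _) (hB _) (abs_nonneg _) hB0
    have b2 : ∫ x, (∑ i ∈ Finset.range n, F ((α : ℝ) ^ i * x)) * F ((α : ℝ) ^ n * x) ∂π ≤ c := by
      simp only [Finset.sum_mul]
      rw [integral_finsetSum]
      · calc _ ≤ ∑ i ∈ Finset.range n, c * (1 / 2) ^ (n - i) := by
              apply Finset.sum_le_sum
              intro i hi
              have := hcov i (n - i)
              rw [Nat.add_sub_cancel' (Finset.mem_range.1 hi).le] at this
              exact (le_abs_self _).trans this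
          _ ≤ c := by
              have : ∀ n : ℕ, ∑ i ∈ Finset.range n, c * (1 / 2) ^ (n - i) = c * (1 - (1 / 2) ^ n) := by
                intro n
                induction n with
                | zero => simp
                | succ n ih =>
                  rw [Finset.sum_range_succ]
                  have : ∑ i ∈ Finset.range n, c * (1 / 2) ^ (n + 1 - i)
                      = (1 / 2) * ∑ i ∈ Finset.range n, c * (1 / 2) ^ (n - i) := by
                    rw [Finset.mul_sum]
                    apply Finset.sum_congr rfl
                    intro i hi
                    rw [Nat.succ_sub (Finset.mem_range.1 hi).le, pow_succ]; ring
                  rw [this, ih]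
                  rw [Nat.add_sub_cancel_left]
                  ring
              rw [this]
              have : (0 : ℝ) ≤ (1 / 2) ^ n := by positivity
              nlinarith
      · intro i _
        exact hprod (by fun_prop) hY (fun x => hB _) (fun x => hB _)
    rw [e]; push_cast
    linarith

theorem lln0 (H : PHyp α β p π) {F : ℝ → ℝ} (hF : Measurable F) {B K : ℝ}
    (hB : ∀ x, |F x| ≤ B) (hK : 0 ≤ K) (hL : ∀ x y, |F x - F y| ≤ K * |x - y|)
    (hper : Function.Periodic F α) (h0 : ∫ x, F x ∂π = 0) :
    ∀ᵐ x ∂π, Tendsto (fun n : ℕ => (∑ i ∈ Finset.range n, F ((α : ℝ) ^ i * x)) / n) atTop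
      (nhds 0) := by
  have := H.prob
  have hB0 : 0 ≤ B := (abs_nonneg _).trans (hB 0)
  obtain ⟨C, hC, hv⟩ := H.var_bound hF hB hK hL hper h0
  set S : ℕ → ℝ → ℝ := fun n x => ∑ i ∈ Finset.range n, F ((α : ℝ) ^ i * x) with hS
  have hm : ∀ n : ℕ, Measurable (S n) := by
    intro n; simp only [hS]; fun_prop
  have hb : ∀ n : ℕ, ∀ x, |S n x| ≤ n * B := by
    intro n x
    refine (Finset.abs_sum_le_sum_abs _ _).trans ?_
    refine (Finset.sum_le_card_nsmul _ _ B (fun i _ => hB _)).trans ?_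
    simp
  set Z : ℕ → ℝ → ℝ := fun k x => (S (k ^ 2) x / (k ^ 2 : ℕ)) ^ 2 with hZ
  have hZm : ∀ k, Measurable (Z k) := by
    intro k
    have := hm (k ^ 2)
    simp only [hZ]; fun_prop
  have hZ0 : ∀ k x, 0 ≤ Z k x := fun k x => by positivity
  have hZi : ∀ k, Integrable (Z k) π := by
    intro k
    refine H.intble (B := B ^ 2) (hZm k) (fun x => ?_)
    rw [abs_of_nonneg (hZ0 k x)]
    apply sq_le_sq'
    all_goals
      have h1 := abs_le.1 (hb (k ^ 2) x)
      rcases Nat.eq_zero_or_pos (k ^ 2) with h | h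
      · rw [h]; simp [hB0]
      · have h2 : (0 : ℝ) < ((k ^ 2 : ℕ) : ℝ) := by exact_mod_cast h
        first
        | rw [div_le_iff₀ h2]; linarith [h1.2]
        | rw [le_div_iff₀ h2]; linarith [h1.1]
  have hZb : ∀ k, ∫ x, Z k x ∂π ≤ C * (1 / (k : ℝ) ^ 2) := by
    intro k
    have h1 := hv (k ^ 2)
    have : ∫ x, Z k x ∂π = (∫ x, (S (k ^ 2) x) ^ 2 ∂π) / ((k : ℝ) ^ 2) ^ 2 := by
      simp only [hZ, div_pow]
      rw [integral_div]
      push_cast; rfl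
    rw [this]
    rcases Nat.eq_zero_or_pos k with h | h
    · subst h; simp
    · have h2 : (0 : ℝ) < (k : ℝ) := by exact_mod_cast h
      rw [div_le_iff₀ (by positivity)]
      push_cast at h1
      calc _ ≤ _ := h1
        _ = _ := by field_simp
  have hsum : Summable (fun k => ∫ x, Z k x ∂π) := by
    refine Summable.of_nonneg_of_le (fun k => integral_nonneg (hZ0 k)) hZb ?_
    exact (Real.summable_one_div_nat_pow.2 (by norm_num)).mul_left C
  have hl : ∫⁻ x, ∑' k, ENNReal.ofReal (Z k x) ∂π ≠ ⊤ := by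
    rw [lintegral_tsum (fun k => (hZm k).ennreal_ofReal.aemeasurable)]
    have : ∀ k, ∫⁻ x, ENNReal.ofReal (Z k x) ∂π = ENNReal.ofReal (∫ x, Z k x ∂π) := fun k =>
      (ofReal_integral_eq_lintegral_ofReal (hZi k) (Eventually.of_forall (hZ0 k))).symm
    simp only [this]
    exact hsum.tsum_ofReal_ne_top
  have hae := ae_lt_top' (AEMeasurable.tsum fun k => (hZm k).ennreal_ofReal.aemeasurable) hl
  filter_upwards [hae] with x hx
  have t1 := ENNReal.tendsto_atTop_zero_of_tsum_ne_top hx.ne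
  have t2 : Tendsto (fun k => Z k x) atTop (nhds 0) := by
    have := (ENNReal.tendsto_toReal ENNReal.zero_ne_top).comp t1
    simp only [ENNReal.toReal_zero] at this
    refine this.congr fun k => ?_
    simp [ENNReal.toReal_ofReal (hZ0 k x)]
  have t3 : Tendsto (fun k : ℕ => |S (k ^ 2) x / (k ^ 2 : ℕ)|) atTop (nhds 0) := by
    have := (Real.continuous_sqrt.tendsto 0).comp t2
    rw [Real.sqrt_zero] at this
    refine this.congr fun k => ?_
    simp only [hZ, Function.comp]
    rw [Real.sqrt_sq_eq_abs]
  have t4 : Tendsto (fun k : ℕ => |S (k ^ 2) x / (k ^ 2 : ℕ)| + 2 * B * (1 / (k : ℝ))) atTop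
      (nhds 0) := by
    have := t3.add (tendsto_one_div_atTop_nhds_zero_nat.const_mul (2 * B))
    simpa using this
  have hsq : Tendsto Nat.sqrt atTop atTop := by
    refine tendsto_atTop.2 fun b => ?_
    filter_upwards [eventually_ge_atTop (b * b)] with n hn
    exact Nat.le_sqrt.2 hn
  refine squeeze_zero_norm' ?_ (t4.comp hsq)
  filter_upwards [eventually_ge_atTop 1] with n hn
  simp only [Function.comp, Real.norm_eq_abs]
  set k := Nat.sqrt n with hk
  have k1 : 1 ≤ k := Nat.le_sqrt.2 (by simpa using hn)
  have k2 : k ^ 2 ≤ n := by rw [sq]; exact Nat.sqrt_le n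
  have k3 : n ≤ k ^ 2 + 2 * k := by
    have := Nat.sqrt_le_add n
    rw [← hk] at this
    rw [sq]; linarith
  have hd : |S n x| ≤ |S (k ^ 2) x| + 2 * k * B := by
    have : S n x = S (k ^ 2) x + ∑ i ∈ Finset.Ico (k ^ 2) n, F ((α : ℝ) ^ i * x) := by
      simp only [hS]
      rw [Finset.sum_range_add_sum_Ico _ k2]
    rw [this]
    refine (abs_add_le _ _).trans ?_
    gcongr
    refine (Finset.abs_sum_le_sum_abs _ _).trans ?_
    refine (Finset.sum_le_card_nsmul _ _ B (fun i _ => hB _)).trans ?_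
    rw [Nat.card_Ico, nsmul_eq_mul]
    have : ((n - k ^ 2 : ℕ) : ℝ) ≤ 2 * k := by
      have : n - k ^ 2 ≤ 2 * k := by omega
      exact_mod_cast this
    gcongr
  have kp : (0 : ℝ) < k := by exact_mod_cast k1
  have hn' : ((k : ℝ)) ^ 2 ≤ n := by exact_mod_cast k2
  rw [abs_div, abs_div, Nat.abs_cast, Nat.abs_cast]
  calc |S n x| / n ≤ (|S (k ^ 2) x| + 2 * k * B) / (k : ℝ) ^ 2 := by
        gcongr
    _ = _ := by push_cast; field_simp

theorem lln (H : PHyp α β p π) {F : ℝ → ℝ} (hF : Measurable F) {B K : ℝ}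
    (hB : ∀ x, |F x| ≤ B) (hK : 0 ≤ K) (hL : ∀ x y, |F x - F y| ≤ K * |x - y|)
    (hper : Function.Periodic F α) :
    ∀ᵐ x ∂π, Tendsto (fun n : ℕ => (∑ i ∈ Finset.range n, F ((α : ℝ) ^ i * x)) / n) atTop
      (nhds (∫ x, F x ∂π)) := by
  have := H.prob
  set m := ∫ x, F x ∂π with hm
  have h := H.lln0 (F := fun x => F x - m) (by fun_prop) (B := B + |m|) (K := K)
    (fun x => (abs_sub _ _).trans (by linarith [hB x])) hK (fun x y => by simpa using hL x y)
    (fun x => by simp [hper x]) (by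
      rw [integral_sub (H.intble hF hB) (integrable_const _)]; simp [hm])
  filter_upwards [h] with x hx
  have := hx.add_const m
  rw [zero_add] at this
  refine this.congr' ?_
  filter_upwards [eventually_ge_atTop 1] with n hn
  have : (0 : ℝ) < n := by exact_mod_cast hn
  rw [Finset.sum_sub_distrib]
  rw [Finset.sum_const, Finset.card_range, nsmul_eq_mul, sub_div, mul_div_cancel_left₀ _ this.ne',
    sub_add_cancel]


theorem null_int (H : PHyp α β p π) {t : ℕ} (hβ : β = α ^ t) :
    π (range (fun z : ℤ => (z : ℝ))) = 0 := by
  have := H.prob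
  have hp0 := H.p0
  have hp1 := H.p1
  have ha := H.apos
  set Z : ℕ → Set ℝ := fun k => range (fun z : ℤ => (α : ℝ) ^ k * z) with hZ
  have hZm : ∀ k, MeasurableSet (Z k) := fun k => (countable_range _).measurableSet
  have hβ' : (β : ℝ) = (α : ℝ) ^ t := by rw [hβ]; push_cast; rfl
  have step : ∀ k, k ≤ t → π (Z k) = π (Z (k + 1)) := by
    intro k hk
    have e := H.inv (Z k) (hZm k)
    have e1 : (fun y => y + (β : ℝ)) ⁻¹' (Z k) = Z k := by
      have hs : (α : ℝ) ^ t = (α : ℝ) ^ k * ((α : ℝ) ^ (t - k)) := by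
        rw [← pow_add]; congr 1; omega
      ext y
      simp only [hZ, mem_preimage, mem_range]
      constructor
      · rintro ⟨z, hz⟩
        refine ⟨z - (α : ℤ) ^ (t - k), ?_⟩
        push_cast
        rw [mul_sub, hz, ← hs, hβ']; ring
      · rintro ⟨z, hz⟩
        refine ⟨z + (α : ℤ) ^ (t - k), ?_⟩
        push_cast
        rw [mul_add, hz, ← hs, hβ']
    have e2 : (fun y => y / (α : ℝ)) ⁻¹' (Z k) = Z (k + 1) := by
      ext y
      simp only [hZ, mem_preimage, mem_range]
      refine exists_congr fun z => ?_
      rw [eq_div_iff ha.ne', pow_succ]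
      constructor <;> (intro h; rw [← h]; ring)
    rw [e1, e2] at e
    have e' := congrArg ENNReal.toReal e
    rw [ENNReal.toReal_add (by finiteness) (by finiteness), ENNReal.toReal_mul, ENNReal.toReal_mul,
      ENNReal.toReal_ofReal hp0.le, ENNReal.toReal_ofReal (by linarith)] at e'
    rw [← ENNReal.toReal_eq_toReal_iff' (by finiteness) (by finiteness)]
    have h3 : (1 - p) * ((π (Z k)).toReal - (π (Z (k + 1))).toReal) = 0 := by linarith
    rcases mul_eq_zero.1 h3 with h | h <;> linarith
  have all : ∀ k, k ≤ t + 1 → π (Z 0) = π (Z k) := by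
    intro k
    induction k with
    | zero => intro _; rfl
    | succ k ih => intro h; rw [ih (by omega), step k (by omega)]
  have h0 := all (t + 1) le_rfl
  have sub : Z (t + 1) ⊆ Z 0 := by
    rintro x ⟨z, rfl⟩
    exact ⟨(α : ℤ) ^ (t + 1) * z, by simp⟩
  have hdiff : π (Z 0 \ Z (t + 1)) = 0 := by
    rw [measure_sdiff sub (hZm _).nullMeasurableSet (by finiteness), h0]; simp
  set W : Set ℝ := range (fun z : ℤ => (α : ℝ) ^ (t + 1) * z + β) with hW
  have hWm : MeasurableSet W := (countable_range _).measurableSet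
  have hWs : W ⊆ Z 0 \ Z (t + 1) := by
    rintro x ⟨z, rfl⟩
    refine ⟨⟨(α : ℤ) ^ (t + 1) * z + β, by simp⟩, ?_⟩
    rintro ⟨z', hz'⟩
    simp only [hβ', pow_succ] at hz'
    have h1 : (α : ℝ) ^ t * (α * z') = (α : ℝ) ^ t * (α * z + 1) := by linarith
    have h2 := mul_left_cancel₀ (pow_pos ha t).ne' h1
    have h3 : (α : ℤ) * z' = α * z + 1 := by exact_mod_cast h2
    have h4 : (α : ℤ) ∣ 1 := ⟨z' - z, by linarith⟩
    have := Int.le_of_dvd one_pos h4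
    have := H.ha
    omega
  have hW0 : π W = 0 := measure_mono_null hWs hdiff
  have e := H.inv W hWm
  have e1 : (fun y => y + (β : ℝ)) ⁻¹' W = Z (t + 1) := by
    ext y
    simp [hZ, hW]
  rw [e1, hW0] at e
  have e3 : ENNReal.ofReal p * π (Z (t + 1)) = 0 := (add_eq_zero.1 e.symm).1
  have e4 : π (Z (t + 1)) = 0 := by
    rcases mul_eq_zero.1 e3 with h | h
    · rw [ENNReal.ofReal_eq_zero] at h; linarith
    · exact h
  rw [← h0] at e4
  simpa [hZ] using e4

noncomputable def dz (x : ℝ) : ℝ := |x - round x|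

theorem dz_le (x : ℝ) (z : ℤ) : dz x ≤ |x - z| := round_le x z

theorem dz_lip (x y : ℝ) : |dz x - dz y| ≤ |x - y| := by
  have h1 := dz_le x (round y)
  have h2 := dz_le y (round x)
  have h3 := abs_sub_le x y (round y)
  have h4 := abs_sub_le y x (round x)
  rw [abs_sub_comm y x] at h4
  rw [abs_le]
  unfold dz at *
  constructor <;> linarith

theorem dz_nonneg (x : ℝ) : 0 ≤ dz x := abs_nonneg _
theorem dz_half (x : ℝ) : dz x ≤ 1 / 2 := abs_sub_round x

theorem dz_cont : Continuous dz := by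
  have : LipschitzWith 1 dz := LipschitzWith.of_dist_le_mul fun x y => by
    simpa [Real.dist_eq] using dz_lip x y
  exact this.continuous

theorem dz_per (n : ℕ) : Function.Periodic dz n := by
  intro x
  simp [dz]

theorem dz_zero {x : ℝ} (h : dz x = 0) : x ∈ range (fun z : ℤ => (z : ℝ)) :=
  ⟨round x, by unfold dz at h; rw [abs_eq_zero] at h; simp only; linarith⟩

theorem dz_pos_ae (H : PHyp α β p π) {t : ℕ} (hβ : β = α ^ t) : ∀ᵐ x ∂π, 0 < dz x := by
  have h := H.null_int hβ
  rw [measure_eq_zero_iff_ae_notMem] at h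
  filter_upwards [h] with x hx
  exact lt_of_le_of_ne (dz_nonneg x) fun hh => hx (dz_zero hh.symm)

theorem dz_int_pos (H : PHyp α β p π) {t : ℕ} (hβ : β = α ^ t) : 0 < ∫ x, dz x ∂π := by
  have := H.prob
  have hi : Integrable dz π := H.intble dz_cont.measurable (B := 1 / 2) (fun x => by
    rw [abs_of_nonneg (dz_nonneg x)]; exact dz_half x)
  rcases (integral_nonneg (μ := π) (f := dz) (fun x => dz_nonneg x)).lt_or_eq with h | h
  · exact h
  · rw [eq_comm, integral_eq_zero_iff_of_nonneg (fun x => dz_nonneg x) hi] at h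
    have : ∀ᵐ x ∂π, False := by
      filter_upwards [h, H.dz_pos_ae hβ] with x h1 h2
      simp at h1; linarith
    simp at this
    exact absurd this (NeZero.ne π)

theorem lln_dz (H : PHyp α β p π) :
    ∀ᵐ x ∂π, Tendsto (fun n : ℕ => (∑ i ∈ Finset.range n, dz ((α : ℝ) ^ i * x)) / n) atTop
      (nhds (∫ x, dz x ∂π)) :=
  H.lln dz_cont.measurable (B := 1 / 2) (K := 1) (fun x => by
    rw [abs_of_nonneg (dz_nonneg x)]; exact dz_half x) zero_le_one
    (fun x y => by simpa using dz_lip x y) (dz_per α)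

/-- infinitely many good scales -/
theorem freq_dz (H : PHyp α β p π) {t : ℕ} (hβ : β = α ^ t) :
    ∃ c : ℝ, 0 < c ∧ ∀ᵐ x ∂π, ∃ᶠ n : ℕ in atTop, c ≤ dz ((α : ℝ) ^ n * x) := by
  have hpos := H.dz_int_pos hβ
  refine ⟨(∫ x, dz x ∂π) / 2, by positivity, ?_⟩
  set m := ∫ x, dz x ∂π with hm
  filter_upwards [H.lln_dz] with x hx
  by_contra hcon
  rw [not_frequently] at hcon
  obtain ⟨N, hN⟩ := eventually_atTop.1 hcon
  have hub : ∀ n : ℕ, ∑ i ∈ Finset.range n, dz ((α : ℝ) ^ i * x) ≤ N + n * (m / 2) := by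
    intro n
    have : ∀ i ∈ Finset.range n, dz ((α : ℝ) ^ i * x) ≤ (if i < N then 1 else 0) + m / 2 := by
      intro i _
      split_ifs with h
      · linarith [dz_half ((α : ℝ) ^ i * x)]
      · have := hN i (by omega)
        push Not at this
        linarith
    refine (Finset.sum_le_sum this).trans ?_
    rw [Finset.sum_add_distrib, Finset.sum_const, Finset.card_range, nsmul_eq_mul]
    gcongr
    rw [Finset.sum_ite, Finset.sum_const_zero, add_zero, Finset.sum_const, nsmul_eq_mul, mul_one]
    norm_cast
    calc _ ≤ (Finset.range N).card := by
          apply Finset.card_le_card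
          intro i hi
          simp at hi ⊢
          exact hi.2
      _ = N := Finset.card_range N
  have hl : Tendsto (fun n : ℕ => (N : ℝ) * (1 / (n : ℝ)) + m / 2) atTop (nhds (N * 0 + m / 2)) :=
    (tendsto_one_div_atTop_nhds_zero_nat.const_mul _).add_const _
  have := le_of_tendsto_of_tendsto hx hl (by
    filter_upwards [eventually_ge_atTop 1] with n hn
    have : (0 : ℝ) < n := by exact_mod_cast hn
    rw [div_le_iff₀ this]
    refine (hub n).trans (le_of_eq ?_)
    field_simp)
  linarith

noncomputable def dg (α : ℕ) (x : ℝ) : ℝ := ((⌊x⌋ % (α : ℤ) : ℤ) : ℝ)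

theorem dg_meas : Measurable (dg α) := by
  unfold dg
  exact (measurable_from_top (f := fun z : ℤ => ((z % (α : ℤ) : ℤ) : ℝ))).comp Int.measurable_floor

theorem dg_per : Function.Periodic (dg α) α := by
  intro x
  simp [dg]

theorem dg_nonneg (H : PHyp α β p π) (x : ℝ) : 0 ≤ dg α x := by
  have : 0 ≤ ⌊x⌋ % (α : ℤ) := Int.emod_nonneg _ (by have := H.ha; omega)
  unfold dg
  exact_mod_cast this

theorem dg_le (H : PHyp α β p π) (x : ℝ) : dg α x ≤ α := by
  have : ⌊x⌋ % (α : ℤ) < α := Int.emod_lt_of_pos _ (by have := H.ha; omega)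
  unfold dg
  exact_mod_cast this.le

noncomputable def chi (K : ℕ) (x : ℝ) : ℝ := min 1 (K * dz x)

theorem chi_lip (K : ℕ) (x y : ℝ) : |chi K x - chi K y| ≤ K * |x - y| := by
  unfold chi
  refine (abs_min_sub_min_le_max _ _ _ _).trans ?_
  rw [sub_self, abs_zero, ← mul_sub, abs_mul, Nat.abs_cast]
  have := dz_lip x y
  apply max_le
  · positivity
  · gcongr

theorem chi_nonneg (K : ℕ) (x : ℝ) : 0 ≤ chi K x :=
  le_min zero_le_one (mul_nonneg (by positivity) (dz_nonneg x))

theorem chi_le (K : ℕ) (x : ℝ) : chi K x ≤ 1 := min_le_left _ _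

theorem chi_cont (K : ℕ) : Continuous (chi K) := by
  unfold chi
  exact continuous_const.min (continuous_const.mul dz_cont)

theorem chi_per (K n : ℕ) : Function.Periodic (chi K) n := by
  intro x
  simp [chi, dz_per n x]

theorem dgchi_lip (H : PHyp α β p π) (K : ℕ) (x y : ℝ) :
    |dg α x * chi K x - dg α y * chi K y| ≤ (α * K) * |x - y| := by
  wlog hxy : x ≤ y generalizing x y
  · rw [abs_sub_comm, abs_sub_comm x y]
    exact this y x (le_of_not_ge hxy)
  have ha := H.apos
  by_cases hf : ⌊x⌋ = ⌊y⌋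
  · have : dg α x = dg α y := by unfold dg; rw [hf]
    rw [this, ← mul_sub, abs_mul, abs_of_nonneg (H.dg_nonneg y), mul_assoc]
    exact mul_le_mul (H.dg_le y) (chi_lip K x y) (abs_nonneg _) ha.le
  · have hlt : ⌊x⌋ < ⌊y⌋ := lt_of_le_of_ne (Int.floor_mono hxy) hf
    have h1 : x < ⌊y⌋ := Int.floor_lt.1 hlt
    have h2 : (⌊y⌋ : ℝ) ≤ y := Int.floor_le y
    have d1 : dz x ≤ y - x := (dz_le x ⌊y⌋).trans (by rw [abs_of_nonpos (by linarith)]; linarith)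
    have d2 : dz y ≤ y - x := (dz_le y ⌊y⌋).trans (by rw [abs_of_nonneg (by linarith)]; linarith)
    rw [abs_of_nonpos (by linarith : x - y ≤ 0)]
    have b : ∀ z, dz z ≤ y - x → 0 ≤ dg α z * chi K z ∧
        dg α z * chi K z ≤ (α * K) * (y - x) := by
      intro z hz
      refine ⟨mul_nonneg (H.dg_nonneg z) (chi_nonneg K z), ?_⟩
      rw [mul_assoc]
      refine mul_le_mul (H.dg_le z) ?_ (chi_nonneg K z) ha.le
      refine (min_le_right _ _).trans ?_
      gcongr
    obtain ⟨a1, a2⟩ := b x d1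
    obtain ⟨b1, b2⟩ := b y d2
    rw [abs_le]
    constructor <;> linarith

theorem chi_int_lim (H : PHyp α β p π) {t : ℕ} (hβ : β = α ^ t) :
    Tendsto (fun K : ℕ => ∫ x, (1 - chi K x) ∂π) atTop (nhds 0) := by
  have := H.prob
  have : (0 : ℝ) = ∫ x, (0 : ℝ) ∂π := by simp
  rw [this]
  refine tendsto_integral_of_dominated_convergence (fun _ => 1) ?_ (integrable_const _) ?_ ?_
  · intro K
    exact (continuous_const.sub (chi_cont K)).aestronglyMeasurable
  · intro K
    refine Eventually.of_forall fun x => ?_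
    rw [Real.norm_eq_abs, abs_of_nonneg (by linarith [chi_le K x])]
    linarith [chi_nonneg K x]
  · filter_upwards [H.dz_pos_ae hβ] with x hx
    refine tendsto_const_nhds.congr' ?_
    obtain ⟨N, hN⟩ := exists_nat_gt (1 / dz x)
    filter_upwards [eventually_ge_atTop N] with K hK
    have : (1 : ℝ) ≤ K * dz x := by
      rw [div_lt_iff₀ hx] at hN
      have : (N : ℝ) ≤ K := by exact_mod_cast hK
      nlinarith
    simp [chi, min_eq_left this]

theorem lln_dg (H : PHyp α β p π) {t : ℕ} (hβ : β = α ^ t) :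
    ∀ᵐ x ∂π, Tendsto (fun n : ℕ => (∑ i ∈ Finset.range n, dg α ((α : ℝ) ^ i * x)) / n) atTop
      (nhds (∫ x, dg α x ∂π)) := by
  have := H.prob
  have ha := H.apos
  have fm : ∀ K : ℕ, Measurable (fun x => dg α x * chi K x) := fun K =>
    dg_meas.mul (chi_cont K).measurable
  have fb : ∀ K : ℕ, ∀ x, |dg α x * chi K x| ≤ α := fun K x => by
    rw [abs_of_nonneg (mul_nonneg (H.dg_nonneg x) (chi_nonneg K x))]
    have := mul_le_mul (H.dg_le x) (chi_le K x) (chi_nonneg K x) ha.le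
    linarith
  have cb : ∀ K : ℕ, ∀ x, |1 - chi K x| ≤ 1 := fun K x => by
    rw [abs_of_nonneg (by linarith [chi_le K x])]
    linarith [chi_nonneg K x]
  have cm : ∀ K : ℕ, Measurable (fun x => 1 - chi K x) := fun K =>
    measurable_const.sub (chi_cont K).measurable
  have A1 : ∀ᵐ x ∂π, ∀ K : ℕ, Tendsto (fun n : ℕ => (∑ i ∈ Finset.range n,
      (fun x => dg α x * chi K x) ((α : ℝ) ^ i * x)) / n) atTop
      (nhds (∫ x, dg α x * chi K x ∂π)) := by
    rw [ae_all_iff]; intro K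
    exact H.lln (fm K) (fb K) (K := α * K) (by positivity) (H.dgchi_lip K)
      (dg_per.mul (chi_per K α))
  have A2 : ∀ᵐ x ∂π, ∀ K : ℕ, Tendsto (fun n : ℕ => (∑ i ∈ Finset.range n,
      (fun x => 1 - chi K x) ((α : ℝ) ^ i * x)) / n) atTop
      (nhds (∫ x, (1 - chi K x) ∂π)) := by
    rw [ae_all_iff]; intro K
    exact H.lln (cm K) (cb K) (K := K) (by positivity)
      (fun x y => by
        have := chi_lip K y x
        rw [abs_sub_comm y x] at this
        simpa using this)
      (fun x => by simp [chi_per K α x])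
  filter_upwards [A1, A2] with x h1 h2
  rw [Metric.tendsto_atTop]
  intro ε hε
  have lim := H.chi_int_lim hβ
  rw [Metric.tendsto_atTop] at lim
  obtain ⟨K, hK⟩ := lim (ε / (4 * α)) (by positivity)
  have hK := hK K le_rfl
  rw [Real.dist_eq, sub_zero] at hK
  have hK := (le_abs_self _).trans_lt hK
  set e := ∫ x, (1 - chi K x) ∂π with he
  obtain ⟨N1, hN1⟩ := Metric.tendsto_atTop.1 (h1 K) (ε / 4) (by positivity)
  obtain ⟨N2, hN2⟩ := Metric.tendsto_atTop.1 (h2 K) (ε / (4 * α)) (by positivity)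
  refine ⟨max (max N1 N2) 1, fun n hn => ?_⟩
  have g1 := hN1 n (le_trans (le_trans (le_max_left _ _) (le_max_left _ _)) hn)
  have g2 := hN2 n (le_trans (le_trans (le_max_right _ _) (le_max_left _ _)) hn)
  have hn1 : (0 : ℝ) < n := by
    have : 1 ≤ n := le_trans (le_max_right _ _) hn
    exact_mod_cast this
  rw [Real.dist_eq] at g1 g2 ⊢
  have pt : ∀ y, dg α y * chi K y ≤ dg α y ∧ dg α y ≤ dg α y * chi K y + α * (1 - chi K y) := by
    intro y
    have := H.dg_nonneg y
    have := H.dg_le y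
    have := chi_le K y
    have := chi_nonneg K y
    constructor <;> nlinarith
  have iD : Integrable (dg α) π := H.intble dg_meas (B := α) (fun x => by
    rw [abs_of_nonneg (H.dg_nonneg x)]; exact H.dg_le x)
  have iF := H.intble (fm K) (fb K)
  have iC := H.intble (cm K) (cb K)
  have I1 : ∫ x, dg α x * chi K x ∂π ≤ ∫ x, dg α x ∂π :=
    integral_mono iF iD (fun y => (pt y).1)
  have I2 : ∫ x, dg α x ∂π ≤ ∫ x, dg α x * chi K x ∂π + α * e := by
    rw [he, ← integral_const_mul, ← integral_add iF (iC.const_mul _)]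
    exact integral_mono iD (iF.add (iC.const_mul _)) (fun y => (pt y).2)
  have S1 : (∑ i ∈ Finset.range n, dg α ((α : ℝ) ^ i * x) * chi K ((α : ℝ) ^ i * x)) / n
      ≤ (∑ i ∈ Finset.range n, dg α ((α : ℝ) ^ i * x)) / n := by
    gcongr with i _
    exact (pt _).1
  have S2 : (∑ i ∈ Finset.range n, dg α ((α : ℝ) ^ i * x)) / n ≤
      (∑ i ∈ Finset.range n, dg α ((α : ℝ) ^ i * x) * chi K ((α : ℝ) ^ i * x)) / n
      + α * ((∑ i ∈ Finset.range n, (1 - chi K ((α : ℝ) ^ i * x))) / n) := by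
    rw [← mul_div_assoc, ← add_div, Finset.mul_sum, ← Finset.sum_add_distrib]
    gcongr with i _
    exact (pt _).2
  rw [abs_lt] at g1 g2
  have c1 : α * e < ε / 4 := by
    calc α * e < α * (ε / (4 * α)) := by gcongr
      _ = ε / 4 := by field_simp
  have c2 : α * ((∑ i ∈ Finset.range n, (1 - chi K ((α : ℝ) ^ i * x))) / n) < ε / 2 := by
    have : (∑ i ∈ Finset.range n, (1 - chi K ((α : ℝ) ^ i * x))) / n < ε / (4 * α) + ε / (4 * α) := by
      linarith [g2.2]
    calc _ < α * (ε / (4 * α) + ε / (4 * α)) := by gcongr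
      _ = ε / 2 := by field_simp; ring
  rw [abs_lt]
  constructor <;> linarith [g1.1, g1.2]


theorem tail_abs {T : ℕ → ℝ} (hp0 : 0 < p) (hp1 : p ≤ 1 / 2) (hT : Antitone T)
    (hT0 : Tendsto T atTop (nhds 0))
    (hrec : ∀ m, T (m + 1) ≤ p * T m + (1 - p) * T (2 * (m + 1))) (m : ℕ) (hm : 1 ≤ m) :
    T (m + 1) ≤ 4 * p / 3 * T m := by
  have hpos : ∀ m, 0 ≤ T m := fun m => hT.le_of_tendsto hT0 m
  have hD1 : ∀ m, T (m + 1) - T (m + 2) ≤ T m - T (m + 1) := by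
    intro m
    have h1 := hrec m
    have h2 := hT (show m + 2 ≤ 2 * (m + 1) by omega)
    have h3 := hT (show m + 1 ≤ m + 2 by omega)
    nlinarith
  have hD : Antitone (fun m => T m - T (m + 1)) := antitone_nat_of_succ_le hD1
  have hsum : ∀ m j : ℕ, j ≤ m → (j : ℝ) * (T (2 * m + 1) - T (2 * m + 2))
      ≤ T (2 * m + 2 - j) - T (2 * m + 2) := by
    intro m j
    induction j with
    | zero => intro _; simp
    | succ j ih =>
      intro hj
      have h1 := ih (by omega)
      have h2 : T (2 * m + 1) - T (2 * m + 2)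
        ≤ T (2 * m + 2 - (j + 1)) - T (2 * m + 2 - (j + 1) + 1) :=
        hD (show 2 * m + 2 - (j + 1) ≤ 2 * m + 1 by omega)
      have h3 : 2 * m + 2 - (j + 1) + 1 = 2 * m + 2 - j := by omega
      rw [h3] at h2
      rw [Nat.cast_succ]
      generalize T (2 * m + 2 - (j + 1)) = u at *
      linarith
  have hsum' : ∀ m : ℕ, ((m + 1 : ℕ) : ℝ) * (T (2 * m + 1) - T (2 * m + 2))
      ≤ T (m + 1) - T (2 * m + 2) := by
    intro m
    have h1 := hsum m m le_rfl
    have h2 : T (2 * m + 1) - T (2 * m + 2) ≤ T (m + 1) - T (m + 2) :=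
      hD (show m + 1 ≤ 2 * m + 1 by omega)
    have h3 : 2 * m + 2 - m = m + 2 := by omega
    rw [h3] at h1
    push_cast
    linarith
  set E : ℕ → ℝ := fun m => (1 - p) * T (m + 1) - p * (T m - T (m + 1))
    - p * (T (m + 1) / ((m + 1 : ℕ) : ℝ)) with hE
  have hEs : ∀ m, E m ≤ E (2 * m + 1) := by
    intro m
    have hm0 : (0 : ℝ) < ((m + 1 : ℕ) : ℝ) := by positivity
    have h1 := hrec m
    have h2 : T (2 * m + 1) - T (2 * m + 2) ≤ (T (m + 1) - T (2 * m + 2)) / ((m + 1 : ℕ) : ℝ) := by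
      rw [le_div_iff₀ hm0]
      linarith [hsum' m]
    rw [sub_div] at h2
    have h3 : T (2 * m + 2) / ((2 * m + 1 + 1 : ℕ) : ℝ) = T (2 * m + 2) / ((m + 1 : ℕ) : ℝ) / 2 := by
      push_cast; field_simp; ring
    have h4 : 0 ≤ T (2 * m + 2) / ((m + 1 : ℕ) : ℝ) := div_nonneg (hpos _) hm0.le
    simp only [hE]
    rw [show 2 * m + 1 + 1 = 2 * m + 2 from rfl] at h3 ⊢
    rw [h3]
    rw [show 2 * (m + 1) = 2 * m + 2 by ring] at h1
    nlinarith
  have hET : ∀ m, E m ≤ T (m + 1) := by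
    intro m
    have h1 := hT (show m ≤ m + 1 by omega)
    have h2 : 0 ≤ T (m + 1) / ((m + 1 : ℕ) : ℝ) := div_nonneg (hpos _) (by positivity)
    have := hpos (m + 1)
    simp only [hE]
    nlinarith
  have hEK : ∀ K m : ℕ, E m ≤ T (m + K) := by
    intro K
    induction K using Nat.strong_induction_on with
    | _ K ih =>
      intro m
      rcases Nat.lt_or_ge 1 K with hK | hK
      · by_cases hKm : K ≤ m + 1
        · refine (hEs m).trans ((hET _).trans (hT (by omega)))
        · refine (hEs m).trans ((ih (K - (m + 1)) (by omega) (2 * m + 1)).trans (hT (by omega)))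
      · exact (hET m).trans (hT (by omega))
  have hE0 : ∀ m, E m ≤ 0 := by
    intro m
    have : Tendsto (fun K => T (m + K)) atTop (nhds 0) := by
      have := (tendsto_add_atTop_iff_nat m).2 hT0
      simpa [add_comm] using this
    exact ge_of_tendsto' this (fun K => hEK K m)
  have h1 := hE0 m
  simp only [hE] at h1
  have h2 : T (m + 1) / ((m + 1 : ℕ) : ℝ) ≤ T (m + 1) / 2 := by
    apply div_le_div_of_nonneg_left (hpos _) (by norm_num)
    have : (1 : ℝ) ≤ m := by exact_mod_cast hm
    push_cast; linarith
  have := hpos (m + 1)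
  nlinarith

theorem tail_abs2 {T : ℕ → ℝ} (hp0 : 0 < p) (hp1 : p ≤ 1 / 2) (hT : Antitone T)
    (hT0 : Tendsto T atTop (nhds 0)) (h1 : T 0 ≤ 1)
    (hrec : ∀ m, T (m + 1) ≤ p * T m + (1 - p) * T (2 * (m + 1))) (m : ℕ) :
    T (2 * m) ≤ 9 / (8 * p) * (8 * p / 9) ^ m := by
  have hpos : ∀ m, 0 ≤ T m := fun m => hT.le_of_tendsto hT0 m
  have key : ∀ m, T (2 * (m + 1)) ≤ (8 * p / 9) ^ m := by
    intro m
    induction m with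
    | zero => simpa using (hT (Nat.zero_le _)).trans h1
    | succ m ih =>
      have a := tail_abs hp0 hp1 hT hT0 hrec (2 * m + 3) (by omega)
      have b := tail_abs hp0 hp1 hT hT0 hrec (2 * m + 2) (by omega)
      rw [show 2 * (m + 1 + 1) = 2 * m + 3 + 1 by ring]
      rw [show 2 * (m + 1) = 2 * m + 2 by ring] at ih
      have c : T (2 * m + 3 + 1) ≤ 4 * p / 3 * (4 * p / 3 * T (2 * m + 2)) :=
        a.trans (by gcongr)
      have d : 4 * p / 3 * (4 * p / 3 * T (2 * m + 2)) ≤ 8 * p / 9 * T (2 * m + 2) := by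
        have := hpos (2 * m + 2)
        have e : 4 * p / 3 * (4 * p / 3) ≤ 8 * p / 9 := by nlinarith
        calc _ = (4 * p / 3 * (4 * p / 3)) * T (2 * m + 2) := by ring
          _ ≤ _ := by gcongr
      calc _ ≤ 8 * p / 9 * T (2 * m + 2) := c.trans d
        _ ≤ 8 * p / 9 * (8 * p / 9) ^ m := by gcongr
        _ = _ := by ring
  rcases m with _ | m
  · simp only [mul_zero, pow_zero, mul_one]
    refine h1.trans ?_
    rw [le_div_iff₀ (by positivity)]; linarith
  · refine (key m).trans (le_of_eq ?_)
    rw [pow_succ]; field_simp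

theorem invr (H : PHyp α β p π) {A : Set ℝ} (hA : MeasurableSet A) :
    π.real A = p * π.real ((fun y => y + (β : ℝ)) ⁻¹' A)
      + (1 - p) * π.real ((fun y => y / (α : ℝ)) ⁻¹' A) := by
  have := H.prob
  have hp0 := H.p0
  have hp1 := H.p1
  have e' := congrArg ENNReal.toReal (H.inv A hA)
  rw [ENNReal.toReal_add (by finiteness) (by finiteness), ENNReal.toReal_mul, ENNReal.toReal_mul,
      ENNReal.toReal_ofReal hp0.le, ENNReal.toReal_ofReal (by linarith)] at e'
  exact e'

theorem inv_Ico (H : PHyp α β p π) (a b : ℝ) :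
    π.real (Ico a b) = p * π.real (Ico (a - β) (b - β))
      + (1 - p) * π.real (Ico (a * α) (b * α)) := by
  rw [H.invr measurableSet_Ico]
  have e2 : (fun y => y / (α : ℝ)) ⁻¹' (Ico a b) = Ico (a * α) (b * α) := by
    ext y
    simp [le_div_iff₀ H.apos, div_lt_iff₀ H.apos]
  rw [e2]
  simp

theorem inv_Ici (H : PHyp α β p π) (a : ℝ) :
    π.real (Ici a) = p * π.real (Ici (a - β)) + (1 - p) * π.real (Ici (a * α)) := by
  rw [H.invr measurableSet_Ici]
  have e2 : (fun y => y / (α : ℝ)) ⁻¹' (Ici a) = Ici (a * α) := by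
    ext y
    simp [le_div_iff₀ H.apos]
  rw [e2]
  simp

theorem neg_null (H : PHyp α β p π) : π (Iio (0 : ℝ)) = 0 := by
  have := H.prob
  have h := prob_compl_eq_one_sub (μ := π) (measurableSet_Ici (a := (0 : ℝ)))
  rw [H.supp] at h
  simpa using h

theorem neg_null' (H : PHyp α β p π) {a b : ℝ} (hb : b ≤ 0) : π.real (Ico a b) = 0 := by
  have := H.prob
  have : π (Ico a b) = 0 := measure_mono_null (fun x hx => lt_of_lt_of_le hx.2 hb) H.neg_null
  simp [Measure.real, this]

noncomputable def tl (β : ℕ) (π : Measure ℝ) (m : ℕ) : ℝ := π.real (Ici ((β : ℝ) * m))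

theorem tl_anti (H : PHyp α β p π) : Antitone (tl β π) := by
  have := H.prob
  intro m n hmn
  refine measureReal_mono ?_ (measure_ne_top _ _)
  apply Ici_subset_Ici.2
  gcongr

theorem tl_lim (H : PHyp α β p π) : Tendsto (tl β π) atTop (nhds 0) := by
  have := H.prob
  have hb : (0 : ℝ) < β := by exact_mod_cast H.hb
  have h := tendsto_measure_iInter_atTop (μ := π) (s := fun m : ℕ => Ici ((β : ℝ) * m))
    (fun m => measurableSet_Ici.nullMeasurableSet)
    (fun m n hmn => Ici_subset_Ici.2 (by gcongr)) ⟨0, by finiteness⟩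
  have e : (⋂ m : ℕ, Ici ((β : ℝ) * m)) = ∅ := by
    ext x
    simp only [mem_iInter, mem_Ici, mem_empty_iff_false, iff_false, not_forall, not_le]
    obtain ⟨n, hn⟩ := exists_nat_gt (x / β)
    refine ⟨n, ?_⟩
    rw [div_lt_iff₀ hb] at hn
    linarith
  rw [e, measure_empty] at h
  have := (ENNReal.tendsto_toReal ENNReal.zero_ne_top).comp h
  simp only [ENNReal.toReal_zero] at this
  exact this

theorem tl_rec (H : PHyp α β p π) (m : ℕ) :
    tl β π (m + 1) ≤ p * tl β π m + (1 - p) * tl β π (2 * (m + 1)) := by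
  have := H.prob
  have hp1 := H.p1
  have ha := H.a2
  unfold tl
  rw [H.inv_Ici]
  have e : (β : ℝ) * ((m + 1 : ℕ) : ℝ) - β = β * m := by push_cast; ring
  rw [e]
  have : π.real (Ici ((β : ℝ) * ((m + 1 : ℕ) : ℝ) * α))
      ≤ π.real (Ici ((β : ℝ) * ((2 * (m + 1) : ℕ) : ℝ))) := by
    refine measureReal_mono ?_ (measure_ne_top _ _)
    apply Ici_subset_Ici.2
    push_cast
    have : (0 : ℝ) ≤ (β : ℝ) * (m + 1) := by positivity
    nlinarith
  have : 0 ≤ 1 - p := by linarith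
  gcongr

theorem tl_bound (H : PHyp α β p π) (m : ℕ) :
    tl β π (2 * m) ≤ 9 / (8 * p) * (8 * p / 9) ^ m := by
  have := H.prob
  exact tail_abs2 H.p0 H.p1 H.tl_anti H.tl_lim measureReal_le_one H.tl_rec m

noncomputable def wt (α β : ℕ) (π : Measure ℝ) (n k : ℕ) : ℝ :=
  π.real (Ico ((β : ℝ) * k / (α : ℝ) ^ n) ((β : ℝ) * (k + 1) / (α : ℝ) ^ n))

theorem wt_nonneg (n k : ℕ) : 0 ≤ wt α β π n k := measureReal_nonneg

theorem wt_zero_succ (H : PHyp α β p π) (k : ℕ) :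
    wt α β π 0 (k + 1) = p * wt α β π 0 k
      + (1 - p) * π.real (Ico ((β : ℝ) * (k + 1) * α) ((β : ℝ) * (k + 1 + 1) * α)) := by
  unfold wt
  rw [H.inv_Ico]
  congr 3
  · congr 1 <;> (push_cast; ring)
  · congr 1 <;> (push_cast; ring)

theorem wt_shift (H : PHyp α β p π) (n k : ℕ) :
    wt α β π (n + 1) (k + α ^ (n + 1)) = p * wt α β π (n + 1) k
      + (1 - p) * wt α β π n (k + α ^ (n + 1)) := by
  have ha := H.apos
  unfold wt
  rw [H.inv_Ico]
  congr 3
  · congr 1 <;> (push_cast; field_simp; ring)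
  · congr 1 <;> (push_cast; field_simp; try ring)

theorem wt_low (H : PHyp α β p π) (n k : ℕ) (hk : k < α ^ (n + 1)) :
    wt α β π (n + 1) k = (1 - p) * wt α β π n k := by
  have ha := H.apos
  unfold wt
  rw [H.inv_Ico, H.neg_null', mul_zero, zero_add]
  · congr 3 <;> (field_simp; try ring)
  · rw [sub_nonpos, div_le_iff₀ (by positivity)]
    have : ((k : ℝ) + 1) ≤ (α : ℝ) ^ (n + 1) := by exact_mod_cast hk
    gcongr

def sd (α : ℕ) : ℕ → ℕ → ℕ
  | 0, k => k
  | n + 1, k => sd α n (k / α) + k % α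

theorem sd_shift (ha : 0 < α) (n k l : ℕ) : sd α n (k + l * α ^ n) = sd α n k + l := by
  induction n generalizing k with
  | zero => simp [sd]
  | succ n ih =>
    have e : k + l * α ^ (n + 1) = k + α * (l * α ^ n) := by ring
    simp only [sd]
    rw [e, Nat.add_mul_div_left _ _ ha, Nat.add_mul_mod_self_left, ih]
    ring

theorem sd_low (n k : ℕ) (hk : k < α ^ (n + 1)) : sd α (n + 1) k = sd α n k := by
  induction n generalizing k with
  | zero =>
    rw [zero_add, pow_one] at hk
    simp [sd, Nat.div_eq_of_lt hk, Nat.mod_eq_of_lt hk]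
  | succ n ih =>
    have h : k / α < α ^ (n + 1) := by
      apply Nat.div_lt_of_lt_mul
      rwa [pow_succ, mul_comm] at hk
    have := ih (k / α) h
    rw [sd, this]
    rfl

theorem wt00 (H : PHyp α β p π) : 0 < wt α β π 0 0 := by
  have := H.prob
  have hp1 := H.p1
  have ha := H.apos
  have ha2 := H.a2
  have hb : (0 : ℝ) < β := by exact_mod_cast H.hb
  rcases (wt_nonneg (α := α) (β := β) (π := π) 0 0).lt_or_eq with h | h
  · exact h
  exfalso
  have all : ∀ n : ℕ, π.real (Ico 0 ((β : ℝ) * (α : ℝ) ^ n)) = 0 := by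
    intro n
    induction n with
    | zero =>
      unfold wt at h
      simp at h
      simpa using h.symm
    | succ n ih =>
      rw [H.inv_Ico] at ih
      rw [zero_mul] at ih
      have h1 : 0 ≤ π.real (Ico (0 - (β : ℝ)) ((β : ℝ) * (α : ℝ) ^ n - β)) := measureReal_nonneg
      have h2 : 0 ≤ π.real (Ico 0 ((β : ℝ) * (α : ℝ) ^ n * α)) := measureReal_nonneg
      have e : (β : ℝ) * (α : ℝ) ^ (n + 1) = (β : ℝ) * (α : ℝ) ^ n * α := by ring
      rw [e]
      have := H.p0
      nlinarith
  have h0 : π (⋃ n : ℕ, Ico 0 ((β : ℝ) * (α : ℝ) ^ n)) = 0 := by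
    rw [measure_iUnion_null_iff]
    intro n
    have := all n
    rwa [measureReal_eq_zero_iff] at this
  have hsub : Ici (0 : ℝ) ⊆ ⋃ n : ℕ, Ico 0 ((β : ℝ) * (α : ℝ) ^ n) := by
    intro x hx
    obtain ⟨n, hn⟩ := pow_unbounded_of_one_lt (x / β) (by linarith : (1 : ℝ) < α)
    rw [div_lt_iff₀ hb] at hn
    exact mem_iUnion.2 ⟨n, hx, by linarith⟩
  have := measure_mono_null hsub h0
  rw [H.supp] at this
  exact one_ne_zero this

theorem decomp (ha : 0 < α) (n k : ℕ) : ∃ m k', k' < α ^ n ∧ k = k' + m * α ^ n :=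
  ⟨k / α ^ n, k % α ^ n, Nat.mod_lt _ (by positivity), (Nat.mod_add_div' k _).symm⟩

theorem wt_lower (H : PHyp α β p π) (n k : ℕ) :
    wt α β π 0 0 * (1 - p) ^ n * p ^ (sd α n k) ≤ wt α β π n k := by
  have hp0 := H.p0
  have hp1 := H.p1
  have hq : 0 ≤ 1 - p := by linarith
  have ha : 0 < α := by have := H.ha; omega
  induction n generalizing k with
  | zero =>
    induction k with
    | zero => simp [sd]
    | succ k ih =>
      rw [H.wt_zero_succ]
      have : 0 ≤ π.real (Ico ((β : ℝ) * (k + 1) * α) ((β : ℝ) * (k + 1 + 1) * α)) :=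
        measureReal_nonneg
      simp only [sd, pow_zero, mul_one] at ih ⊢
      calc _ = p * (wt α β π 0 0 * p ^ k) := by ring
        _ ≤ p * wt α β π 0 k := by gcongr
        _ ≤ _ := by
          have := mul_nonneg hq this
          linarith
  | succ n ih =>
    obtain ⟨m, k', hk', rfl⟩ := decomp ha (n + 1) k
    rw [sd_shift ha, sd_low n k' hk']
    induction m with
    | zero =>
      simp only [zero_mul, add_zero]
      rw [H.wt_low n k' hk']
      calc _ = (1 - p) * (wt α β π 0 0 * (1 - p) ^ n * p ^ (sd α n k')) := by ring
        _ ≤ _ := by gcongr; exact ih k'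
    | succ m ihm =>
      rw [show k' + (m + 1) * α ^ (n + 1) = k' + m * α ^ (n + 1) + α ^ (n + 1) by ring, H.wt_shift]
      have := mul_nonneg hq (wt_nonneg (α := α) (β := β) (π := π) n
        (k' + m * α ^ (n + 1) + α ^ (n + 1)))
      calc _ = p * (wt α β π 0 0 * (1 - p) ^ (n + 1) * p ^ (sd α n k' + m)) := by ring
        _ ≤ p * wt α β π (n + 1) (k' + m * α ^ (n + 1)) := by gcongr
        _ ≤ _ := by linarith

theorem wt_base (H : PHyp α β p π) :
    ∃ C : ℝ, 0 < C ∧ ∀ k, wt α β π 0 k ≤ C * p ^ k := by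
  have := H.prob
  have hp0 := H.p0
  have hp1 := H.p1
  have ha := H.a2
  set c := 9 / (8 * p) with hc
  have hc0 : 0 < c := by positivity
  have key : ∀ k, wt α β π 0 k ≤ (1 + c * (9 - 9 * (8 / 9) ^ k)) * p ^ k := by
    intro k
    induction k with
    | zero =>
      simp only [pow_zero, mul_one, sub_self, mul_zero, add_zero]
      exact measureReal_le_one
    | succ k ih =>
      rw [H.wt_zero_succ]
      have h1 : π.real (Ico ((β : ℝ) * (k + 1) * α) ((β : ℝ) * (k + 1 + 1) * α))
          ≤ c * (8 * p / 9) ^ (k + 1) := by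
        refine le_trans ?_ (H.tl_bound (k + 1))
        refine measureReal_mono ?_ (measure_ne_top _ _)
        intro x hx
        refine le_trans ?_ hx.1
        push_cast
        have : (0 : ℝ) ≤ (β : ℝ) * (k + 1) := by positivity
        nlinarith
      have h0 : 0 ≤ π.real (Ico ((β : ℝ) * (k + 1) * α) ((β : ℝ) * (k + 1 + 1) * α)) :=
        measureReal_nonneg
      have h2 : (8 * p / 9) ^ (k + 1) = (8 / 9) ^ (k + 1) * p ^ (k + 1) := by
        rw [← mul_pow]; ring
      rw [h2] at h1
      have h3 : p * wt α β π 0 k ≤ p * ((1 + c * (9 - 9 * (8 / 9) ^ k)) * p ^ k) := by gcongr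
      have h4 : c * ((8 / 9) ^ (k + 1) * p ^ (k + 1)) ≤ c * ((8 / 9) ^ k * p ^ (k + 1)) := by
        gcongr ?_ * (?_ * ?_)
        rw [pow_succ]
        have : (0 : ℝ) < (8 / 9) ^ k := by positivity
        linarith
      have e : (1 + c * (9 - 9 * (8 / 9) ^ (k + 1))) * p ^ (k + 1)
        = p * ((1 + c * (9 - 9 * (8 / 9) ^ k)) * p ^ k) + c * ((8 / 9) ^ k * p ^ (k + 1)) := by ring
      rw [e]
      nlinarith
  refine ⟨1 + c * 9, by positivity, fun k => (key k).trans ?_⟩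
  have : (0 : ℝ) < (8 / 9) ^ k := by positivity
  gcongr
  linarith

theorem r_lt (H : PHyp α β p π) : p ^ (α - 1) < 1 :=
  pow_lt_one₀ H.p0.le (by linarith [H.p1]) (by have := H.ha; omega)

theorem wt_upper (H : PHyp α β p π) :
    ∃ C : ℝ, 0 < C ∧ ∀ n k, wt α β π n k ≤ C * ((1 - p) / (1 - p ^ (α - 1))) ^ n * p ^ (sd α n k) := by
  have hp0 := H.p0
  have hp1 := H.p1
  have ha : 0 < α := by have := H.ha; omega
  have hr := H.r_lt
  have hr0 : 0 < p ^ (α - 1) := by positivity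
  set r := p ^ (α - 1) with hrr
  obtain ⟨C, hC, hb⟩ := H.wt_base
  refine ⟨C, hC, fun n => ?_⟩
  have h1r : 0 < 1 - r := by linarith
  have h1p : 0 < 1 - p := by linarith
  induction n with
  | zero => intro k; simpa [sd] using hb k
  | succ n ih =>
    intro k
    obtain ⟨m, k', hk', rfl⟩ := decomp ha (n + 1) k
    rw [sd_shift ha, sd_low n k' hk']
    set A := C * ((1 - p) / (1 - r)) ^ n * p ^ (sd α n k') with hA
    have hA0 : 0 < A := by positivity
    have key : ∀ m : ℕ, wt α β π (n + 1) (k' + m * α ^ (n + 1))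
        ≤ A * (1 - p) * p ^ m * ((1 - r ^ (m + 1)) / (1 - r)) := by
      intro m
      induction m with
      | zero =>
        simp only [zero_mul, add_zero, pow_zero, mul_one, zero_add, pow_one]
        rw [H.wt_low n k' hk', div_self h1r.ne', mul_one, mul_comm]
        gcongr
        exact ih k'
      | succ m ihm =>
        have h1 := ih (k' + (m + 1) * α ^ (n + 1))
        rw [show k' + (m + 1) * α ^ (n + 1) = k' + (α * (m + 1)) * α ^ n by ring, sd_shift ha,
          pow_add, ← mul_assoc, ← hA] at h1
        have e : p ^ (α * (m + 1)) = p ^ (m + 1) * r ^ (m + 1) := by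
          rw [hrr, ← pow_mul, ← pow_add]
          congr 1
          obtain ⟨a, rfl⟩ : ∃ a, α = a + 1 := ⟨α - 1, by omega⟩
          rw [Nat.add_sub_cancel]; ring
        rw [show k' + (α * (m + 1)) * α ^ n = k' + m * α ^ (n + 1) + α ^ (n + 1) by ring] at h1
        rw [show k' + (m + 1) * α ^ (n + 1) = k' + m * α ^ (n + 1) + α ^ (n + 1) by ring,
          H.wt_shift]
        calc _ ≤ p * (A * (1 - p) * p ^ m * ((1 - r ^ (m + 1)) / (1 - r)))
              + (1 - p) * (A * p ^ (α * (m + 1))) := by gcongr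
          _ = _ := by rw [e]; field_simp; ring
    calc _ ≤ _ := key m
      _ ≤ A * (1 - p) * p ^ m * (1 / (1 - r)) := by
        have : 0 < r ^ (m + 1) := by positivity
        gcongr
        linarith
      _ = _ := by rw [hA]; ring


theorem dg_nat {x : ℝ} (hx : 0 ≤ x) : dg α x = ((⌊x⌋₊ % α : ℕ) : ℝ) := by
  unfold dg
  rw [← Int.natCast_floor_eq_floor hx]
  norm_cast

theorem ae_nonneg (H : PHyp α β p π) : ∀ᵐ x ∂π, 0 ≤ x := by
  rw [ae_iff]
  have : {a : ℝ | ¬ 0 ≤ a} = Iio 0 := by ext; simp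
  rw [this]; exact H.neg_null

theorem xi_eq (H : PHyp α β p π) (i : ℕ) (hi : i < α) :
    xi α π i = π.real {x | dg α x = i} := by
  have ha : 0 < α := by omega
  unfold xi Measure.real
  congr 1
  rw [← measure_iUnion]
  · apply measure_congr
    filter_upwards [H.ae_nonneg] with x hx
    have key : (∃ m : ℕ, (m : ℝ) * α + i ≤ x ∧ x < (m : ℝ) * α + i + 1) ↔ dg α x = i := by
      rw [dg_nat hx]
      constructor
      · rintro ⟨m, h1, h2⟩
        have : ⌊x⌋₊ = m * α + i := by
          rw [Nat.floor_eq_iff hx]; push_cast; exact ⟨h1, h2⟩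
        rw [this, Nat.mul_add_mod', Nat.mod_eq_of_lt hi]
      · intro h
        have h : ⌊x⌋₊ % α = i := by exact_mod_cast h
        have h3 : ⌊x⌋₊ = ⌊x⌋₊ / α * α + i := by
          have := Nat.div_add_mod' ⌊x⌋₊ α
          omega
        have h4 := (Nat.floor_eq_iff hx).1 h3
        push_cast at h4
        exact ⟨⌊x⌋₊ / α, by push_cast; exact h4.1, by push_cast; exact h4.2⟩
    have : (x ∈ ⋃ m : ℕ, Ico ((m : ℝ) * α + i) ((m : ℝ) * α + i + 1)) = (x ∈ {x | dg α x = i}) := by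
      simp only [mem_iUnion, mem_Ico, mem_ofPred_eq, eq_iff_iff]
      exact key
    exact this
  · intro m n hmn
    refine Set.disjoint_left.2 fun x hx hy => hmn ?_
    have hx0 : 0 ≤ x := le_trans (by positivity) hx.1
    have e1 : ⌊x⌋₊ = m * α + i := by
      rw [Nat.floor_eq_iff hx0]; push_cast; exact hx
    have e2 : ⌊x⌋₊ = n * α + i := by
      rw [Nat.floor_eq_iff hx0]; push_cast; exact hy
    have : m * α = n * α := by omega
    exact Nat.eq_of_mul_eq_mul_right ha this
  · intro m; exact measurableSet_Ico

theorem sum_xi (H : PHyp α β p π) :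
    ∑ i ∈ Finset.range α, (i : ℝ) * xi α π i = ∫ x, dg α x ∂π := by
  have := H.prob
  have ha : 0 < α := by have := H.ha; omega
  have hm : ∀ i : ℕ, MeasurableSet {x | dg α x = i} := fun i =>
    measurableSet_eq_fun dg_meas measurable_const
  have e : ∀ᵐ x ∂π, dg α x = ∑ i ∈ Finset.range α,
      (i : ℝ) * ({x | dg α x = i}.indicator (fun _ => (1 : ℝ)) x) := by
    filter_upwards [H.ae_nonneg] with x hx
    have hlt := Nat.mod_lt ⌊x⌋₊ ha
    rw [Finset.sum_eq_single_of_mem (⌊x⌋₊ % α) (Finset.mem_range.2 hlt)]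
    · rw [indicator_of_mem (by exact dg_nat hx), mul_one, dg_nat hx]
    · intro b _ hb
      rw [indicator_of_notMem, mul_zero]
      intro h
      rw [mem_ofPred_eq, dg_nat hx] at h
      exact hb (by exact_mod_cast h.symm)
  rw [integral_congr_ae e, integral_finsetSum]
  · refine Finset.sum_congr rfl fun i hi => ?_
    rw [integral_const_mul, integral_indicator_const _ (hm i), H.xi_eq i (Finset.mem_range.1 hi)]
    simp
  · intro i _
    exact ((integrable_const _).indicator (hm i)).const_mul _

noncomputable def kk (α : ℕ) (x : ℝ) (N : ℕ) : ℕ := ⌊(α : ℝ) ^ N * x⌋₊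

theorem kk_div (ha : 0 < α) (x : ℝ) (N : ℕ) : kk α x (N + 1) / α = kk α x N := by
  unfold kk
  rw [← Nat.floor_div_natCast]
  congr 1
  have : (α : ℝ) ≠ 0 := by positivity
  field_simp
  try ring

theorem sd_kk (ha : 0 < α) {x : ℝ} (hx : 0 ≤ x) (t N : ℕ) :
    (sd α (t + N) (kk α x N) : ℝ) + dg α x = sd α t (kk α x 0)
      + ∑ j ∈ Finset.range N, dg α ((α : ℝ) ^ j * x) + dg α ((α : ℝ) ^ N * x) := by
  induction N with
  | zero => simp
  | succ N ih =>
    rw [Finset.sum_range_succ]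
    have e : sd α (t + (N + 1)) (kk α x (N + 1))
        = sd α (t + N) (kk α x N) + kk α x (N + 1) % α := by
      rw [← add_assoc, sd, kk_div ha]
    rw [e]
    have h2 : dg α ((α : ℝ) ^ (N + 1) * x) = ((kk α x (N + 1) % α : ℕ) : ℝ) :=
      dg_nat (by positivity)
    rw [h2]
    push_cast
    linarith

theorem sd_lim (H : PHyp α β p π) {t : ℕ} (hβ : β = α ^ t) :
    ∀ᵐ x ∂π, Tendsto (fun N : ℕ => (sd α (t + N) (kk α x N) : ℝ) / N) atTop
      (nhds (∫ x, dg α x ∂π)) := by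
  have ha : 0 < α := by have := H.ha; omega
  filter_upwards [H.lln_dg hβ, H.ae_nonneg] with x hx hx0
  have h1 : Tendsto (fun N : ℕ => (dg α ((α : ℝ) ^ N * x)) / (N : ℝ)) atTop (nhds 0) := by
    refine squeeze_zero (g := fun N : ℕ => (α : ℝ) / N) ?_ ?_
      (tendsto_const_div_atTop_nhds_zero_nat _)
    · intro N; exact div_nonneg (H.dg_nonneg _) (by positivity)
    · intro N
      have := H.dg_le ((α : ℝ) ^ N * x)
      gcongr
  have h2 := tendsto_const_div_atTop_nhds_zero_nat ((sd α t (kk α x 0) : ℝ) - dg α x)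
  have h3 := (hx.add h1).add h2
  rw [add_zero, add_zero] at h3
  refine h3.congr fun N => ?_
  have := sd_kk ha hx0 t N
  rw [← add_div, ← add_div]
  congr 1
  linarith

noncomputable def JJ (α : ℕ) (x : ℝ) (N : ℕ) : Set ℝ :=
  Ico ((kk α x N : ℝ) / (α : ℝ) ^ N) (((kk α x N : ℝ) + 1) / (α : ℝ) ^ N)

theorem JJ_wt (H : PHyp α β p π) {t : ℕ} (hβ : β = α ^ t) (x : ℝ) (N : ℕ) :
    π.real (JJ α x N) = wt α β π (t + N) (kk α x N) := by
  have ha := H.apos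
  unfold JJ wt
  have : (β : ℝ) = (α : ℝ) ^ t := by rw [hβ]; push_cast; rfl
  rw [this, pow_add, mul_div_mul_left _ _ (by positivity), mul_div_mul_left _ _ (by positivity)]

theorem JJ_sub (H : PHyp α β p π) {x : ℝ} (hx : 0 ≤ x) {N : ℕ} {r : ℝ}
    (hr : 1 / (α : ℝ) ^ N ≤ r) : JJ α x N ⊆ Metric.ball x r := by
  have ha := H.apos
  have hN : 0 < (α : ℝ) ^ N := by positivity
  intro y hy
  have h1 : (kk α x N : ℝ) ≤ (α : ℝ) ^ N * x := Nat.floor_le (by positivity)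
  have h2 : (α : ℝ) ^ N * x < kk α x N + 1 := Nat.lt_floor_add_one _
  have h3 := hy.1
  have h4 := hy.2
  rw [div_le_iff₀ hN] at h3 hr
  rw [lt_div_iff₀ hN] at h4
  rw [Metric.mem_ball, Real.dist_eq, abs_sub_lt_iff]
  constructor <;> nlinarith

theorem sub_JJ (H : PHyp α β p π) {x : ℝ} (hx : 0 ≤ x) {N : ℕ} {c : ℝ}
    (hc : c ≤ dz ((α : ℝ) ^ N * x)) : Metric.ball x (c / (α : ℝ) ^ N) ⊆ JJ α x N := by
  have ha := H.apos
  have hN : 0 < (α : ℝ) ^ N := by positivity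
  intro y hy
  have h1 : (kk α x N : ℝ) ≤ (α : ℝ) ^ N * x := Nat.floor_le (by positivity)
  have h2 : (α : ℝ) ^ N * x < kk α x N + 1 := Nat.lt_floor_add_one _
  have h3 := hc.trans (dz_le ((α : ℝ) ^ N * x) (kk α x N))
  have h4 := hc.trans (dz_le ((α : ℝ) ^ N * x) (kk α x N + 1))
  push_cast at h3 h4
  rw [abs_of_nonneg (by linarith)] at h3
  rw [abs_of_nonpos (by linarith)] at h4
  rw [Metric.mem_ball, Real.dist_eq, lt_div_iff₀ hN, ← abs_of_pos hN, ← abs_mul,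
    abs_lt] at hy
  refine ⟨?_, ?_⟩
  · rw [div_le_iff₀ hN]; linarith
  · rw [lt_div_iff₀ hN]; linarith

theorem JJ_lower (H : PHyp α β p π) {t : ℕ} (hβ : β = α ^ t) (x : ℝ) (N : ℕ) :
    0 < π.real (JJ α x N) ∧
    Real.log (wt α β π 0 0) + (t + N) * Real.log (1 - p)
      + (sd α (t + N) (kk α x N) : ℝ) * Real.log p ≤ Real.log (π.real (JJ α x N)) := by
  have hp0 := H.p0
  have hp1 := H.p1
  have hq : 0 < 1 - p := by linarith
  have hw := H.wt00
  have h := H.wt_lower (t + N) (kk α x N)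
  rw [← H.JJ_wt hβ] at h
  have h0 : 0 < wt α β π 0 0 * (1 - p) ^ (t + N) * p ^ (sd α (t + N) (kk α x N)) := by positivity
  refine ⟨h0.trans_le h, ?_⟩
  refine le_trans (le_of_eq ?_) (Real.log_le_log h0 h)
  rw [Real.log_mul (by positivity) (by positivity), Real.log_mul (by positivity) (by positivity),
    Real.log_pow, Real.log_pow]
  push_cast; rfl

theorem JJ_upper (H : PHyp α β p π) {t : ℕ} (hβ : β = α ^ t) :
    ∃ C : ℝ, ∀ (x : ℝ) (N : ℕ), Real.log (π.real (JJ α x N)) ≤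
      C + (t + N) * (Real.log (1 - p) - Real.log (1 - p ^ (α - 1)))
      + (sd α (t + N) (kk α x N) : ℝ) * Real.log p := by
  have hp0 := H.p0
  have hp1 := H.p1
  have hq : 0 < 1 - p := by linarith
  have hr := H.r_lt
  have hr : 0 < 1 - p ^ (α - 1) := by linarith
  obtain ⟨C, hC, h⟩ := H.wt_upper
  refine ⟨Real.log C, fun x N => ?_⟩
  have h := h (t + N) (kk α x N)
  rw [← H.JJ_wt hβ] at h
  refine (Real.log_le_log (H.JJ_lower hβ x N).1 h).trans (le_of_eq ?_)
  rw [Real.log_mul (by positivity) (by positivity), Real.log_mul (by positivity) (by positivity),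
    Real.log_pow, Real.log_pow, Real.log_div hq.ne' hr.ne']
  push_cast; rfl

theorem ball_pos (H : PHyp α β p π) {t : ℕ} (hβ : β = α ^ t) {x : ℝ} (hx : 0 ≤ x) {r : ℝ}
    (hr : 0 < r) : 0 < π.real (Metric.ball x r) := by
  have := H.prob
  have ha := H.apos
  have ha2 := H.a2
  obtain ⟨N, hN⟩ := pow_unbounded_of_one_lt (1 / r) (by linarith : (1 : ℝ) < α)
  refine (H.JJ_lower hβ x N).1.trans_le (measureReal_mono (H.JJ_sub hx ?_) (measure_ne_top _ _))
  rw [div_le_iff₀ (by positivity)]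
  rw [div_lt_iff₀ hr] at hN
  linarith

theorem lin_lim {s : ℕ → ℝ} {m : ℝ} (hs : Tendsto (fun N : ℕ => s N / N) atTop (nhds m))
    (A t B q : ℝ) : Tendsto (fun N : ℕ => (A + (t + N) * B + s N * q) / N) atTop
      (nhds (B + m * q)) := by
  have h1 := tendsto_const_div_atTop_nhds_zero_nat (A + t * B)
  have h2 := (h1.add (tendsto_const_nhds (x := B))).add (hs.mul_const q)
  rw [zero_add] at h2
  refine h2.congr' ?_
  filter_upwards [eventually_gt_atTop 0] with N hN
  have : (N : ℝ) ≠ 0 := by positivity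
  field_simp
  ring

theorem ratio_nonneg (H : PHyp α β p π) (x : ℝ) :
    ∀ᶠ r in nhdsWithin (0 : ℝ) (Ioi 0),
      0 ≤ Real.log (π (Metric.ball x r)).toReal / Real.log r := by
  have := H.prob
  filter_upwards [Ioo_mem_nhdsGT (zero_lt_one (α := ℝ))] with r hr
  exact div_nonneg_of_nonpos (Real.log_nonpos measureReal_nonneg measureReal_le_one)
    (Real.log_nonpos hr.1.le hr.2.le)

theorem upper_ev (H : PHyp α β p π) {t : ℕ} (hβ : β = α ^ t) {x m : ℝ} (hx : 0 ≤ x)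
    (hs : Tendsto (fun N : ℕ => (sd α (t + N) (kk α x N) : ℝ) / N) atTop (nhds m))
    {d : ℝ} (hd : dBar α p m < d) :
    ∀ᶠ r in nhdsWithin (0 : ℝ) (Ioi 0),
      Real.log (π (Metric.ball x r)).toReal / Real.log r ≤ d := by
  have := H.prob
  have ha := H.apos
  have ha2 := H.a2
  have hL : 0 < Real.log α := Real.log_pos (by linarith)
  set LL : ℕ → ℝ := fun N => Real.log (wt α β π 0 0) + ((t : ℝ) + N) * Real.log (1 - p)
      + (sd α (t + N) (kk α x N) : ℝ) * Real.log p with hLL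
  have h1 : Tendsto (fun N => LL N / N) atTop (nhds (Real.log (1 - p) + m * Real.log p)) :=
    lin_lim hs _ _ _ _
  have h2 : Tendsto (fun M : ℕ => (((M + 1 : ℕ) : ℝ) / M)) atTop (nhds 1) := by
    have := (tendsto_const_nhds (x := (1 : ℝ))).add (tendsto_const_div_atTop_nhds_zero_nat (1 : ℝ))
    rw [add_zero] at this
    refine this.congr' ?_
    filter_upwards [eventually_gt_atTop 0] with N hN
    have : (N : ℝ) ≠ 0 := by positivity
    push_cast
    field_simp
  have h3 : Tendsto (fun M : ℕ => -(LL (M + 1) / ((M : ℝ) * Real.log α))) atTop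
      (nhds (dBar α p m)) := by
    have := (((h1.comp (tendsto_add_atTop_nat 1)).mul h2).div_const (-Real.log α))
    rw [mul_one] at this
    have e : dBar α p m = (Real.log (1 - p) + m * Real.log p) / -Real.log α := by
      unfold dBar; rw [Real.log_inv]
    rw [e]
    refine this.congr' ?_
    filter_upwards [eventually_gt_atTop 0] with N hN
    have : (N : ℝ) ≠ 0 := by positivity
    have : ((N + 1 : ℕ) : ℝ) ≠ 0 := by positivity
    simp only [Function.comp]
    field_simp
  have h4 : Tendsto (fun r : ℝ => ⌊-Real.log r / Real.log α⌋₊) (nhdsWithin (0 : ℝ) (Ioi 0))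
      atTop := by
    refine tendsto_nat_floor_atTop.comp ?_
    exact (tendsto_neg_atBot_atTop.comp Real.tendsto_log_nhdsGT_zero).atTop_div_const hL
  filter_upwards [h4.eventually (h3.eventually_lt_const hd), h4.eventually (eventually_gt_atTop 0),
    Ioo_mem_nhdsGT (zero_lt_one (α := ℝ))] with r hr1 hM hr
  set M := ⌊-Real.log r / Real.log α⌋₊ with hMd
  refine le_trans ?_ hr1.le
  have hlr : Real.log r < 0 := Real.log_neg hr.1 hr.2
  have a1 : (M : ℝ) ≤ -Real.log r / Real.log α :=
    Nat.floor_le (div_nonneg (by linarith) hL.le)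
  have a2 : -Real.log r / Real.log α < M + 1 := Nat.lt_floor_add_one _
  rw [le_div_iff₀ hL] at a1
  rw [div_lt_iff₀ hL] at a2
  have a3 : 1 / (α : ℝ) ^ (M + 1) ≤ r := by
    rw [← Real.log_le_log_iff (by positivity) hr.1, one_div, Real.log_inv, Real.log_pow]
    push_cast; linarith
  obtain ⟨b0, b1⟩ := H.JJ_lower hβ x (M + 1)
  have b2 : Real.log (π.real (JJ α x (M + 1))) ≤ Real.log (π.real (Metric.ball x r)) :=
    Real.log_le_log b0 (measureReal_mono (H.JJ_sub hx a3) (measure_ne_top _ _))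
  have b3 : Real.log (π.real (Metric.ball x r)) ≤ 0 :=
    Real.log_nonpos measureReal_nonneg measureReal_le_one
  have b4 : LL (M + 1) ≤ Real.log (π.real (Metric.ball x r)) := b1.trans b2
  change Real.log (π.real (Metric.ball x r)) / Real.log r ≤ _
  have hM' : (0 : ℝ) < M := by exact_mod_cast hM
  rw [← neg_div_neg_eq, ← neg_div]
  refine div_le_div₀ (by linarith) (by linarith) (by positivity) a1

theorem upper_dim (H : PHyp α β p π) {t : ℕ} (hβ : β = α ^ t) {x m : ℝ} (hx : 0 ≤ x)
    (hs : Tendsto (fun N : ℕ => (sd α (t + N) (kk α x N) : ℝ) / N) atTop (nhds m)) :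
    upperLocalDim π x ≤ dBar α p m := by
  refine le_of_forall_gt_imp_ge_of_dense fun d hd => ?_
  refine limsup_le_of_le ?_ (H.upper_ev hβ hx hs hd)
  exact (isBoundedUnder_of_eventually_ge (H.ratio_nonneg x)).isCoboundedUnder_le

theorem lower_dim (H : PHyp α β p π) {t : ℕ} (hβ : β = α ^ t) {x m c : ℝ} (hx : 0 ≤ x)
    (hs : Tendsto (fun N : ℕ => (sd α (t + N) (kk α x N) : ℝ) / N) atTop (nhds m))
    (hc0 : 0 < c) (hc : ∃ᶠ n in atTop, c ≤ dz ((α : ℝ) ^ n * x)) :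
    dLow α p m ≤ upperLocalDim π x := by
  have := H.prob
  have ha := H.apos
  have ha2 := H.a2
  have hL : 0 < Real.log α := Real.log_pos (by linarith)
  refine le_of_forall_lt_imp_le_of_dense fun d hd => ?_
  have hbd : IsBoundedUnder (· ≤ ·) (nhdsWithin (0 : ℝ) (Ioi 0))
      (fun r : ℝ => Real.log (π (Metric.ball x r)).toReal / Real.log r) :=
    isBoundedUnder_of_eventually_le (H.upper_ev hβ hx hs (lt_add_one _))
  refine le_limsup_of_frequently_le ?_ hbd
  obtain ⟨C, hC⟩ := H.JJ_upper hβ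
  set U : ℕ → ℝ := fun N => C + ((t : ℝ) + N) * (Real.log (1 - p) - Real.log (1 - p ^ (α - 1)))
      + (sd α (t + N) (kk α x N) : ℝ) * Real.log p with hU
  have h1 : Tendsto (fun N => U N / N) atTop
    (nhds (Real.log (1 - p) - Real.log (1 - p ^ (α - 1)) + m * Real.log p)) :=
    lin_lim hs _ _ _ _
  have hlr : ∀ N : ℕ, Real.log (c / (α : ℝ) ^ N) = Real.log c - N * Real.log α := by
    intro N
    rw [Real.log_div (by positivity) (by positivity), Real.log_pow]
  have h2 : Tendsto (fun N : ℕ => Real.log (c / (α : ℝ) ^ N) / N) atTop (nhds (-Real.log α)) := by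
    have := (tendsto_const_div_atTop_nhds_zero_nat (Real.log c)).sub
      (tendsto_const_nhds (x := Real.log α))
    rw [zero_sub] at this
    refine this.congr' ?_
    filter_upwards [eventually_gt_atTop 0] with N hN
    have : (N : ℝ) ≠ 0 := by positivity
    rw [hlr]
    field_simp
  have h3 : Tendsto (fun N : ℕ => U N / Real.log (c / (α : ℝ) ^ N)) atTop (nhds (dLow α p m)) := by
    have := h1.div h2 (by linarith)
    have e : dLow α p m = (Real.log (1 - p) - Real.log (1 - p ^ (α - 1)) + m * Real.log p)
        / -Real.log α := by
      unfold dLow dBar; rw [Real.log_inv]; ring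
    rw [e]
    refine this.congr' ?_
    filter_upwards [eventually_gt_atTop 0] with N hN
    have : (N : ℝ) ≠ 0 := by positivity
    simp only [Pi.div_apply]
    rw [div_div_div_cancel_right₀ this]
  have h4 : Tendsto (fun N : ℕ => c / (α : ℝ) ^ N) atTop (nhdsWithin (0 : ℝ) (Ioi 0)) := by
    refine tendsto_nhdsWithin_iff.2 ⟨?_, Eventually.of_forall fun N => ?_⟩
    · exact tendsto_const_nhds.div_atTop (tendsto_pow_atTop_atTop_of_one_lt (by linarith))
    · exact div_pos hc0 (by positivity)
  refine h4.frequently ?_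
  have hlt1 : ∀ᶠ N : ℕ in atTop, c / (α : ℝ) ^ N < 1 :=
    (tendsto_nhdsWithin_iff.1 h4).1.eventually_lt_const zero_lt_one
  refine (hc.and_eventually ((h3.eventually_const_lt hd).and hlt1)).mono ?_
  rintro N ⟨hN, hN1, hN2⟩
  refine hN1.le.trans ?_
  have hr0 : 0 < c / (α : ℝ) ^ N := div_pos hc0 (by positivity)
  have b1 : Real.log (π.real (Metric.ball x (c / (α : ℝ) ^ N))) ≤ U N :=
    (Real.log_le_log (H.ball_pos hβ hx hr0)
      (measureReal_mono (H.sub_JJ hx hN) (measure_ne_top _ _))).trans (hC x N)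
  exact div_le_div_of_nonpos_of_le (Real.log_neg hr0 hN2).le b1

theorem final_thm (H : PHyp α β p π) {t : ℕ} (hβ : β = α ^ t) :
    dLow α p (∑ i ∈ Finset.range α, (i : ℝ) * xi α π i) ≤
        sSup {s : ℝ | ∀ᵐ x ∂π, s ≤ upperLocalDim π x} ∧
      sSup {s : ℝ | ∀ᵐ x ∂π, s ≤ upperLocalDim π x} ≤
        sInf {s : ℝ | ∀ᵐ x ∂π, upperLocalDim π x ≤ s} ∧
      sInf {s : ℝ | ∀ᵐ x ∂π, upperLocalDim π x ≤ s} ≤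
        dBar α p (∑ i ∈ Finset.range α, (i : ℝ) * xi α π i) := by
  have := H.prob
  rw [H.sum_xi]
  obtain ⟨c, hc0, hc⟩ := H.freq_dz hβ
  have hlow : ∀ᵐ x ∂π, dLow α p (∫ x, dg α x ∂π) ≤ upperLocalDim π x := by
    filter_upwards [hc, H.ae_nonneg, H.sd_lim hβ] with x h1 h2 h3
    exact H.lower_dim hβ h2 h3 hc0 h1
  have hup : ∀ᵐ x ∂π, upperLocalDim π x ≤ dBar α p (∫ x, dg α x ∂π) := by
    filter_upwards [H.ae_nonneg, H.sd_lim hβ] with x h2 h3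
    exact H.upper_dim hβ h2 h3
  have hcmp : ∀ s ∈ {s : ℝ | ∀ᵐ x ∂π, s ≤ upperLocalDim π x},
      ∀ u ∈ {s : ℝ | ∀ᵐ x ∂π, upperLocalDim π x ≤ s}, s ≤ u := by
    intro s hs u hu
    have hs : ∀ᵐ x ∂π, s ≤ upperLocalDim π x := hs
    have hu : ∀ᵐ x ∂π, upperLocalDim π x ≤ u := hu
    obtain ⟨x, h1, h2⟩ := (hs.and hu).exists
    exact h1.trans h2
  refine ⟨le_csSup ⟨_, fun s hs => hcmp s hs _ hup⟩ hlow, ?_,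
    csInf_le ⟨_, fun u hu => hcmp _ hlow u hu⟩ hup⟩
  exact csSup_le ⟨_, hlow⟩ fun s hs => le_csInf ⟨_, hup⟩ fun u hu => hcmp s hs u hu


end PHyp

/-- Remark on packing dimensions: if `β = α^t` and `p ≤ 1/2`, then
`d̲(Σ i·ξ_i) ≤ dim_P π ≤ dim_P^* π ≤ d̄(Σ i·ξ_i)`, where
`dim_P π = sup{s : dim̄π(x) ≥ s for π-a.e. x}` and
`dim_P^* π = inf{s : dim̄π(x) ≤ s for π-a.e. x}`. -/
theorem stmt16 (α β t : ℕ) (hα : 2 ≤ α) (hβ : β = α ^ t) (p : ℝ) (hp0 : 0 < p)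
    (hp : p ≤ 1 / 2)
    (π : Measure ℝ) [IsProbabilityMeasure π] (hsupp : π (Ici (0 : ℝ)) = 1)
    (hinv : ∀ A : Set ℝ, MeasurableSet A →
      π A = ENNReal.ofReal p * π ((fun y => y + (β : ℝ)) ⁻¹' A)
          + ENNReal.ofReal (1 - p) * π ((fun y => y / (α : ℝ)) ⁻¹' A)) :
    dLow α p (∑ i ∈ Finset.range α, (i : ℝ) * xi α π i) ≤
        sSup {s : ℝ | ∀ᵐ x ∂π, s ≤ upperLocalDim π x} ∧
      sSup {s : ℝ | ∀ᵐ x ∂π, s ≤ upperLocalDim π x} ≤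
        sInf {s : ℝ | ∀ᵐ x ∂π, upperLocalDim π x ≤ s} ∧
      sInf {s : ℝ | ∀ᵐ x ∂π, upperLocalDim π x ≤ s} ≤
        dBar α p (∑ i ∈ Finset.range α, (i : ℝ) * xi α π i) := by
  have H : PHyp α β p π :=
    { ha := hα
      hb := by rw [hβ]; exact Nat.one_le_pow _ _ (by omega)
      p0 := hp0
      p1 := hp
      prob := inferInstance
      supp := hsupp
      inv := hinv }
  exact H.final_thm hβ
end
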